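/- There exist absolute constants C > 0 and y₀ ≥ 2 such that the following holds for all y ≥ y₀. Let χ be a Dirichlet character modulo q, and let ξ be a primitive Dirichlet character of conductor D ≤ log y satisfying 𝔻(χ, ξ; y) ≤ 𝔻(χ, ψ₁; y) for every primitive Dirichlet character ψ₁ of conductor at most log y. Let z ≥ 1 be real and let a, b be coprime integers with 1 ≤ b ≤ (log y)^{1/100} and gcd(b, q) = 1. If D ∤ b or χ(−1)·ξ(−1) = 1, then |∑_{1 ≤ |n| ≤ z, P⁺(|n|) ≤ y} χ(n)·e(na/b)/n| ≤ C·(log y)^{0.86}. If D ∣ b and χ(−1)·ξ(−1) = −1, then |∑_{1 ≤ |n| ≤ z, P⁺(|n|) ≤ y} χ(n)·e(na/b)/n| ≤ (log y)·min{(2·e^γ/√D)·(2/3)^{ω(b/D)}, exp(−𝔻(χ, ξ; y)²/2 + C)} + C·(log y)^{0.86}, where ω(m) is the number of distinct prime divisors of m. -/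

import Mathlib

open Real Complex MeasureTheory
open scoped BigOperators

attribute [local instance] Classical.propDecidable

/-- `e(x) = exp(2πix)` -/
noncomputable def e2pi (x : ℝ) : ℂ := Complex.exp (2 * Real.pi * Complex.I * x)

/-- `∑_{n ≤ x} χ(n)` -/
noncomputable def charSum {q : ℕ} (χ : DirichletCharacter ℂ q) (x : ℝ) : ℂ :=
  ∑ n ∈ Finset.Icc 1 ⌊x⌋₊, χ (n : ZMod q)

/-- `M(χ) = max_{1 ≤ N ≤ q} |∑_{n ≤ N} χ(n)|` -/
noncomputable def Mchi {q : ℕ} (χ : DirichletCharacter ℂ q) : ℝ :=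
  ⨆ N ∈ Finset.Icc 1 q, ‖charSum χ (N : ℝ)‖

/-- `m(χ) = π M(χ)/(e^γ √q)` -/
noncomputable def mchi {q : ℕ} (χ : DirichletCharacter ℂ q) : ℝ :=
  Real.pi * Mchi χ / (Real.exp Real.eulerMascheroniConstant * Real.sqrt q)

/-- the modified Bessel function `I₀` -/
noncomputable def I0 (t : ℝ) : ℝ := ∑' n : ℕ, (t ^ 2 / 4) ^ n / ((n.factorial : ℝ)) ^ 2

/-- the constant `A` -/
noncomputable def Aconst : ℝ :=
  Real.log 2 - 1 - (∫ t in (0:ℝ)..2, Real.log (I0 t) / t ^ 2)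
    - ∫ t in Set.Ioi (2:ℝ), (Real.log (I0 t) - t) / t ^ 2

/-- `Φ_q(τ)` -/
noncomputable def Phi (q : ℕ) (τ : ℝ) : ℝ :=
  (Nat.card {χ : DirichletCharacter ℂ q // χ ≠ 1 ∧ τ < mchi χ} : ℝ) / q.totient

/-- `S_𝒜(χ) = max_{α ∈ [0,1]} |∑_{n ∈ 𝒜} χ(n) e(nα)/n|` -/
noncomputable def SA {q : ℕ} (χ : DirichletCharacter ℂ q) (A : Finset ℕ) : ℝ :=
  ⨆ α : Set.Icc (0:ℝ) 1, ‖∑ n ∈ A, χ (n : ZMod q) * e2pi (n * (α : ℝ)) / n‖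

/-- `S_{y,z}(χ)` -/
noncomputable def Syz {q : ℕ} (χ : DirichletCharacter ℂ q) (y z : ℝ) : ℝ :=
  SA χ ((Finset.Icc 1 ⌊z⌋₊).filter fun n => ∃ p : ℕ, p.Prime ∧ p ∣ n ∧ y < (p : ℝ))

/-- `L(1,χ)` -/
noncomputable def Lone {q : ℕ} (χ : DirichletCharacter ℂ q) : ℂ :=
  ∑' n : ℕ, χ (n : ZMod q) / n

/-- the Gauss sum `G(χ) = ∑_{a=1}^{q} χ(a) e(a/q)` -/
noncomputable def gaussS {q : ℕ} (χ : DirichletCharacter ℂ q) : ℂ :=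
  ∑ a ∈ Finset.Icc 1 q, χ (a : ZMod q) * e2pi ((a : ℝ) / q)

/-- the pretentious distance `𝔻(χ, ξ; y)` -/
noncomputable def Ddist {q D : ℕ} (χ : DirichletCharacter ℂ q) (ξ : DirichletCharacter ℂ D)
    (y : ℝ) : ℝ :=
  Real.sqrt (∑ p ∈ (Finset.Icc 1 ⌊y⌋₊).filter Nat.Prime,
    (1 - (χ (p : ZMod q) * (starRingEnd ℂ) (ξ (p : ZMod D))).re) / p)

/-- The primes up to `N`. -/
abbrev primesUpTo (N : ℕ) : Finset ℕ := (Finset.Icc 1 N).filter Nat.Prime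

theorem Icc_one_eq_Ioc_zero (N : ℕ) : Finset.Icc 1 N = Finset.Ioc 0 N := by
  ext; simp only [Finset.mem_Icc, Finset.mem_Ioc]; omega

theorem mul_log_sub_le_log_factorial (N : ℕ) :
    N * Real.log N - N ≤ Real.log (N.factorial : ℝ) := by
  rcases Nat.eq_zero_or_pos N with rfl | hN
  · simp
  have h := Real.pow_div_factorial_le_exp (x := (N : ℝ)) (Nat.cast_nonneg N) N
  have hN' : (0 : ℝ) < N := by exact_mod_cast hN
  have hf : (0 : ℝ) < N.factorial := by exact_mod_cast N.factorial_pos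
  have h2 := Real.log_le_log (by positivity) h
  rw [Real.log_div (by positivity) (by positivity), Real.log_pow, Real.log_exp] at h2
  linarith

theorem log_factorial_eq_sum_vonMangoldt (N : ℕ) :
    Real.log (N.factorial : ℝ) =
      ∑ n ∈ Finset.Icc 1 N, ArithmeticFunction.vonMangoldt n * ((N / n : ℕ) : ℝ) := by
  rw [Icc_one_eq_Ioc_zero, ← ArithmeticFunction.sum_Ioc_mul_zeta_eq_sum,
    ArithmeticFunction.vonMangoldt_mul_zeta]
  induction N with
  | zero => simp
  | succ n ih =>
    rw [Nat.factorial_succ, Finset.sum_Ioc_succ_top (Nat.zero_le n), ← ih]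
    push_cast
    rw [Real.log_mul (by positivity) (by positivity), ArithmeticFunction.log_apply]
    push_cast; ring

/-- Mertens' first theorem, for the von Mangoldt function. -/
theorem exists_abs_sum_vonMangoldt_div_sub_log_le :
    ∃ C : ℝ, 0 < C ∧ ∀ N : ℕ, 1 ≤ N →
      |∑ n ∈ Finset.Icc 1 N, ArithmeticFunction.vonMangoldt n / n - Real.log N| ≤ C := by
  refine ⟨Real.log 4 + 4, by positivity, fun N hN => ?_⟩
  have hN' : (0 : ℝ) < N := by exact_mod_cast hN
  have hfac := log_factorial_eq_sum_vonMangoldt N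
  have hpsi := Chebyshev.psi_le_const_mul_self (x := (N : ℝ)) hN'.le
  have hpsi' : Chebyshev.psi N = ∑ n ∈ Finset.Icc 1 N, ArithmeticFunction.vonMangoldt n := by
    rw [Chebyshev.psi, Nat.floor_natCast, Icc_one_eq_Ioc_zero]
  have hlow : Real.log (N.factorial : ℝ) ≤
      N * ∑ n ∈ Finset.Icc 1 N, ArithmeticFunction.vonMangoldt n / n := by
    rw [hfac, Finset.mul_sum]
    refine Finset.sum_le_sum fun n hn => ?_
    have : (((N / n : ℕ)) : ℝ) ≤ N / n := Nat.cast_div_le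
    calc _ ≤ ArithmeticFunction.vonMangoldt n * ((N : ℝ) / n) :=
          mul_le_mul_of_nonneg_left this ArithmeticFunction.vonMangoldt_nonneg
      _ = _ := by ring
  have hup : N * ∑ n ∈ Finset.Icc 1 N, ArithmeticFunction.vonMangoldt n / n ≤
      Real.log (N.factorial : ℝ) + Chebyshev.psi N := by
    rw [hfac, Finset.mul_sum, hpsi', ← Finset.sum_add_distrib]
    refine Finset.sum_le_sum fun n hn => ?_
    have : (N : ℝ) / n ≤ ((N / n : ℕ) : ℝ) + 1 := by
      rw [← Nat.floor_div_eq_div (K := ℝ)]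
      exact (Nat.lt_floor_add_one _).le
    calc _ = ArithmeticFunction.vonMangoldt n * ((N : ℝ) / n) := by ring
      _ ≤ ArithmeticFunction.vonMangoldt n * (((N / n : ℕ) : ℝ) + 1) :=
          mul_le_mul_of_nonneg_left this ArithmeticFunction.vonMangoldt_nonneg
      _ = _ := by ring
  have h1 := mul_log_sub_le_log_factorial N
  have h2 : Real.log (N.factorial : ℝ) ≤ N * Real.log N := by
    rw [← Real.log_pow]
    exact Real.log_le_log (by positivity) (by exact_mod_cast Nat.factorial_le_pow N)
  have h4 : 0 < Real.log 4 := by positivity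
  rw [abs_le]
  constructor
  · have : (N : ℝ) * (Real.log N - 1) ≤
        N * ∑ n ∈ Finset.Icc 1 N, ArithmeticFunction.vonMangoldt n / n := by linarith
    have := le_of_mul_le_mul_left this hN'
    linarith
  · have : N * ∑ n ∈ Finset.Icc 1 N, ArithmeticFunction.vonMangoldt n / n ≤
        (N : ℝ) * (Real.log N + (Real.log 4 + 4)) := by linarith
    have := le_of_mul_le_mul_left this hN'
    linarith

/-- `∑_{n ≤ N} Λ(n)/(n log n)`. -/
noncomputable def sumMangoldtDivLog (N : ℕ) : ℝ :=
  ∑ n ∈ Finset.Icc 1 N, ArithmeticFunction.vonMangoldt n / (n * Real.log n)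

theorem abs_div_sub_log_div_le {a b : ℝ} (ha : 0 < a) (hab : a ≤ b) (h1 : b - a ≤ 1) :
    |(b - a) / b - (Real.log b - Real.log a)| ≤ 1 / a - 1 / b := by
  have hb : 0 < b := ha.trans_le hab
  have h2 : Real.log b - Real.log a ≤ b / a - 1 := by
    rw [← Real.log_div hb.ne' ha.ne']; exact Real.log_le_sub_one_of_pos (by positivity)
  have h3 : Real.log a - Real.log b ≤ a / b - 1 := by
    rw [← Real.log_div ha.ne' hb.ne']; exact Real.log_le_sub_one_of_pos (by positivity)
  have h4 : (b - a) / b = 1 - a / b := by field_simp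
  have h5 : b / a - 1 = (b - a) / a := by field_simp
  have h6 : (b - a) / a - (b - a) / b ≤ 1 / a - 1 / b := by
    have : (b - a) / a - (b - a) / b = (b - a) * (1 / a - 1 / b) := by ring
    rw [this]
    have : 0 ≤ 1 / a - 1 / b := sub_nonneg.2 (one_div_le_one_div_of_le ha hab)
    nlinarith
  rw [abs_le]; constructor <;> linarith [sub_nonneg.2 (one_div_le_one_div_of_le ha hab)]

theorem exists_abs_sumMangoldtDivLog_sub_le :
    ∃ c C : ℝ, 0 < C ∧ ∀ N : ℕ, 2 ≤ N →
      |sumMangoldtDivLog N - Real.log (Real.log N) - c| ≤ C / Real.log N := by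
  obtain ⟨C, hC, hR⟩ := exists_abs_sum_vonMangoldt_div_sub_log_le
  set R : ℕ → ℝ := fun N =>
    ∑ n ∈ Finset.Icc 1 N, ArithmeticFunction.vonMangoldt n / n - Real.log N with hRdef
  set E : ℕ → ℝ := fun N => sumMangoldtDivLog N - Real.log (Real.log N) - R N / Real.log N with hE
  have hlog : ∀ n : ℕ, 2 ≤ n → 0 < Real.log n := fun n hn =>
    Real.log_pos (by exact_mod_cast hn)
  have hstep : ∀ n : ℕ, 2 ≤ n →
      |E (n + 1) - E n| ≤ (1 + C) * (1 / Real.log n - 1 / Real.log (n + 1 : ℕ)) := by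
    intro n hn
    have hn0 : (0 : ℝ) < n := by positivity
    have hl := hlog n hn
    have hl' := hlog (n + 1) (by omega)
    have hle : Real.log n ≤ Real.log (n + 1 : ℕ) := Real.log_le_log hn0 (by simp)
    have hd : Real.log (n + 1 : ℕ) - Real.log n ≤ 1 := by
      rw [← Real.log_div (by positivity) (by positivity)]
      refine (Real.log_le_sub_one_of_pos (by positivity)).trans ?_
      rw [sub_le_iff_le_add, div_le_iff₀ hn0]
      push_cast
      have : (2 : ℝ) ≤ n := by exact_mod_cast hn
      linarith
    have hB : sumMangoldtDivLog (n + 1) = sumMangoldtDivLog n +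
        ArithmeticFunction.vonMangoldt (n + 1) / ((n + 1 : ℕ) * Real.log (n + 1 : ℕ)) := by
      rw [sumMangoldtDivLog, Finset.sum_Icc_succ_top (by omega)]; rfl
    have hRs : R (n + 1) = R n + ArithmeticFunction.vonMangoldt (n + 1) / (n + 1 : ℕ) +
        Real.log n - Real.log (n + 1 : ℕ) := by
      simp only [hRdef]
      rw [Finset.sum_Icc_succ_top (by omega)]; ring
    have key : E (n + 1) - E n =
        ((Real.log (n + 1 : ℕ) - Real.log n) / Real.log (n + 1 : ℕ) -
          (Real.log (Real.log (n + 1 : ℕ)) - Real.log (Real.log n))) +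
        R n * (1 / Real.log n - 1 / Real.log (n + 1 : ℕ)) := by
      simp only [hE]
      rw [hB, hRs]
      have : ((n + 1 : ℕ) : ℝ) ≠ 0 := by positivity
      field_simp
      ring
    rw [key]
    refine (abs_add_le _ _).trans ?_
    have hmono : 0 ≤ 1 / Real.log n - 1 / Real.log (n + 1 : ℕ) :=
      sub_nonneg.2 (one_div_le_one_div_of_le hl hle)
    have h1 := abs_div_sub_log_div_le hl hle hd
    have h2 : |R n * (1 / Real.log n - 1 / Real.log (n + 1 : ℕ))| ≤
        C * (1 / Real.log n - 1 / Real.log (n + 1 : ℕ)) := by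
      rw [abs_mul, abs_of_nonneg hmono]
      exact mul_le_mul_of_nonneg_right (hR n (by omega)) hmono
    linarith
  set K := 1 + C
  have htel : ∀ M : ℕ, 2 ≤ M → ∀ N : ℕ, M ≤ N →
      |E N - E M| ≤ K * (1 / Real.log M - 1 / Real.log N) := by
    intro M hM N hN
    induction N, hN using Nat.le_induction with
    | base => simp
    | succ n hn ih =>
      have := hstep n (by omega)
      have h3 : E (n + 1) - E M = (E (n + 1) - E n) + (E n - E M) := by ring
      rw [h3]
      refine (abs_add_le _ _).trans ((add_le_add this ih).trans (le_of_eq (by ring)))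
  have hK : 0 < K := by positivity
  have hVU : ∀ M N : ℕ, 2 ≤ M → 2 ≤ N → E M - K / Real.log M ≤ E N + K / Real.log N := by
    intro M N hM hN
    have hpM : 0 < K / Real.log M := div_pos hK (hlog M hM)
    have hpN : 0 < K / Real.log N := div_pos hK (hlog N hN)
    rcases le_total M N with h | h
    · have := htel M hM N h
      rw [mul_sub, mul_one_div, mul_one_div] at this
      linarith [(abs_le.1 this).1]
    · have := htel N hN M h
      rw [mul_sub, mul_one_div, mul_one_div] at this
      linarith [(abs_le.1 this).2]
  refine ⟨⨅ n : ℕ, (E (n + 2) + K / Real.log (n + 2 : ℕ)), K + C, by positivity, fun N hN => ?_⟩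
  have hup : ⨅ n : ℕ, (E (n + 2) + K / Real.log (n + 2 : ℕ)) ≤ E N + K / Real.log N := by
    obtain ⟨m, rfl⟩ := Nat.exists_eq_add_of_le' hN
    exact ciInf_le (f := fun n : ℕ => E (n + 2) + K / Real.log (n + 2 : ℕ))
      ⟨E 2 - K / Real.log (2 : ℕ), by
        rintro _ ⟨n, rfl⟩; exact hVU 2 (n + 2) le_rfl (by omega)⟩ m
  have hlo : E N - K / Real.log N ≤ ⨅ n : ℕ, (E (n + 2) + K / Real.log (n + 2 : ℕ)) :=
    le_ciInf fun n => hVU N (n + 2) hN (by omega)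
  have hRN : |R N / Real.log N| ≤ C / Real.log N := by
    rw [abs_div, abs_of_pos (hlog N hN)]
    exact div_le_div_of_nonneg_right (hR N (by omega)) (hlog N hN).le
  have hEN : sumMangoldtDivLog N - Real.log (Real.log N) = E N + R N / Real.log N := by
    simp only [hE]; ring
  rw [hEN, add_div, abs_le]
  have := abs_le.1 hRN
  constructor <;> linarith [this.1, this.2]

theorem integral_log_mul_exp_neg :
    ∫ t in Set.Ioi (0 : ℝ), Real.log t * Real.exp (-t) = -Real.eulerMascheroniConstant := by
  have h1 := Complex.hasDerivAt_GammaIntegral (s := 1) (by simp)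
  have h2 := Complex.hasDerivAt_Gamma_one
  have h3 : Complex.Gamma =ᶠ[nhds 1] Complex.GammaIntegral := by
    have : {s : ℂ | 0 < s.re} ∈ nhds (1 : ℂ) :=
      (isOpen_lt continuous_const Complex.continuous_re).mem_nhds (by simp)
    filter_upwards [this] with s hs using Complex.Gamma_eq_integral hs
  have h4 := (h1.congr_of_eventuallyEq h3).unique h2
  simp only [sub_self, Complex.cpow_zero, one_mul] at h4
  have h5 : ((∫ t in Set.Ioi (0 : ℝ), Real.log t * Real.exp (-t) : ℝ) : ℂ) =
      ((-Real.eulerMascheroniConstant : ℝ) : ℂ) := by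
    rw [← integral_complex_ofReal]
    push_cast at h4 ⊢
    exact h4
  exact_mod_cast h5

theorem integrableOn_log_mul_exp_neg :
    IntegrableOn (fun t : ℝ => Real.log t * Real.exp (-t)) (Set.Ioi 0) := by
  by_contra h
  have h1 := integral_log_mul_exp_neg
  rw [integral_undef h] at h1
  have := Real.one_half_lt_eulerMascheroniConstant
  linarith

theorem integral_exp_neg_mul_sumMangoldtDivLog {σ : ℝ} (hσ : 0 < σ) :
    IntegrableOn (fun u : ℝ => Real.exp (-u) * sumMangoldtDivLog ⌊Real.exp (u / σ)⌋₊) (Set.Ioi 0) ∧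
    ∫ u in Set.Ioi (0 : ℝ), Real.exp (-u) * sumMangoldtDivLog ⌊Real.exp (u / σ)⌋₊ =
      Real.log (riemannZeta ((1 + σ : ℝ) : ℂ)).re := by
  set a : ℕ → ℝ := fun n => ArithmeticFunction.vonMangoldt n / (n * Real.log n) with ha
  have ha0 : ∀ n, 0 ≤ a n := fun n => div_nonneg ArithmeticFunction.vonMangoldt_nonneg
    (mul_nonneg (Nat.cast_nonneg n) (Real.log_natCast_nonneg n))
  set F : ℕ → ℝ → ℝ := fun n => Set.indicator (Set.Ici (σ * Real.log n))
    (fun u => a n * Real.exp (-u)) with hF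
  have hnn : ∀ n : ℕ, 0 ≤ σ * Real.log n := fun n => mul_nonneg hσ.le (Real.log_natCast_nonneg n)
  have hFint : ∀ n, IntegrableOn (F n) (Set.Ioi 0) := by
    intro n
    refine IntegrableOn.indicator ?_ measurableSet_Ici
    exact (integrableOn_exp_neg_Ioi 0).const_mul _
  have hFval : ∀ n, ∫ u in Set.Ioi (0 : ℝ), F n u =
      ArithmeticFunction.vonMangoldt n / ((n : ℝ) ^ (1 + σ) * Real.log n) := by
    intro n
    have hset : (Set.Ioi (0 : ℝ) ∩ Set.Ici (σ * Real.log n) : Set ℝ) =ᵐ[volume]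
        (Set.Ioi (σ * Real.log n) : Set ℝ) := by
      have h := (Filter.EventuallyEq.refl (ae volume) (Set.Ioi (0 : ℝ))).inter
        (Ioi_ae_eq_Ici (μ := volume) (a := σ * Real.log n)).symm
      rwa [Set.Ioi_inter_Ioi, max_eq_right (hnn n)] at h
    rw [setIntegral_indicator measurableSet_Ici, setIntegral_congr_set hset,
      integral_const_mul, integral_exp_neg_Ioi]
    rcases Nat.eq_zero_or_pos n with rfl | hn
    · simp [ha]
    · have hn' : (0 : ℝ) < n := by exact_mod_cast hn
      rw [Real.rpow_add hn', Real.rpow_one, Real.rpow_def_of_pos hn' σ, ha,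
        show -(σ * Real.log n) = -(Real.log n * σ) by ring, Real.exp_neg]
      simp only
      rw [div_mul_eq_mul_div, ← div_eq_mul_inv, div_div]
      congr 1; ring
  have hFnorm : ∀ n u, ‖F n u‖ = F n u := by
    intro n u
    rw [Real.norm_of_nonneg]
    exact Set.indicator_nonneg (fun u _ => mul_nonneg (ha0 n) (Real.exp_pos _).le) u
  have hsum : Summable fun n : ℕ =>
      ArithmeticFunction.vonMangoldt n / ((n : ℝ) ^ (1 + σ) * Real.log n) := by
    have h1 : Summable fun n : ℕ => 1 / (n : ℝ) ^ (1 + σ) :=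
      Real.summable_one_div_nat_rpow.2 (by linarith)
    refine Summable.of_nonneg_of_le (fun n => div_nonneg ArithmeticFunction.vonMangoldt_nonneg
      (mul_nonneg (by positivity) (Real.log_natCast_nonneg n))) (fun n => ?_) h1
    rw [mul_comm, ← div_div]
    refine div_le_div_of_nonneg_right ?_ (by positivity)
    exact div_le_one_of_le₀ ArithmeticFunction.vonMangoldt_le_log (Real.log_natCast_nonneg n)
  have hmem : ∀ (u : ℝ) (n : ℕ), 1 ≤ n →
      (u ∈ Set.Ici (σ * Real.log n) ↔ n ≤ ⌊Real.exp (u / σ)⌋₊) := by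
    intro u n hn
    rw [Nat.le_floor_iff (Real.exp_pos _).le, ← Real.log_le_iff_le_exp (by exact_mod_cast hn),
      le_div_iff₀ hσ, Set.mem_Ici, mul_comm]
  have hpt : ∀ u, HasSum (fun n => F n u)
      (Real.exp (-u) * sumMangoldtDivLog ⌊Real.exp (u / σ)⌋₊) := by
    intro u
    have h1 : Real.exp (-u) * sumMangoldtDivLog ⌊Real.exp (u / σ)⌋₊ =
        ∑ n ∈ Finset.Icc 1 ⌊Real.exp (u / σ)⌋₊, F n u := by
      rw [sumMangoldtDivLog, Finset.mul_sum]
      refine Finset.sum_congr rfl fun n hn => ?_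
      rw [Finset.mem_Icc] at hn
      rw [hF]
      simp only
      rw [Set.indicator_of_mem ((hmem u n hn.1).2 hn.2), mul_comm]
    rw [h1]
    refine hasSum_sum_of_ne_finset_zero fun n hn => ?_
    rcases Nat.eq_zero_or_pos n with rfl | hn0
    · simp [hF, ha]
    · rw [hF]
      simp only
      refine Set.indicator_of_notMem (fun h => hn ?_) _
      exact Finset.mem_Icc.2 ⟨hn0, (hmem u n hn0).1 h⟩
  have hS : Summable fun n => ∫ u in Set.Ioi (0 : ℝ), ‖F n u‖ := by
    simpa only [hFnorm, hFval] using hsum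
  have key := hasSum_integral_of_summable_integral_norm (F := F) hFint hS
  have hlog := log_riemannZeta_eq (s := 1 + σ) (by linarith)
  simp only [hFval, fun u => (hpt u).tsum_eq] at key
  have hval : ∫ u in Set.Ioi (0 : ℝ), Real.exp (-u) * sumMangoldtDivLog ⌊Real.exp (u / σ)⌋₊ =
      Real.log (riemannZeta ((1 + σ : ℝ) : ℂ)).re := by
    rw [← key.tsum_eq, hlog]
  refine ⟨?_, hval⟩
  by_contra hni
  have h0 := integral_undef hni
  rw [h0] at key
  have hz := (hasSum_zero_iff_of_nonneg (fun n => div_nonneg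
    ArithmeticFunction.vonMangoldt_nonneg
      (mul_nonneg (by positivity) (Real.log_natCast_nonneg n)))).1 key
  have h2 := congrFun hz 2
  have hl2 := Real.log_pos one_lt_two
  simp only [Pi.zero_apply, ArithmeticFunction.vonMangoldt_apply_prime Nat.prime_two] at h2
  have : 0 < Real.log (2 : ℕ) / (((2 : ℕ) : ℝ) ^ (1 + σ) * Real.log (2 : ℕ)) := by
    push_cast; positivity
  linarith

theorem tendsto_log_zeta_add_log :
    Filter.Tendsto (fun k : ℕ => Real.log (riemannZeta ((1 + 1 / ((k : ℝ) + 1) : ℝ) : ℂ)).re +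
      Real.log (1 / ((k : ℝ) + 1))) Filter.atTop (nhds 0) := by
  have h := (Asymptotics.isLittleO_one_iff ℝ).1 log_riemannZeta_add_log_sub_isLittleO_ofReal
  have h2 : Filter.Tendsto (fun k : ℕ => 1 + 1 / ((k : ℝ) + 1)) Filter.atTop
      (nhdsWithin 1 (Set.Ioi 1)) := by
    rw [tendsto_nhdsWithin_iff]
    refine ⟨by simpa using (tendsto_one_div_add_atTop_nhds_zero_nat (𝕜 := ℝ)).const_add 1, ?_⟩
    filter_upwards with k
    have : 0 < 1 / ((k : ℝ) + 1) := by positivity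
    simp only [Set.mem_Ioi]; linarith
  simpa [Function.comp_def] using h.comp h2

theorem abs_log_sub_log_log_floor_exp_le {x : ℝ} (hN : 2 ≤ ⌊Real.exp x⌋₊) :
    |Real.log x - Real.log (Real.log ⌊Real.exp x⌋₊)| ≤ 1 / Real.log ⌊Real.exp x⌋₊ := by
  set N := ⌊Real.exp x⌋₊ with hNdef
  have hN2 : (2 : ℝ) ≤ N := by exact_mod_cast hN
  have hlN : 0 < Real.log N := Real.log_pos (by linarith)
  have h1 : Real.log N ≤ x := by
    rw [Real.log_le_iff_le_exp (by linarith)]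
    exact Nat.floor_le (Real.exp_pos _).le
  have h2 : x ≤ Real.log N + 1 := by
    have h3 : Real.exp x ≤ N * 2 := by
      have := Nat.lt_floor_add_one (Real.exp x)
      rw [← hNdef] at this
      linarith
    have h4 := Real.log_le_log (Real.exp_pos x) h3
    rw [Real.log_exp, Real.log_mul (by linarith) (by norm_num)] at h4
    have := Real.log_two_lt_d9
    linarith
  have hx : 0 < x := hlN.trans_le h1
  have h5 : Real.log (Real.log N) ≤ Real.log x := Real.log_le_log hlN h1
  rw [abs_of_nonneg (by linarith), ← Real.log_div hx.ne' hlN.ne']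
  refine (Real.log_le_sub_one_of_pos (by positivity)).trans ?_
  rw [div_sub_one hlN.ne']
  gcongr
  linarith

theorem tendsto_floor_exp_div {u : ℝ} (hu : 0 < u) :
    Filter.Tendsto (fun k : ℕ => ⌊Real.exp (u / (1 / ((k : ℝ) + 1)))⌋₊) Filter.atTop
      Filter.atTop := by
  refine tendsto_nat_floor_atTop.comp (Real.tendsto_exp_atTop.comp ?_)
  have h : (fun k : ℕ => u / (1 / ((k : ℝ) + 1))) = fun k : ℕ => u * ((k : ℝ) + 1) := by
    ext k; field_simp
  rw [h]
  exact Filter.Tendsto.const_mul_atTop hu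
    (Filter.tendsto_atTop_add_const_right _ _ tendsto_natCast_atTop_atTop)

theorem exists_abs_sumMangoldtDivLog_sub_log_log_sub_eulerMascheroniConstant_le :
    ∃ C, 0 < C ∧ ∀ N : ℕ, 2 ≤ N → |sumMangoldtDivLog N - Real.log (Real.log N) -
      Real.eulerMascheroniConstant| ≤ C / Real.log N := by
  obtain ⟨c, C, hC, h⟩ := exists_abs_sumMangoldtDivLog_sub_le
  suffices hc : c = Real.eulerMascheroniConstant by exact ⟨C, hC, hc ▸ h⟩
  set σ : ℕ → ℝ := fun k => 1 / ((k : ℝ) + 1) with hσ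
  have hσ0 : ∀ k, 0 < σ k := fun k => by positivity
  have hσ1 : ∀ k, σ k ≤ 1 := fun k => by
    rw [hσ]; simp only
    rw [div_le_one (by positivity)]
    linarith [(Nat.cast_nonneg k : (0 : ℝ) ≤ k)]
  set G : ℕ → ℝ → ℝ := fun k u =>
    Real.exp (-u) * sumMangoldtDivLog ⌊Real.exp (u / σ k)⌋₊ + Real.log (σ k) * Real.exp (-u) with hG
  have hclose : ∀ k u, 0 < u → 2 ≤ ⌊Real.exp (u / σ k)⌋₊ →
      |sumMangoldtDivLog ⌊Real.exp (u / σ k)⌋₊ + Real.log (σ k) - (Real.log u + c)| ≤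
        (C + 1) / Real.log ⌊Real.exp (u / σ k)⌋₊ := by
    intro k u hu hN
    have h1 := h _ hN
    have h2 := abs_log_sub_log_log_floor_exp_le hN
    rw [Real.log_div hu.ne' (hσ0 k).ne'] at h2
    rw [add_div]
    rw [abs_le] at *
    constructor <;> linarith [h1.1, h1.2, h2.1, h2.2]
  have hGi : ∀ k, IntegrableOn (G k) (Set.Ioi 0) := fun k =>
    (integral_exp_neg_mul_sumMangoldtDivLog (hσ0 k)).1.add
      ((integrableOn_exp_neg_Ioi 0).const_mul _)
  have hGv : ∀ k, ∫ u in Set.Ioi (0 : ℝ), G k u =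
      Real.log (riemannZeta ((1 + σ k : ℝ) : ℂ)).re + Real.log (σ k) := by
    intro k
    have := integral_add (integral_exp_neg_mul_sumMangoldtDivLog (hσ0 k)).1
      ((integrableOn_exp_neg_Ioi 0).const_mul (Real.log (σ k)))
    rw [(integral_exp_neg_mul_sumMangoldtDivLog (hσ0 k)).2, integral_const_mul,
      integral_exp_neg_Ioi_zero, mul_one] at this
    exact this
  set K : ℝ := |c| + (C + 1) / Real.log 2 with hK
  have hlog2 := Real.log_pos one_lt_two
  have hK0 : 0 ≤ K := by positivity
  have hdom : ∀ k, ∀ u ∈ Set.Ioi (0 : ℝ), ‖G k u‖ ≤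
      ‖Real.log u * Real.exp (-u)‖ + K * Real.exp (-u) := by
    intro k u hu
    rw [Set.mem_Ioi] at hu
    have hre : G k u = (sumMangoldtDivLog ⌊Real.exp (u / σ k)⌋₊ + Real.log (σ k)) *
      Real.exp (-u) := by rw [hG]; ring
    rw [hre, norm_mul, norm_mul, Real.norm_of_nonneg (Real.exp_pos (-u)).le, ← add_mul,
      Real.norm_eq_abs, Real.norm_eq_abs]
    refine mul_le_mul_of_nonneg_right ?_ (Real.exp_pos _).le
    by_cases hN : 2 ≤ ⌊Real.exp (u / σ k)⌋₊
    · have h1 := hclose k u hu hN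
      have h2 : (C + 1) / Real.log ⌊Real.exp (u / σ k)⌋₊ ≤ (C + 1) / Real.log 2 := by
        have : (2 : ℝ) ≤ ⌊Real.exp (u / σ k)⌋₊ := by exact_mod_cast hN
        gcongr
      have h3 := abs_add_le (Real.log u) c
      have h4 := abs_add_le (sumMangoldtDivLog ⌊Real.exp (u / σ k)⌋₊ + Real.log (σ k) -
        (Real.log u + c)) (Real.log u + c)
      rw [sub_add_cancel] at h4
      rw [hK]; linarith
    · have hB : sumMangoldtDivLog ⌊Real.exp (u / σ k)⌋₊ = 0 := by
        have hle : ⌊Real.exp (u / σ k)⌋₊ ≤ 1 := by omega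
        rw [sumMangoldtDivLog]
        refine Finset.sum_eq_zero fun n hn => ?_
        rw [Finset.mem_Icc] at hn
        have : n = 1 := by omega
        simp [this]
      have hlt : Real.exp (u / σ k) < 2 := by
        have := Nat.lt_floor_add_one (Real.exp (u / σ k))
        have h5 : ((⌊Real.exp (u / σ k)⌋₊ : ℕ) : ℝ) ≤ 1 := by
          exact_mod_cast (by omega : ⌊Real.exp (u / σ k)⌋₊ ≤ 1)
        linarith
      have h6 : u / σ k ≤ 1 := by
        have := Real.add_one_le_exp (u / σ k)
        linarith
      rw [div_le_one (hσ0 k)] at h6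
      have h7 := Real.log_le_log hu h6
      have h8 := Real.log_nonpos (hσ0 k).le (hσ1 k)
      rw [hB, zero_add, abs_of_nonpos h8, abs_of_nonpos (h7.trans h8)]
      linarith
  have hlim : ∀ u ∈ Set.Ioi (0 : ℝ), Filter.Tendsto (fun k => G k u) Filter.atTop
      (nhds ((Real.log u + c) * Real.exp (-u))) := by
    intro u hu
    rw [Set.mem_Ioi] at hu
    have hre : ∀ k, G k u = (sumMangoldtDivLog ⌊Real.exp (u / σ k)⌋₊ + Real.log (σ k)) *
      Real.exp (-u) := fun k => by rw [hG]; ring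
    simp only [hre]
    refine Filter.Tendsto.mul_const _ ?_
    have hN := tendsto_floor_exp_div hu
    have h1 : Filter.Tendsto (fun k => (C + 1) / Real.log ⌊Real.exp (u / σ k)⌋₊) Filter.atTop
        (nhds 0) :=
      Filter.Tendsto.div_atTop tendsto_const_nhds
        (Real.tendsto_log_atTop.comp (tendsto_natCast_atTop_atTop.comp hN))
    rw [tendsto_iff_norm_sub_tendsto_zero]
    refine squeeze_zero' (Filter.Eventually.of_forall fun k => norm_nonneg _) ?_ h1
    filter_upwards [hN.eventually_ge_atTop 2] with k hk
    exact hclose k u hu hk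
  have hdct := tendsto_integral_of_dominated_convergence
    (μ := volume.restrict (Set.Ioi (0 : ℝ)))
    (F := G) (f := fun u => (Real.log u + c) * Real.exp (-u))
    (fun u => ‖Real.log u * Real.exp (-u)‖ + K * Real.exp (-u))
    (fun k => (hGi k).aestronglyMeasurable)
    (integrableOn_log_mul_exp_neg.norm.add ((integrableOn_exp_neg_Ioi 0).const_mul K))
    (fun k => (ae_restrict_iff' measurableSet_Ioi).2 (Filter.Eventually.of_forall (hdom k)))
    ((ae_restrict_iff' measurableSet_Ioi).2 (Filter.Eventually.of_forall hlim))
  simp only [hGv] at hdct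
  have h0 := tendsto_nhds_unique hdct tendsto_log_zeta_add_log
  simp only [add_mul] at h0
  rw [integral_add integrableOn_log_mul_exp_neg ((integrableOn_exp_neg_Ioi 0).const_mul c),
    integral_log_mul_exp_neg, integral_const_mul, integral_exp_neg_Ioi_zero] at h0
  linarith

theorem sum_vonMangoldt_mul_eq_sum_primes (f : ℕ → ℝ) (N : ℕ) :
    ∑ n ∈ Finset.Icc 1 N, ArithmeticFunction.vonMangoldt n * f n =
      ∑ p ∈ primesUpTo N, ∑ k ∈ Finset.Icc 1 (Nat.log p N), Real.log p * f (p ^ k) := by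
  have h1 : ∑ n ∈ Finset.Icc 1 N, ArithmeticFunction.vonMangoldt n * f n =
      ∑ n ∈ (Finset.Icc 1 N).filter IsPrimePow, ArithmeticFunction.vonMangoldt n * f n := by
    rw [Finset.sum_filter]
    refine Finset.sum_congr rfl fun n _ => ?_
    split_ifs with h
    · rfl
    · rw [ArithmeticFunction.vonMangoldt_apply, if_neg h, zero_mul]
  rw [h1, Finset.sum_sigma']
  symm
  refine Finset.sum_bij (fun x _ => x.1 ^ x.2) ?_ ?_ ?_ ?_
  · rintro ⟨p, k⟩ hx
    simp only [Finset.mem_sigma, Finset.mem_filter, Finset.mem_Icc] at hx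
    obtain ⟨⟨⟨hp1, hpN⟩, hp⟩, hk1, hkN⟩ := hx
    simp only [Finset.mem_filter, Finset.mem_Icc]
    exact ⟨⟨Nat.one_le_pow _ _ hp.pos, Nat.pow_le_of_le_log (by omega) hkN⟩,
      hp.isPrimePow.pow (by omega)⟩
  · rintro ⟨p, k⟩ hx ⟨p', k'⟩ hx' h
    simp only [Finset.mem_sigma, Finset.mem_filter, Finset.mem_Icc] at hx hx' h
    have hpp : p = p' := by
      rw [← hx.1.2.pow_minFac (k := k) (by omega), h, hx'.1.2.pow_minFac (by omega)]
    subst hpp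
    have := Nat.pow_right_injective hx.1.2.two_le h
    rw [this]
  · intro n hn
    simp only [Finset.mem_filter, Finset.mem_Icc] at hn
    obtain ⟨⟨hn1, hnN⟩, hpp⟩ := hn
    obtain ⟨p, k, hp, hk, rfl⟩ := (isPrimePow_nat_iff _).1 hpp
    refine ⟨⟨p, k⟩, ?_, rfl⟩
    simp only [Finset.mem_sigma, Finset.mem_filter, Finset.mem_Icc]
    exact ⟨⟨⟨hp.one_le, (Nat.le_self_pow (by omega) p).trans hnN⟩, hp⟩, by omega,
      Nat.le_log_of_pow_le hp.one_lt hnN⟩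
  · rintro ⟨p, k⟩ hx
    simp only [Finset.mem_sigma, Finset.mem_filter, Finset.mem_Icc] at hx
    simp only
    rw [ArithmeticFunction.vonMangoldt_apply_pow (by omega),
      ArithmeticFunction.vonMangoldt_apply_prime hx.1.2]

theorem sumMangoldtDivLog_eq_sum_primes (N : ℕ) :
    sumMangoldtDivLog N =
      ∑ p ∈ primesUpTo N, ∑ k ∈ Finset.Icc 1 (Nat.log p N), (1 : ℝ) / (k * (p : ℝ) ^ k) := by
  have h := sum_vonMangoldt_mul_eq_sum_primes (fun n => 1 / (n * Real.log n)) N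
  simp only [mul_one_div] at h
  rw [sumMangoldtDivLog, h]
  refine Finset.sum_congr rfl fun p hp => Finset.sum_congr rfl fun k hk => ?_
  rw [Finset.mem_filter] at hp
  rw [Finset.mem_Icc] at hk
  have hl : 0 < Real.log p := Real.log_pos (by exact_mod_cast hp.2.one_lt)
  have hp0 : (0 : ℝ) < p := by exact_mod_cast hp.2.pos
  have hk0 : (0 : ℝ) < k := by exact_mod_cast (by omega : 0 < k)
  push_cast
  rw [Real.log_pow]
  field_simp

theorem hasSum_one_div_mul_pow_prime {p : ℕ} (hp : p.Prime) :
    HasSum (fun n : ℕ => (1 : ℝ) / ((n + 1 : ℕ) * (p : ℝ) ^ (n + 1)))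
      (-Real.log (1 - 1 / p)) := by
  have hp1 : (1 : ℝ) < p := by exact_mod_cast hp.one_lt
  have h := Real.hasSum_pow_div_log_of_abs_lt_one (x := 1 / (p : ℝ)) (by
    rw [abs_of_nonneg (by positivity), div_lt_one (by linarith)]; exact hp1)
  convert h using 2 with n
  rw [one_div_pow, div_div, mul_comm]
  push_cast
  rfl

theorem sum_Icc_one_eq_sum_range (f : ℕ → ℝ) (K : ℕ) :
    ∑ k ∈ Finset.Icc 1 K, f k = ∑ n ∈ Finset.range K, f (n + 1) := by
  induction K with
  | zero => simp
  | succ K ih => rw [Finset.sum_Icc_succ_top (by omega), ih, Finset.sum_range_succ]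

theorem sum_Icc_one_div_le_neg_log {p : ℕ} (hp : p.Prime) (K : ℕ) :
    ∑ k ∈ Finset.Icc 1 K, (1 : ℝ) / (k * (p : ℝ) ^ k) ≤ -Real.log (1 - 1 / p) := by
  rw [sum_Icc_one_eq_sum_range (fun k => (1 : ℝ) / (k * (p : ℝ) ^ k))]
  exact sum_le_hasSum _ (fun n _ => by positivity) (hasSum_one_div_mul_pow_prime hp)

theorem neg_log_le_sum_Icc_one_div_add {p : ℕ} (hp : p.Prime) (K : ℕ) :
    -Real.log (1 - 1 / p) ≤
      ∑ k ∈ Finset.Icc 1 K, (1 : ℝ) / (k * (p : ℝ) ^ k) + 2 / (p : ℝ) ^ (K + 1) := by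
  have hp2 : (2 : ℝ) ≤ p := by exact_mod_cast hp.two_le
  rw [sum_Icc_one_eq_sum_range (fun k => (1 : ℝ) / (k * (p : ℝ) ^ k))]
  have h := (hasSum_nat_add_iff' K).2 (hasSum_one_div_mul_pow_prime hp)
  have hr0 : (0 : ℝ) ≤ 1 / p := by positivity
  have hr2 : (1 : ℝ) / p ≤ 1 / 2 := by gcongr
  have hg := (hasSum_geometric_of_lt_one hr0 (by linarith)).mul_left ((1 / (p : ℝ)) ^ (K + 1))
  have hle := hasSum_le (fun n => ?_) h hg
  · have h3 : (1 / (p : ℝ)) ^ (K + 1) * (1 - 1 / (p : ℝ))⁻¹ ≤ 2 / (p : ℝ) ^ (K + 1) := by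
      rw [one_div_pow, div_eq_mul_one_div 2, mul_comm]
      refine mul_le_mul_of_nonneg_right ?_ (by positivity)
      rw [inv_le_comm₀ (by linarith) (by norm_num)]
      linarith
    linarith
  · rw [← pow_add, one_div_pow]
    refine one_div_le_one_div_of_le (by positivity) ?_
    rw [show K + 1 + n = n + K + 1 by ring]
    refine le_mul_of_one_le_left (by positivity) ?_
    push_cast
    have : (0 : ℝ) ≤ (n : ℝ) + K := by positivity
    linarith

theorem summable_nat_rpow_neg_three_halves :
    Summable fun n : ℕ => (n : ℝ) ^ (-(3 / 2 : ℝ)) :=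
  Real.summable_nat_rpow.2 (by norm_num)

theorem exists_abs_sum_one_div_primes_sub_log_log_le :
    ∃ C, 0 < C ∧ ∀ N : ℕ, 2 ≤ N →
      |∑ p ∈ primesUpTo N, (1 : ℝ) / p - Real.log (Real.log N)| ≤ C := by
  obtain ⟨C, hC, h⟩ := exists_abs_sumMangoldtDivLog_sub_log_log_sub_eulerMascheroniConstant_le
  have hs : Summable fun n : ℕ => (1 : ℝ) / (n : ℝ) ^ 2 :=
    Real.summable_one_div_nat_pow.2 (by norm_num)
  set T := ∑' n : ℕ, (1 : ℝ) / (n : ℝ) ^ 2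
  have hT : 0 ≤ T := tsum_nonneg fun n => by positivity
  have hl2 := Real.log_pos one_lt_two
  refine ⟨C / Real.log 2 + 1 + 2 * T, by positivity, fun N hN => ?_⟩
  have h1 := h N hN
  have hN2 : (2 : ℝ) ≤ N := by exact_mod_cast hN
  have h2 : C / Real.log N ≤ C / Real.log 2 := by gcongr
  have hlo : ∑ p ∈ primesUpTo N, (1 : ℝ) / p ≤ sumMangoldtDivLog N := by
    rw [sumMangoldtDivLog_eq_sum_primes]
    refine Finset.sum_le_sum fun p hp => ?_
    rw [Finset.mem_filter, Finset.mem_Icc] at hp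
    have := Finset.single_le_sum (f := fun k : ℕ => (1 : ℝ) / (k * (p : ℝ) ^ k))
      (s := Finset.Icc 1 (Nat.log p N)) (fun k _ => by positivity)
      (Finset.mem_Icc.2 ⟨le_rfl, Nat.log_pos hp.2.one_lt hp.1.2⟩)
    simpa using this
  have hhi : sumMangoldtDivLog N ≤ ∑ p ∈ primesUpTo N, (1 : ℝ) / p + 2 * T := by
    have h3 : ∑ p ∈ primesUpTo N, (1 : ℝ) / (p : ℝ) ^ 2 ≤ T :=
      hs.sum_le_tsum _ fun n _ => by positivity
    have h4 : sumMangoldtDivLog N ≤ ∑ p ∈ primesUpTo N, ((1 : ℝ) / p + 2 * (1 / (p : ℝ) ^ 2)) := by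
      rw [sumMangoldtDivLog_eq_sum_primes]
      refine Finset.sum_le_sum fun p hp => ?_
      rw [Finset.mem_filter, Finset.mem_Icc] at hp
      refine (sum_Icc_one_div_le_neg_log hp.2 _).trans
        ((neg_log_le_sum_Icc_one_div_add hp.2 1).trans_eq ?_)
      simp [div_eq_mul_inv]
    rw [Finset.sum_add_distrib, ← Finset.mul_sum] at h4
    linarith
  have hg0 := Real.one_half_lt_eulerMascheroniConstant
  have hg1 := Real.eulerMascheroniConstant_lt_two_thirds
  rw [abs_le] at *
  constructor <;> linarith [h1.1, h1.2]

/-- The Euler product `∏_{p ≤ N} (1 - 1/p)⁻¹`. -/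
noncomputable def mertensProduct (N : ℕ) : ℝ := ∏ p ∈ primesUpTo N, (1 - 1 / (p : ℝ))⁻¹

theorem exists_mertensProduct_le :
    ∃ C, 0 < C ∧ ∀ N : ℕ, 2 ≤ N →
      mertensProduct N ≤ Real.exp Real.eulerMascheroniConstant * Real.log N + C := by
  obtain ⟨C, hC, h⟩ := exists_abs_sumMangoldtDivLog_sub_log_log_sub_eulerMascheroniConstant_le
  set T := ∑' n : ℕ, (n : ℝ) ^ (-(3 / 2 : ℝ))
  have hT : 0 ≤ T := tsum_nonneg fun n => by positivity
  set E := C + 8 * T with hE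
  have hE0 : 0 < E := by positivity
  have hl2 := Real.log_pos one_lt_two
  refine ⟨Real.exp Real.eulerMascheroniConstant * (E * Real.exp (E / Real.log 2)), by positivity,
    fun N hN => ?_⟩
  have hN2 : (2 : ℝ) ≤ N := by exact_mod_cast hN
  have hlN : 0 < Real.log N := Real.log_pos (by linarith)
  have hpos : ∀ p ∈ primesUpTo N, (0 : ℝ) < 1 - 1 / (p : ℝ) := by
    intro p hp
    rw [Finset.mem_filter] at hp
    have hp1 : (1 : ℝ) < p := by exact_mod_cast hp.2.one_lt
    rw [sub_pos, div_lt_one (by linarith)]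
    exact hp1
  have hlogP : Real.log (mertensProduct N) =
      ∑ p ∈ primesUpTo N, -Real.log (1 - 1 / (p : ℝ)) := by
    rw [mertensProduct, Real.log_prod fun p hp => (inv_pos.2 (hpos p hp)).ne']
    simp only [Real.log_inv]
  have hPpos : 0 < mertensProduct N := Finset.prod_pos fun p hp => inv_pos.2 (hpos p hp)
  have hle : Real.log (mertensProduct N) ≤ sumMangoldtDivLog N + 8 * T / Real.log N := by
    rw [hlogP, sumMangoldtDivLog_eq_sum_primes]
    have hterm : ∀ p ∈ primesUpTo N, -Real.log (1 - 1 / (p : ℝ)) ≤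
        ∑ k ∈ Finset.Icc 1 (Nat.log p N), (1 : ℝ) / (k * (p : ℝ) ^ k) +
          8 / Real.log N * (p : ℝ) ^ (-(3 / 2 : ℝ)) := by
      intro p hp
      rw [Finset.mem_filter, Finset.mem_Icc] at hp
      refine (neg_log_le_sum_Icc_one_div_add hp.2 (Nat.log p N)).trans ?_
      gcongr
      have hp0 : (0 : ℝ) < p := by exact_mod_cast hp.2.pos
      have hp1 : (1 : ℝ) ≤ p := by exact_mod_cast hp.2.one_le
      set X : ℝ := (p : ℝ) ^ (Nat.log p N + 1) with hX
      have hX0 : 0 < X := by positivity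
      have hXN : (N : ℝ) ≤ X := by
        rw [hX]; exact_mod_cast (Nat.lt_pow_succ_log_self hp.2.one_lt N).le
      have hXp : (p : ℝ) ^ 2 ≤ X := by
        rw [hX]
        exact pow_le_pow_right₀ hp1 (by have := Nat.log_pos hp.2.one_lt hp.1.2; omega)
      have h1 : Real.log N ≤ 4 * X ^ (1 / 4 : ℝ) := by
        have h2 := Real.log_le_rpow_div (x := (N : ℝ)) (ε := 1 / 4) (by positivity) (by norm_num)
        have h3 : (N : ℝ) ^ (1 / 4 : ℝ) ≤ X ^ (1 / 4 : ℝ) := by gcongr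
        linarith
      have h4 : (p : ℝ) ^ (3 / 2 : ℝ) ≤ X ^ (3 / 4 : ℝ) := by
        have : (p : ℝ) ^ (3 / 2 : ℝ) = ((p : ℝ) ^ 2) ^ (3 / 4 : ℝ) := by
          rw [← Real.rpow_natCast, ← Real.rpow_mul hp0.le]; norm_num
        rw [this]; gcongr
      have h5 : X ^ (1 / 4 : ℝ) * X ^ (3 / 4 : ℝ) = X := by
        rw [← Real.rpow_add hX0]; norm_num
      rw [Real.rpow_neg hp0.le, ← div_eq_mul_inv, div_div, div_le_div_iff₀ hX0 (by positivity)]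
      have h6 : Real.log N * (p : ℝ) ^ (3 / 2 : ℝ) ≤ 4 * X ^ (1 / 4 : ℝ) * X ^ (3 / 4 : ℝ) := by
        gcongr
      rw [mul_assoc, h5] at h6
      linarith
    refine (Finset.sum_le_sum hterm).trans ?_
    rw [Finset.sum_add_distrib, ← Finset.mul_sum, mul_div_right_comm]
    gcongr
    exact summable_nat_rpow_neg_three_halves.sum_le_tsum _ fun n _ => by positivity
  have h1 := (abs_le.1 (h N hN)).2
  have h2 : Real.log (mertensProduct N) ≤
      Real.log (Real.log N) + Real.eulerMascheroniConstant + E / Real.log N := by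
    rw [hE, add_div]; linarith
  rw [Real.log_le_iff_le_exp hPpos, Real.exp_add, Real.exp_add, Real.exp_log hlN] at h2
  refine h2.trans ?_
  have h3 : Real.exp (E / Real.log N) ≤ 1 + E / Real.log N * Real.exp (E / Real.log 2) := by
    have h4 := Real.add_one_le_exp (-(E / Real.log N))
    rw [Real.exp_neg] at h4
    have h5 := Real.exp_pos (E / Real.log N)
    have h6 : Real.exp (E / Real.log N) * (-(E / Real.log N) + 1) ≤ 1 := by
      calc _ ≤ Real.exp (E / Real.log N) * (Real.exp (E / Real.log N))⁻¹ := by gcongr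
        _ = 1 := mul_inv_cancel₀ h5.ne'
    have h7 : Real.exp (E / Real.log N) ≤ Real.exp (E / Real.log 2) := by gcongr
    have h8 : E / Real.log N * Real.exp (E / Real.log N) ≤
      E / Real.log N * Real.exp (E / Real.log 2) := by gcongr
    linarith
  calc Real.log N * Real.exp Real.eulerMascheroniConstant * Real.exp (E / Real.log N)
      ≤ Real.log N * Real.exp Real.eulerMascheroniConstant *
        (1 + E / Real.log N * Real.exp (E / Real.log 2)) := by gcongr
    _ = _ := by field_simp

theorem sum_mul_succ_div_two_pow (K : ℕ) :
    ∑ k ∈ Finset.Icc 1 K, ((k : ℝ) * (k + 1)) / 2 ^ k = 8 - ((K : ℝ) ^ 2 + 5 * K + 8) / 2 ^ K := by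
  induction K with
  | zero => norm_num
  | succ K ih =>
    rw [Finset.sum_Icc_succ_top (by omega), ih]
    push_cast
    field_simp
    ring

theorem exists_sum_prime_powers_weighted_log_le :
    ∃ C, 0 < C ∧ ∀ M : ℕ, ∑ p ∈ primesUpTo M, ∑ k ∈ Finset.Icc 1 (Nat.log p M),
      ((k : ℝ) * (k + 1)) * Real.log p ≤ C * M := by
  set T := ∑' n : ℕ, (n : ℝ) ^ (-(3 / 2 : ℝ))
  have hT : 0 ≤ T := tsum_nonneg fun n => by positivity
  have hl4 : 0 < Real.log 4 := Real.log_pos (by norm_num)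
  refine ⟨2 * Real.log 4 + 64 * T, by positivity, fun M => ?_⟩
  have hterm : ∀ p ∈ primesUpTo M, ∑ k ∈ Finset.Icc 1 (Nat.log p M),
      ((k : ℝ) * (k + 1)) * Real.log p ≤
        2 * Real.log p + 64 * M * (p : ℝ) ^ (-(3 / 2 : ℝ)) := by
    intro p hp
    rw [Finset.mem_filter, Finset.mem_Icc] at hp
    obtain ⟨⟨_, hpM⟩, hp⟩ := hp
    have hp2 : (2 : ℝ) ≤ p := by exact_mod_cast hp.two_le
    have hp0 : (0 : ℝ) < p := by linarith
    have hlp : 0 ≤ Real.log p := Real.log_nonneg (by linarith)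
    have h1 : ∀ k ∈ Finset.Icc 1 (Nat.log p M), (k : ℝ) * (k + 1) ≤
        (if k = 1 then 2 else 0) + 4 * M / (p : ℝ) ^ 2 * (((k : ℝ) * (k + 1)) / 2 ^ k) := by
      intro k hk
      rw [Finset.mem_Icc] at hk
      split_ifs with hk1
      · subst hk1
        have : (0 : ℝ) ≤ 4 * M / (p : ℝ) ^ 2 * ((((1 : ℕ) : ℝ) * ((1 : ℕ) + 1)) / 2 ^ 1) := by
          positivity
        push_cast at this ⊢
        linarith
      · have hpk : (p : ℝ) ^ k ≤ M := by
          exact_mod_cast Nat.pow_le_of_le_log (by omega) hk.2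
        obtain ⟨j, rfl⟩ : ∃ j, k = j + 2 := ⟨k - 2, by omega⟩
        have h2 : (p : ℝ) ^ 2 * 2 ^ (j + 2) ≤ 4 * M := by
          have : (2 : ℝ) ^ j ≤ (p : ℝ) ^ j := by gcongr
          calc (p : ℝ) ^ 2 * 2 ^ (j + 2) = 4 * (2 ^ j * (p : ℝ) ^ 2) := by ring
            _ ≤ 4 * ((p : ℝ) ^ j * (p : ℝ) ^ 2) := by gcongr
            _ = 4 * (p : ℝ) ^ (j + 2) := by ring
            _ ≤ 4 * M := by gcongr
        rw [zero_add, div_mul_div_comm, le_div_iff₀ (by positivity), mul_comm (4 * (M : ℝ))]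
        gcongr
    rw [← Finset.sum_mul]
    have h3 : ∑ k ∈ Finset.Icc 1 (Nat.log p M), (k : ℝ) * (k + 1) ≤ 2 + 32 * M / (p : ℝ) ^ 2 := by
      refine (Finset.sum_le_sum h1).trans ?_
      rw [Finset.sum_add_distrib, ← Finset.mul_sum, sum_mul_succ_div_two_pow,
        Finset.sum_ite_eq' ]
      have h4 : (if 1 ∈ Finset.Icc 1 (Nat.log p M) then (2 : ℝ) else 0) ≤ 2 := by
        split_ifs <;> norm_num
      have h5 : 4 * M / (p : ℝ) ^ 2 *
          (8 - ((Nat.log p M : ℝ) ^ 2 + 5 * (Nat.log p M : ℝ) + 8) / 2 ^ (Nat.log p M)) ≤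
          4 * M / (p : ℝ) ^ 2 * 8 := by
        refine mul_le_mul_of_nonneg_left ?_ (by positivity)
        rw [sub_le_self_iff]
        positivity
      have h6 : 4 * M / (p : ℝ) ^ 2 * 8 = 32 * M / (p : ℝ) ^ 2 := by ring
      linarith
    refine (mul_le_mul_of_nonneg_right h3 hlp).trans ?_
    rw [add_mul]
    refine add_le_add le_rfl ?_
    have h7 := Real.log_le_rpow_div (x := (p : ℝ)) (ε := 1 / 2) hp0.le (by norm_num)
    have h8 : (p : ℝ) ^ (-(3 / 2 : ℝ)) = (p : ℝ) ^ (1 / 2 : ℝ) / (p : ℝ) ^ 2 := by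
      rw [← Real.rpow_natCast (p : ℝ) 2, ← Real.rpow_sub hp0]; norm_num
    rw [h8]
    calc 32 * M / (p : ℝ) ^ 2 * Real.log p
        ≤ 32 * M / (p : ℝ) ^ 2 * ((p : ℝ) ^ (1 / 2 : ℝ) / (1 / 2)) := by gcongr
      _ = _ := by ring
  refine (Finset.sum_le_sum hterm).trans ?_
  rw [Finset.sum_add_distrib, ← Finset.mul_sum, ← Finset.mul_sum]
  have h9 : ∑ p ∈ primesUpTo M, Real.log p ≤ Real.log 4 * M := by
    have := Chebyshev.theta_le_log4_mul_x (x := (M : ℝ)) (by positivity)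
    rw [Chebyshev.theta, Nat.floor_natCast] at this
    rwa [primesUpTo, Icc_one_eq_Ioc_zero]
  have h10 : ∑ p ∈ primesUpTo M, (p : ℝ) ^ (-(3 / 2 : ℝ)) ≤ T :=
    summable_nat_rpow_neg_three_halves.sum_le_tsum _ fun n _ => by positivity
  have h11 : 64 * (M : ℝ) * ∑ p ∈ primesUpTo M, (p : ℝ) ^ (-(3 / 2 : ℝ)) ≤ 64 * M * T := by
    gcongr
  linarith

/-- Nonnegative multiplicative functions dominated on prime powers by the divisor function. -/
structure DivisorBounded (g : ℕ → ℝ) : Prop where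
  nonneg : ∀ n, 0 ≤ g n
  map_one : g 1 = 1
  map_mul : ∀ {m n : ℕ}, m.Coprime n → g (m * n) = g m * g n
  prime_pow_le : ∀ {p : ℕ} (k : ℕ), p.Prime → g (p ^ k) ≤ k + 1

theorem DivisorBounded.sum_mul_log_le {g : ℕ → ℝ} (hg : DivisorBounded g) (N : ℕ) :
    ∑ n ∈ Finset.Icc 1 N, g n * Real.log n ≤
      ∑ m ∈ Finset.Icc 1 N, g m * ∑ p ∈ primesUpTo (N / m),
        ∑ k ∈ Finset.Icc 1 (Nat.log p (N / m)), ((k : ℝ) * (k + 1)) * Real.log p := by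
  have h1 : ∑ n ∈ Finset.Icc 1 N, g n * Real.log n ≤
      ∑ n ∈ Finset.Icc 1 N, ∑ p ∈ n.primeFactors,
        g (n / p ^ n.factorization p) *
          (((n.factorization p : ℝ) * (n.factorization p + 1)) * Real.log p) := by
    refine Finset.sum_le_sum fun n hn => ?_
    rw [Finset.mem_Icc] at hn
    rw [Real.log_nat_eq_sum_factorization, Finsupp.sum, Nat.support_factorization, Finset.mul_sum]
    refine Finset.sum_le_sum fun p hp => ?_
    have hpp := Nat.prime_of_mem_primeFactors hp
    have hlp : 0 ≤ Real.log p := Real.log_natCast_nonneg p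
    have h2 : g n ≤ (n.factorization p + 1) * g (n / p ^ n.factorization p) := by
      conv_lhs => rw [← Nat.ordProj_mul_ordCompl_eq_self n p]
      rw [hg.map_mul ((Nat.coprime_ordCompl hpp (by omega)).pow_left _)]
      exact mul_le_mul_of_nonneg_right (hg.prime_pow_le _ hpp) (hg.nonneg _)
    calc g n * ((n.factorization p : ℝ) * Real.log p)
        ≤ (n.factorization p + 1) * g (n / p ^ n.factorization p) *
          ((n.factorization p : ℝ) * Real.log p) := by gcongr
      _ = _ := by ring
  refine h1.trans ?_
  simp only [Finset.mul_sum]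
  rw [Finset.sum_sigma']
  simp only [Finset.sum_sigma']
  set B := (Finset.Icc 1 N).sigma fun m => (primesUpTo (N / m)).sigma fun p =>
    Finset.Icc 1 (Nat.log p (N / m))
  set A := (Finset.Icc 1 N).sigma fun n => n.primeFactors
  set H : (_ : ℕ) × (_ : ℕ) × ℕ → ℝ := fun x =>
    g x.1 * ((x.2.2 : ℝ) * (x.2.2 + 1) * Real.log x.2.1) with hH
  set φ : (_ : ℕ) × ℕ → (_ : ℕ) × (_ : ℕ) × ℕ := fun x =>
    ⟨x.1 / x.2 ^ x.1.factorization x.2, x.2, x.1.factorization x.2⟩ with hφ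
  have hinj : Set.InjOn φ A := by
    rintro ⟨n, p⟩ _ ⟨n', p'⟩ _ h
    simp only [hφ, Sigma.mk.injEq, heq_eq_eq] at h
    obtain ⟨h1, h2, h3⟩ := h
    subst h2
    have h4 := Nat.ordProj_mul_ordCompl_eq_self n p
    rw [h1, h3, Nat.ordProj_mul_ordCompl_eq_self n' p] at h4
    rw [h4]
  have hmaps : A.image φ ⊆ B := by
    intro x hx
    rw [Finset.mem_image] at hx
    obtain ⟨⟨n, p⟩, hx, rfl⟩ := hx
    simp only [A, Finset.mem_sigma, Finset.mem_Icc] at hx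
    obtain ⟨⟨hn1, hnN⟩, hp⟩ := hx
    have hpp := Nat.prime_of_mem_primeFactors hp
    have hpn := Nat.dvd_of_mem_primeFactors hp
    have hv : 1 ≤ n.factorization p := (hpp.dvd_iff_one_le_factorization (by omega)).1 hpn
    have hm : 0 < n / p ^ n.factorization p := Nat.ordCompl_pos p (by omega)
    have hle : p ^ n.factorization p ≤ N / (n / p ^ n.factorization p) := by
      rw [Nat.le_div_iff_mul_le hm, Nat.ordProj_mul_ordCompl_eq_self]
      exact hnN
    simp only [hφ, B, Finset.mem_sigma, Finset.mem_Icc, Finset.mem_filter]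
    exact ⟨⟨hm, (Nat.div_le_self _ _).trans hnN⟩, ⟨⟨hpp.one_le,
      (Nat.le_self_pow (by omega) p).trans hle⟩, hpp⟩, hv, Nat.le_log_of_pow_le hpp.one_lt hle⟩
  have : ∑ x ∈ A, H (φ x) ≤ ∑ x ∈ B, H x := by
    rw [← Finset.sum_image hinj]
    refine Finset.sum_le_sum_of_subset_of_nonneg hmaps fun x _ _ => ?_
    exact mul_nonneg (hg.nonneg _) (mul_nonneg (by positivity) (Real.log_natCast_nonneg _))
  exact this

theorem DivisorBounded.exists_log_mul_sum_le :
    ∃ C, 0 < C ∧ ∀ (g : ℕ → ℝ), DivisorBounded g → ∀ N : ℕ, 1 ≤ N →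
      Real.log N * ∑ n ∈ Finset.Icc 1 N, g n ≤ C * N * ∑ n ∈ Finset.Icc 1 N, g n / n := by
  obtain ⟨C, hC, h⟩ := exists_sum_prime_powers_weighted_log_le
  refine ⟨C + 1, by positivity, fun g hg N hN => ?_⟩
  have hN0 : (0 : ℝ) < N := by exact_mod_cast hN
  have h1 : ∑ n ∈ Finset.Icc 1 N, g n * Real.log n ≤ C * N * ∑ n ∈ Finset.Icc 1 N, g n / n := by
    refine (hg.sum_mul_log_le N).trans ?_
    rw [Finset.mul_sum]
    refine Finset.sum_le_sum fun m hm => ?_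
    have hdiv : ((N / m : ℕ) : ℝ) ≤ N / m := Nat.cast_div_le
    calc _ ≤ g m * (C * (N / m : ℕ)) := by
          exact mul_le_mul_of_nonneg_left (h _) (hg.nonneg m)
      _ ≤ g m * (C * (N / m)) := by
          have := hg.nonneg m
          gcongr
      _ = _ := by ring
  have h2 : ∑ n ∈ Finset.Icc 1 N, g n * (Real.log N - Real.log n) ≤
      N * ∑ n ∈ Finset.Icc 1 N, g n / n := by
    rw [Finset.mul_sum]
    refine Finset.sum_le_sum fun n hn => ?_
    rw [Finset.mem_Icc] at hn
    have hn0 : (0 : ℝ) < n := by exact_mod_cast hn.1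
    rw [← Real.log_div hN0.ne' hn0.ne']
    have h3 : Real.log (N / n) ≤ N / n := by
      have := Real.log_le_sub_one_of_pos (x := (N : ℝ) / n) (by positivity)
      linarith
    calc g n * Real.log (N / n) ≤ g n * (N / n) := mul_le_mul_of_nonneg_left h3 (hg.nonneg n)
      _ = _ := by ring
  simp only [mul_sub, Finset.sum_sub_distrib, ← Finset.sum_mul] at h2
  linarith

theorem primesBelow_succ_eq_primesUpTo (N : ℕ) : (N + 1).primesBelow = primesUpTo N := by
  ext p
  simp only [Nat.mem_primesBelow, Finset.mem_filter, Finset.mem_Icc]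
  exact ⟨fun h => ⟨⟨h.2.one_le, by omega⟩, h.2⟩, fun h => ⟨by omega, h.2⟩⟩

theorem hasSum_succ_div_two_pow : HasSum (fun k : ℕ => ((k : ℝ) + 1) / 2 ^ k) 4 := by
  have h1 := hasSum_coe_mul_geometric_of_norm_lt_one (r := (1 / 2 : ℝ)) (by norm_num)
  have h2 := hasSum_geometric_of_lt_one (r := (1 / 2 : ℝ)) (by norm_num) (by norm_num)
  have h3 : (fun k : ℕ => ((k : ℝ) + 1) / 2 ^ k) =
      fun k : ℕ => (k : ℝ) * (1 / 2) ^ k + (1 / 2) ^ k := by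
    funext k
    rw [one_div_pow]
    ring
  rw [h3, show (4 : ℝ) = 1 / 2 / (1 - 1 / 2) ^ 2 + (1 - 1 / 2)⁻¹ by norm_num]
  exact h1.add h2

theorem DivisorBounded.tsum_prime_pow_le {g : ℕ → ℝ} (hg : DivisorBounded g) {p : ℕ}
    (hp : p.Prime) : Summable (fun k : ℕ => ‖g (p ^ k) / (p ^ k : ℕ)‖) ∧
      ∑' k : ℕ, g (p ^ k) / (p ^ k : ℕ) ≤ 1 + g p / p + 16 / (p : ℝ) ^ 2 := by
  have hp2 : (2 : ℝ) ≤ p := by exact_mod_cast hp.two_le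
  have hp0 : (0 : ℝ) < p := by linarith
  have hnn : ∀ k, 0 ≤ g (p ^ k) / (p ^ k : ℕ) := fun k => div_nonneg (hg.nonneg _) (by positivity)
  have hS : Summable (fun k : ℕ => g (p ^ k) / (p ^ k : ℕ)) := by
    refine Summable.of_nonneg_of_le hnn (fun k => ?_) hasSum_succ_div_two_pow.summable
    push_cast
    have := hg.prime_pow_le k hp
    gcongr
  refine ⟨by simpa only [fun k => Real.norm_of_nonneg (hnn k)] using hS, ?_⟩
  have h1 : HasSum (fun k : ℕ => if k = 0 then (1 : ℝ) else 0) 1 := hasSum_ite_eq 0 1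
  have h2 : HasSum (fun k : ℕ => if k = 1 then g p / p else 0) (g p / p) := hasSum_ite_eq 1 _
  have h3 := (h1.add h2).add (hasSum_succ_div_two_pow.mul_left (4 / (p : ℝ) ^ 2))
  refine (hasSum_le (fun k => ?_) hS.hasSum h3).trans_eq (by ring)
  have hpos : 0 ≤ 4 / (p : ℝ) ^ 2 * (((k : ℝ) + 1) / 2 ^ k) := by positivity
  match k with
  | 0 => simp [hg.map_one]; positivity
  | 1 => simp; positivity
  | k + 2 =>
    simp only [Nat.add_eq_zero_iff, OfNat.ofNat_ne_zero, and_false, if_false,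
      show ¬ (k + 2 = 1) by omega, zero_add]
    have h4 : (p : ℝ) ^ 2 * 2 ^ (k + 2) ≤ 4 * (p : ℝ) ^ (k + 2) := by
      have : (2 : ℝ) ^ k ≤ (p : ℝ) ^ k := by gcongr
      calc (p : ℝ) ^ 2 * 2 ^ (k + 2) = 4 * (2 ^ k * (p : ℝ) ^ 2) := by ring
        _ ≤ 4 * ((p : ℝ) ^ k * (p : ℝ) ^ 2) := by gcongr
        _ = _ := by ring
    have h5 := hg.prime_pow_le (k + 2) hp
    have h6 : ((k + 2 : ℕ) : ℝ) + 1 > 0 := by positivity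
    push_cast at h5 h6 ⊢
    rw [div_mul_div_comm, div_le_div_iff₀ (by positivity) (by positivity)]
    calc g (p ^ (k + 2)) * ((p : ℝ) ^ 2 * 2 ^ (k + 2))
        ≤ ((k : ℝ) + 2 + 1) * (4 * (p : ℝ) ^ (k + 2)) := by gcongr
      _ = _ := by ring

theorem DivisorBounded.exists_sum_div_le_exp :
    ∃ C, 0 < C ∧ ∀ (g : ℕ → ℝ), DivisorBounded g → ∀ N : ℕ,
      ∑ n ∈ Finset.Icc 1 N, g n / n ≤ Real.exp (∑ p ∈ primesUpTo N, g p / p + C) := by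
  have hs : Summable fun n : ℕ => (1 : ℝ) / (n : ℝ) ^ 2 :=
    Real.summable_one_div_nat_pow.2 (by norm_num)
  set T := ∑' n : ℕ, (1 : ℝ) / (n : ℝ) ^ 2
  have hT : 0 ≤ T := tsum_nonneg fun n => by positivity
  refine ⟨16 * T + 1, by positivity, fun g hg N => ?_⟩
  have h := (EulerProduct.summable_and_hasSum_smoothNumbers_prod_primesBelow_tsum
    (f := fun n => g n / n) (by simp [hg.map_one])
    (fun {m n} hmn => by simp only [hg.map_mul hmn]; push_cast; rw [mul_div_mul_comm])
    (fun {p} hp => (hg.tsum_prime_pow_le hp).1) (N + 1)).2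
  rw [primesBelow_succ_eq_primesUpTo] at h
  have h' := hasSum_subtype_iff_indicator (f := fun n => g n / n)
    (s := (N + 1).smoothNumbers) |>.1 h
  have h1 : ∑ n ∈ Finset.Icc 1 N, g n / n ≤
      ∏ p ∈ primesUpTo N, ∑' k : ℕ, g (p ^ k) / (p ^ k : ℕ) := by
    refine le_trans (le_of_eq ?_) (sum_le_hasSum (Finset.Icc 1 N) (fun n _ =>
      Set.indicator_nonneg (fun n _ => div_nonneg (hg.nonneg n) (by positivity)) n) h')
    refine Finset.sum_congr rfl fun n hn => ?_
    rw [Finset.mem_Icc] at hn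
    rw [Set.indicator_of_mem (Nat.mem_smoothNumbers_of_lt hn.1 (by omega))]
  refine h1.trans ?_
  have h2 : ∏ p ∈ primesUpTo N, ∑' k : ℕ, g (p ^ k) / (p ^ k : ℕ) ≤
      ∏ p ∈ primesUpTo N, Real.exp (g p / p + 16 * (1 / (p : ℝ) ^ 2)) := by
    refine Finset.prod_le_prod (fun p _ => tsum_nonneg fun k =>
      div_nonneg (hg.nonneg _) (by positivity)) fun p hp => ?_
    rw [Finset.mem_filter] at hp
    refine (hg.tsum_prime_pow_le hp.2).2.trans ?_
    have := Real.add_one_le_exp (g p / p + 16 * (1 / (p : ℝ) ^ 2))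
    rw [mul_one_div] at *
    linarith
  refine h2.trans ?_
  rw [← Real.exp_sum, Finset.sum_add_distrib, ← Finset.mul_sum]
  have h3 : ∑ p ∈ primesUpTo N, (1 : ℝ) / (p : ℝ) ^ 2 ≤ T :=
    hs.sum_le_tsum _ fun n _ => by positivity
  gcongr
  linarith

/-- A completely multiplicative function viewed as an arithmetic function. -/
def complArithmetic (f : ℕ →*₀ ℂ) : ArithmeticFunction ℂ := ⟨f, map_zero f⟩

theorem complArithmetic_apply (f : ℕ →*₀ ℂ) (n : ℕ) : complArithmetic f n = f n := rfl

theorem isMultiplicative_complArithmetic_mul_zeta (f : ℕ →*₀ ℂ) :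
    (complArithmetic f * (ArithmeticFunction.zeta : ArithmeticFunction ℂ)).IsMultiplicative :=
  ArithmeticFunction.IsMultiplicative.mul
    ⟨map_one f, fun {m n} _ => map_mul f m n⟩
    ArithmeticFunction.isMultiplicative_zeta.natCast

theorem complArithmetic_mul_zeta_prime_pow (f : ℕ →*₀ ℂ) {p : ℕ} (hp : p.Prime) (k : ℕ) :
    (complArithmetic f * (ArithmeticFunction.zeta : ArithmeticFunction ℂ)) (p ^ k) =
      ∑ i ∈ Finset.range (k + 1), f p ^ i := by
  rw [ArithmeticFunction.coe_mul_zeta_apply, Nat.sum_divisors_prime_pow hp]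
  simp [complArithmetic_apply]

theorem divisorBounded_norm_mul_zeta (f : ℕ →*₀ ℂ) (hf : ∀ n, ‖f n‖ ≤ 1) :
    DivisorBounded fun n =>
      ‖(complArithmetic f * (ArithmeticFunction.zeta : ArithmeticFunction ℂ)) n‖ where
  nonneg _ := norm_nonneg _
  map_one := by rw [(isMultiplicative_complArithmetic_mul_zeta f).map_one, norm_one]
  map_mul {m n} h := by
    rw [(isMultiplicative_complArithmetic_mul_zeta f).map_mul_of_coprime h, norm_mul]
  prime_pow_le {p} k hp := by
    rw [complArithmetic_mul_zeta_prime_pow f hp]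
    refine (norm_sum_le _ _).trans ?_
    refine (Finset.sum_le_card_nsmul _ _ 1 fun i _ => ?_).trans ?_
    · rw [norm_pow]; exact pow_le_one₀ (norm_nonneg _) (hf p)
    · simp

theorem norm_sum_div_mul_le (f : ℕ →*₀ ℂ) (hf : ∀ n, ‖f n‖ ≤ 1) (N : ℕ) :
    N * ‖∑ n ∈ Finset.Icc 1 N, f n / n‖ ≤ ∑ n ∈ Finset.Icc 1 N,
      ‖(complArithmetic f * (ArithmeticFunction.zeta : ArithmeticFunction ℂ)) n‖ + N := by
  have h1 := ArithmeticFunction.sum_Ioc_mul_zeta_eq_sum (complArithmetic f) N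
  rw [← Icc_one_eq_Ioc_zero] at h1
  have h2 : (N : ℂ) * ∑ n ∈ Finset.Icc 1 N, f n / n =
      ∑ n ∈ Finset.Icc 1 N,
        (complArithmetic f * (ArithmeticFunction.zeta : ArithmeticFunction ℂ)) n +
      ∑ n ∈ Finset.Icc 1 N, f n * (((N : ℝ) / n - (N / n : ℕ) : ℝ) : ℂ) := by
    rw [h1, ← Finset.sum_add_distrib, Finset.mul_sum]
    refine Finset.sum_congr rfl fun n _ => ?_
    rw [complArithmetic_apply]
    push_cast
    ring
  have h3 : ‖(N : ℂ) * ∑ n ∈ Finset.Icc 1 N, f n / n‖ =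
      N * ‖∑ n ∈ Finset.Icc 1 N, f n / n‖ := by
    rw [norm_mul, Complex.norm_natCast]
  rw [← h3, h2]
  refine (norm_add_le _ _).trans (add_le_add (norm_sum_le _ _) ((norm_sum_le _ _).trans ?_))
  refine (Finset.sum_le_card_nsmul _ _ 1 fun n hn => ?_).trans (by simp)
  rw [Finset.mem_Icc] at hn
  have hn0 : (0 : ℝ) < n := by exact_mod_cast hn.1
  rw [norm_mul, Complex.norm_real]
  refine mul_le_one₀ (hf n) (norm_nonneg _) ?_
  have h4 : ((N / n : ℕ) : ℝ) ≤ N / n := Nat.cast_div_le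
  rw [Real.norm_of_nonneg (by linarith)]
  have h5 : (N : ℝ) / n < (N / n : ℕ) + 1 := by
    rw [div_lt_iff₀ hn0]
    exact_mod_cast (by
      have := Nat.lt_div_mul_add (a := N) (b := n) hn.1
      rw [add_mul, one_mul]; exact this)
  linarith

theorem exists_norm_sum_div_le :
    ∃ K, 0 < K ∧ ∀ f : ℕ →*₀ ℂ, (∀ n, ‖f n‖ ≤ 1) → ∀ (Y : ℕ) (w : ℕ → ℝ),
      (∀ p : ℕ, p.Prime → Y < p → f p = 0) →
      (∀ p : ℕ, p.Prime → 0 ≤ w p ∧ ‖1 + f p‖ ≤ 1 + w p) → ∀ N : ℕ,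
        ‖∑ n ∈ Finset.Icc 1 N, f n / n‖ ≤ 1 + K * Real.exp (∑ p ∈ primesUpTo Y, w p / p) := by
  obtain ⟨C₁, hC₁, h₁⟩ := DivisorBounded.exists_log_mul_sum_le
  obtain ⟨C₂, hC₂, h₂⟩ := DivisorBounded.exists_sum_div_le_exp
  obtain ⟨C₃, hC₃, h₃⟩ := exists_abs_sum_one_div_primes_sub_log_log_le
  refine ⟨C₁ * Real.exp (C₂ + C₃), by positivity, fun f hf Y w hY hw N => ?_⟩
  have hpos : 0 ≤ C₁ * Real.exp (C₂ + C₃) * Real.exp (∑ p ∈ primesUpTo Y, w p / p) := by positivity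
  rcases Nat.lt_or_ge N 2 with hN | hN
  · have : ‖∑ n ∈ Finset.Icc 1 N, f n / n‖ ≤ 1 := by
      interval_cases N <;> simp
    linarith
  have hN0 : (0 : ℝ) < N := by exact_mod_cast (by omega : 0 < N)
  have hN2 : (2 : ℝ) ≤ N := by exact_mod_cast hN
  have hlN : 0 < Real.log N := Real.log_pos (by linarith)
  set g := fun n : ℕ =>
    ‖(complArithmetic f * (ArithmeticFunction.zeta : ArithmeticFunction ℂ)) n‖ with hg
  have hdb : DivisorBounded g := divisorBounded_norm_mul_zeta f hf
  have hgp : ∀ p : ℕ, p.Prime → g p = ‖1 + f p‖ := by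
    intro p hp
    have := complArithmetic_mul_zeta_prime_pow f hp 1
    rw [pow_one] at this
    rw [Finset.sum_range_succ, Finset.sum_range_one, pow_zero, pow_one] at this
    simp only [hg, this]
  have h4 : ∑ p ∈ primesUpTo N, g p / p ≤
      ∑ p ∈ primesUpTo N, (1 : ℝ) / p + ∑ p ∈ primesUpTo Y, w p / p := by
    have h5 : ∑ p ∈ primesUpTo N, g p / p ≤ ∑ p ∈ primesUpTo N, ((1 : ℝ) / p +
        if p ∈ primesUpTo Y then w p / p else 0) := by
      refine Finset.sum_le_sum fun p hp => ?_
      rw [Finset.mem_filter] at hp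
      have hp0 : (0 : ℝ) < p := by exact_mod_cast hp.2.pos
      split_ifs with h
      · rw [← add_div, hgp p hp.2]
        have := (hw p hp.2).2
        gcongr
      · rw [hgp p hp.2, hY p hp.2 ?_]
        · simp
        · by_contra hc
          exact h (Finset.mem_filter.2 ⟨Finset.mem_Icc.2 ⟨hp.2.one_le, by omega⟩, hp.2⟩)
    rw [Finset.sum_add_distrib, ← Finset.sum_filter] at h5
    refine h5.trans (add_le_add le_rfl ?_)
    refine Finset.sum_le_sum_of_subset_of_nonneg (fun p hp => (Finset.mem_filter.1 hp).2) ?_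
    intro p hp _
    rw [Finset.mem_filter] at hp
    exact div_nonneg (hw p hp.2).1 (by positivity)
  have h6 := (abs_le.1 (h₃ N hN)).2
  have h7 : ∑ n ∈ Finset.Icc 1 N, g n / n ≤
      Real.log N * (Real.exp (C₂ + C₃) * Real.exp (∑ p ∈ primesUpTo Y, w p / p)) := by
    refine (h₂ g hdb N).trans ?_
    rw [← Real.exp_add]
    calc _ ≤ Real.exp (Real.log (Real.log N) + (C₂ + C₃ + ∑ p ∈ primesUpTo Y, w p / p)) := by
          refine Real.exp_le_exp.2 ?_; linarith
      _ = _ := by rw [Real.exp_add (Real.log (Real.log N)), Real.exp_log hlN]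
  have h8 := h₁ g hdb N (by omega)
  have h9 : Real.log N * ∑ n ∈ Finset.Icc 1 N, g n ≤ Real.log N *
      (N * (C₁ * Real.exp (C₂ + C₃) * Real.exp (∑ p ∈ primesUpTo Y, w p / p))) := by
    refine h8.trans ?_
    calc C₁ * N * ∑ n ∈ Finset.Icc 1 N, g n / n ≤ C₁ * N * (Real.log N *
        (Real.exp (C₂ + C₃) * Real.exp (∑ p ∈ primesUpTo Y, w p / p))) := by gcongr
      _ = _ := by ring
  have h10 := le_of_mul_le_mul_left h9 hlN
  have h11 := norm_sum_div_mul_le f hf N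
  have h12 : N * ‖∑ n ∈ Finset.Icc 1 N, f n / n‖ ≤
      N * (1 + C₁ * Real.exp (C₂ + C₃) * Real.exp (∑ p ∈ primesUpTo Y, w p / p)) := by
    linarith
  exact le_of_mul_le_mul_left h12 hN0

theorem norm_one_add_le {w : ℂ} (hw : ‖w‖ ≤ 1) : ‖1 + w‖ ≤ 1 + (1 + w.re) / 2 := by
  have hre : -1 ≤ w.re := by
    have := Complex.abs_re_le_norm w
    linarith [neg_le_of_abs_le this]
  refine abs_le_of_sq_le_sq' ?_ (by linarith) |>.2
  have h1 : ‖1 + w‖ ^ 2 = 1 + 2 * w.re + ‖w‖ ^ 2 := by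
    rw [Complex.sq_norm, Complex.sq_norm, Complex.normSq_apply, Complex.normSq_apply]
    simp; ring
  have h2 : ‖w‖ ^ 2 ≤ 1 := pow_le_one₀ (norm_nonneg _) hw
  rw [h1]
  nlinarith [sq_nonneg (1 - w.re)]

theorem sum_range_dirichletCharacter_eq_zero {M : ℕ} [NeZero M] (Ψ : DirichletCharacter ℂ M)
    (hΨ : Ψ ≠ 1) : ∑ k ∈ Finset.range M, Ψ (k : ZMod M) = 0 := by
  rw [← MulChar.sum_eq_zero_of_ne_one hΨ]
  refine Finset.sum_bij (fun k _ => (k : ZMod M)) (fun k _ => Finset.mem_univ _) ?_ ?_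
    (fun k _ => rfl)
  · intro a ha b hb h
    rw [Finset.mem_range] at ha hb
    rw [ZMod.natCast_eq_natCast_iff'] at h
    rwa [Nat.mod_eq_of_lt ha, Nat.mod_eq_of_lt hb] at h
  · intro x _
    exact ⟨x.val, Finset.mem_range.2 (ZMod.val_lt x), ZMod.natCast_zmod_val x⟩

theorem norm_sum_range_dirichletCharacter_le {M : ℕ} [NeZero M] (Ψ : DirichletCharacter ℂ M)
    (hΨ : Ψ ≠ 1) (n : ℕ) : ‖∑ k ∈ Finset.range n, Ψ (k : ZMod M)‖ ≤ M := by
  induction n using Nat.strong_induction_on with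
  | _ n ih =>
    rcases le_or_gt n M with h | h
    · refine (norm_sum_le _ _).trans ((Finset.sum_le_card_nsmul _ _ 1 fun k _ =>
        DirichletCharacter.norm_le_one Ψ _).trans ?_)
      simpa using h
    · obtain ⟨m, rfl⟩ := Nat.exists_eq_add_of_lt h
      rw [show M + m + 1 = M + (m + 1) by ring, Finset.sum_range_add,
        sum_range_dirichletCharacter_eq_zero Ψ hΨ, zero_add]
      simp only [Nat.cast_add, ZMod.natCast_self, zero_add]
      have := ih (m + 1) (by have := NeZero.pos M; omega)
      simpa using this

theorem norm_sum_Icc_dirichletCharacter_le {M : ℕ} [NeZero M] (Ψ : DirichletCharacter ℂ M)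
    (hΨ : Ψ ≠ 1) (n : ℕ) : ‖∑ k ∈ Finset.Icc 1 n, Ψ (k : ZMod M)‖ ≤ M ∧
      ‖∑ k ∈ Finset.Icc 1 n, Ψ (k : ZMod M)‖ ≤ n := by
  constructor
  · have hM1 : M ≠ 1 := by
      rintro rfl
      exact hΨ (DirichletCharacter.level_one Ψ)
    have h := norm_sum_range_dirichletCharacter_le Ψ hΨ (n + 1)
    have : ∑ k ∈ Finset.Icc 1 n, Ψ (k : ZMod M) =
        ∑ k ∈ Finset.range (n + 1), Ψ (k : ZMod M) := by
      rw [Finset.sum_range_succ', Nat.cast_zero, Ψ.map_nonunit (fun h => by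
        have := isUnit_zero_iff.1 h
        have h1 : Subsingleton (ZMod M) := subsingleton_of_zero_eq_one this
        rw [ZMod.subsingleton_iff] at h1
        exact hM1 h1), add_zero, Finset.range_eq_Ico,
      Finset.sum_Ico_add' (fun k : ℕ => Ψ (k : ZMod M))]
      rfl
    rwa [this]
  · refine (norm_sum_le _ _).trans ((Finset.sum_le_card_nsmul _ _ 1 fun k _ =>
        DirichletCharacter.norm_le_one Ψ _).trans ?_)
    simp

theorem norm_LSeries_dirichletCharacter_le {M : ℕ} [NeZero M] (Ψ : DirichletCharacter ℂ M)
    (hΨ : Ψ ≠ 1) {s : ℝ} (hs : 1 < s) :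
    ‖LSeries (fun n => Ψ n) (s : ℂ)‖ ≤ s * (Real.log M + 1) := by
  have hM : (1 : ℝ) ≤ M := by exact_mod_cast NeZero.one_le
  have h := LSeries_eq_mul_integral (fun n => Ψ n) (r := 0) le_rfl (s := (s : ℂ))
    (by simp; linarith) (DirichletCharacter.LSeriesSummable_of_one_lt_re Ψ (by simpa using hs))
    (by
      simp only [Real.rpow_zero]
      exact Asymptotics.IsBigO.of_bound M (Filter.Eventually.of_forall fun n => by
        simpa using (norm_sum_Icc_dirichletCharacter_le Ψ hΨ n).1))
  rw [h, norm_mul, Complex.norm_real, Real.norm_of_nonneg (by linarith)]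
  refine mul_le_mul_of_nonneg_left ?_ (by linarith)
  set φ : ℝ → ℝ := fun t => if t ≤ M then t⁻¹ else M * t ^ (-2 : ℝ) with hφ
  have hi1 : IntegrableOn (fun t : ℝ => t⁻¹) (Set.Ioc 1 (M : ℝ)) := by
    rw [← intervalIntegrable_iff_integrableOn_Ioc_of_le hM]
    exact intervalIntegral.intervalIntegrable_inv (fun x hx => by
      rw [Set.uIcc_of_le hM] at hx; linarith [hx.1]) continuousOn_id
  have hi2 : IntegrableOn (fun t : ℝ => M * t ^ (-2 : ℝ)) (Set.Ioi (M : ℝ)) :=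
    (integrableOn_Ioi_rpow_of_lt (by norm_num) (by linarith)).const_mul _
  have hφ1 : Set.EqOn φ (fun t => t⁻¹) (Set.Ioc 1 (M : ℝ)) := fun t ht => if_pos ht.2
  have hφ2 : Set.EqOn φ (fun t => M * t ^ (-2 : ℝ)) (Set.Ioi (M : ℝ)) :=
    fun t ht => if_neg (not_le.2 ht)
  have hj1 := hi1.congr_fun hφ1.symm measurableSet_Ioc
  have hj2 := hi2.congr_fun hφ2.symm measurableSet_Ioi
  have hφi : IntegrableOn φ (Set.Ioi 1) := by
    rw [← Set.Ioc_union_Ioi_eq_Ioi hM]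
    exact hj1.union hj2
  have hφv : ∫ t in Set.Ioi 1, φ t = Real.log M + 1 := by
    rw [← Set.Ioc_union_Ioi_eq_Ioi hM, setIntegral_union (Set.Ioc_disjoint_Ioi le_rfl)
      measurableSet_Ioi hj1 hj2, setIntegral_congr_fun measurableSet_Ioc hφ1,
      setIntegral_congr_fun measurableSet_Ioi hφ2, ← intervalIntegral.integral_of_le hM,
      integral_inv_of_pos one_pos (by linarith), integral_const_mul,
      integral_Ioi_rpow_of_lt (by norm_num) (by linarith)]
    have : (M : ℝ) ≠ 0 := by linarith
    rw [show (-2 + 1 : ℝ) = -1 by norm_num, Real.rpow_neg_one]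
    field_simp
  rw [← hφv]
  refine norm_integral_le_of_norm_le hφi ?_
  refine (ae_restrict_iff' measurableSet_Ioi).2 (Filter.Eventually.of_forall fun t ht => ?_)
  rw [Set.mem_Ioi] at ht
  have ht0 : 0 < t := by linarith
  obtain ⟨hb1, hb2⟩ := norm_sum_Icc_dirichletCharacter_le Ψ hΨ ⌊t⌋₊
  have hb3 : ((⌊t⌋₊ : ℕ) : ℝ) ≤ t := Nat.floor_le ht0.le
  have hpow : ‖(t : ℂ) ^ (-((s : ℂ) + 1))‖ ≤ t ^ (-2 : ℝ) := by
    rw [Complex.norm_cpow_eq_rpow_re_of_pos ht0]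
    refine Real.rpow_le_rpow_of_exponent_le ht.le ?_
    simp; linarith
  rw [norm_mul]
  simp only [hφ]
  split_ifs with htM
  · calc _ ≤ t * t ^ (-2 : ℝ) := by
          gcongr
          linarith
      _ = t⁻¹ := by
          rw [← Real.rpow_one_add' ht0.le (by norm_num), ← Real.rpow_neg_one]; norm_num
  · gcongr

theorem summable_vonMangoldt_div_rpow_mul_log {s : ℝ} (hs : 1 < s) :
    Summable fun n : ℕ => ArithmeticFunction.vonMangoldt n / ((n : ℝ) ^ s * Real.log n) := by
  refine Summable.of_nonneg_of_le (fun n => div_nonneg ArithmeticFunction.vonMangoldt_nonneg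
    (mul_nonneg (by positivity) (Real.log_natCast_nonneg n))) (fun n => ?_)
    (Real.summable_one_div_nat_rpow.2 hs)
  rw [mul_comm, ← div_div]
  refine div_le_div_of_nonneg_right ?_ (by positivity)
  exact div_le_one_of_le₀ ArithmeticFunction.vonMangoldt_le_log (Real.log_natCast_nonneg n)

theorem tsum_re_dirichletCharacter_vonMangoldt {M : ℕ} (Ψ : DirichletCharacter ℂ M)
    {s : ℝ} (hs : 1 < s) :
    ‖LSeries (fun n => Ψ n) (s : ℂ)‖ = Real.exp (∑' n : ℕ, (Ψ (n : ZMod M)).re *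
      (ArithmeticFunction.vonMangoldt n / ((n : ℝ) ^ s * Real.log n))) := by
  set r : ℕ → ℝ := fun n => ArithmeticFunction.vonMangoldt n / ((n : ℝ) ^ s * Real.log n) with hr
  have hrs : Summable r := summable_vonMangoldt_div_rpow_mul_log hs
  have hr0 : ∀ n, 0 ≤ r n := fun n => div_nonneg ArithmeticFunction.vonMangoldt_nonneg
    (mul_nonneg (by positivity) (Real.log_natCast_nonneg n))
  have hsum : Summable fun n : ℕ => Ψ (n : ZMod M) * (r n : ℂ) := by
    refine Summable.of_norm_bounded hrs fun n => ?_
    rw [norm_mul, Complex.norm_real, Real.norm_of_nonneg (hr0 n)]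
    exact mul_le_of_le_one_left (hr0 n) (DirichletCharacter.norm_le_one Ψ _)
  have h1 := DirichletCharacter.LSeries_eq_exp_LSeries Ψ (s := (s : ℂ)) (by simpa using hs)
  rw [← h1, Complex.norm_exp]
  congr 1
  have h2 : LSeries (fun n : ℕ => Ψ n * (ArithmeticFunction.vonMangoldt n : ℂ) / Real.log n)
      (s : ℂ) = ∑' n : ℕ, Ψ (n : ZMod M) * (r n : ℂ) := by
    rw [LSeries]
    refine tsum_congr fun n => ?_
    rcases Nat.eq_zero_or_pos n with rfl | hn
    · simp [hr]
    · rw [LSeries.term_of_ne_zero (by omega), hr]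
      simp only
      push_cast
      rw [Complex.ofReal_cpow (by positivity)]
      push_cast
      rw [mul_div_assoc, mul_div_assoc, div_div, mul_comm (Complex.log n)]
  rw [h2, Complex.re_tsum hsum]
  refine tsum_congr fun n => ?_
  rw [Complex.re_mul_ofReal]

theorem exists_sum_re_dirichletCharacter_div_le :
    ∃ (C : ℝ) (N₀ : ℕ), 0 < C ∧ 2 ≤ N₀ ∧ ∀ N : ℕ, N₀ ≤ N → ∀ (M : ℕ) (Ψ : DirichletCharacter ℂ M),
      1 ≤ M → Ψ ≠ 1 →
        ∑ p ∈ primesUpTo N, (Ψ (p : ZMod M)).re / p ≤ Real.log (Real.log M + 1) + C := by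
  obtain ⟨C₁, hC₁, h₁⟩ := exists_abs_sum_vonMangoldt_div_sub_log_le
  obtain ⟨C₃, hC₃, h₃⟩ := exists_abs_sum_one_div_primes_sub_log_log_le
  have hz := (Asymptotics.isLittleO_one_iff ℝ).1 log_riemannZeta_add_log_sub_isLittleO_ofReal
  have hlim : Filter.Tendsto (fun N : ℕ => 1 + (Real.log N)⁻¹) Filter.atTop
      (nhdsWithin 1 (Set.Ioi 1)) := by
    have hlog : Filter.Tendsto (fun N : ℕ => Real.log N) Filter.atTop Filter.atTop :=
      Real.tendsto_log_atTop.comp tendsto_natCast_atTop_atTop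
    rw [tendsto_nhdsWithin_iff]
    refine ⟨by simpa using (tendsto_inv_atTop_zero.comp hlog).const_add 1, ?_⟩
    filter_upwards [hlog.eventually_gt_atTop 0] with k hk
    have := inv_pos.2 hk
    simp only [Set.mem_Ioi]; linarith
  have hev := (hz.comp hlim).eventually (ge_mem_nhds (zero_lt_one : (0 : ℝ) < 1))
  obtain ⟨N₀, hN₀⟩ := Filter.eventually_atTop.1 hev
  have hl2 := Real.log_pos one_lt_two
  refine ⟨2 + 1 + C₃ + 2 * (1 + C₁ / Real.log 2), max N₀ 2, by positivity, le_max_right _ _,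
    fun N hN M Ψ hM hΨ => ?_⟩
  have hN2 : 2 ≤ N := (le_max_right _ _).trans hN
  have hN2' : (2 : ℝ) ≤ N := by exact_mod_cast hN2
  have hz1 := hN₀ N ((le_max_left _ _).trans hN)
  have hlN : 0 < Real.log N := Real.log_pos (by linarith)
  have hl2N : Real.log 2 ≤ Real.log N := Real.log_le_log (by norm_num) hN2'
  have : NeZero M := ⟨by omega⟩
  have hM1 : (1 : ℝ) ≤ M := by exact_mod_cast hM
  have hlM : 0 ≤ Real.log M := Real.log_nonneg hM1
  set s : ℝ := 1 + (Real.log N)⁻¹ with hs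
  have hinv : 0 < (Real.log N)⁻¹ := inv_pos.2 hlN
  have hs1 : 1 < s := by linarith
  have hs3 : s ≤ 3 := by
    have h2 : (Real.log N)⁻¹ ≤ 2 := by
      rw [inv_le_comm₀ hlN (by norm_num)]
      have := Real.log_two_gt_d9
      linarith
    linarith
  simp only [Function.comp] at hz1
  rw [show s - 1 = (Real.log N)⁻¹ by rw [hs]; ring, Real.log_inv, log_riemannZeta_eq hs1] at hz1
  set r : ℕ → ℝ := fun n => ArithmeticFunction.vonMangoldt n / ((n : ℝ) ^ s * Real.log n) with hr
  set b : ℕ → ℝ := fun n => ArithmeticFunction.vonMangoldt n / (n * Real.log n) with hb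
  have hrs : Summable r := summable_vonMangoldt_div_rpow_mul_log hs1
  have hr0 : ∀ n, 0 ≤ r n := fun n => div_nonneg ArithmeticFunction.vonMangoldt_nonneg
    (mul_nonneg (by positivity) (Real.log_natCast_nonneg n))
  have hb0 : ∀ n, 0 ≤ b n := fun n => div_nonneg ArithmeticFunction.vonMangoldt_nonneg
    (mul_nonneg (by positivity) (Real.log_natCast_nonneg n))
  set c : ℕ → ℝ := fun n => (Ψ (n : ZMod M)).re with hc
  have hc1 : ∀ n, |c n| ≤ 1 := fun n =>
    (Complex.abs_re_le_norm _).trans (DirichletCharacter.norm_le_one Ψ _)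
  have hcs : Summable fun n => c n * r n := by
    refine Summable.of_norm_bounded hrs fun n => ?_
    rw [norm_mul, Real.norm_of_nonneg (hr0 n)]
    exact mul_le_of_le_one_left (hr0 n) (hc1 n)
  have hE : ∑' n, c n * r n ≤ Real.log (Real.log M + 1) + 2 := by
    have h4 := norm_LSeries_dirichletCharacter_le Ψ hΨ hs1
    rw [tsum_re_dirichletCharacter_vonMangoldt Ψ hs1] at h4
    have h5 : s * (Real.log M + 1) ≤ Real.exp 2 * (Real.log M + 1) := by
      have := Real.add_one_le_exp (2 : ℝ)
      gcongr
      linarith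
    have h6 := h4.trans h5
    rw [← Real.le_log_iff_exp_le (by positivity), Real.log_mul (Real.exp_pos _).ne' (by positivity),
      Real.log_exp] at h6
    linarith
  have hfin : ∑ n ∈ Finset.Icc 1 N, c n * r n + ∑ n ∈ Finset.Icc 1 N, r n ≤
      ∑' n, c n * r n + ∑' n, r n := by
    rw [← Finset.sum_add_distrib, ← hcs.tsum_add hrs]
    refine (hcs.add hrs).sum_le_tsum _ fun n _ => ?_
    have := (abs_le.1 (hc1 n)).1
    nlinarith [hr0 n]
  have hbr : ∀ n ∈ Finset.Icc 1 N, |b n - r n| ≤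
      (Real.log N)⁻¹ * (ArithmeticFunction.vonMangoldt n / n) := by
    intro n hn
    rw [Finset.mem_Icc] at hn
    have hn0 : (0 : ℝ) < n := by exact_mod_cast hn.1
    rcases eq_or_lt_of_le hn.1 with rfl | hn1
    · simp [hb, hr]
    · have hln : 0 < Real.log n := Real.log_pos (by exact_mod_cast hn1)
      have hΛ := ArithmeticFunction.vonMangoldt_nonneg (n := n)
      have hpow : (n : ℝ) ^ s = n * Real.exp (Real.log n * (Real.log N)⁻¹) := by
        rw [hs, Real.rpow_add hn0, Real.rpow_one, Real.rpow_def_of_pos hn0]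
      have heq : b n - r n = ArithmeticFunction.vonMangoldt n / (n * Real.log n) *
          (1 - Real.exp (-(Real.log n * (Real.log N)⁻¹))) := by
        rw [hb, hr]
        simp only
        rw [hpow, Real.exp_neg]
        have := Real.exp_pos (Real.log n * (Real.log N)⁻¹)
        field_simp
      have h7 : Real.exp (-(Real.log n * (Real.log N)⁻¹)) ≤ 1 := by
        rw [Real.exp_le_one_iff]
        have : 0 ≤ Real.log n * (Real.log N)⁻¹ := by positivity
        linarith
      rw [heq, abs_of_nonneg (mul_nonneg (hb0 n) (by linarith))]
      have h8 := Real.add_one_le_exp (-(Real.log n * (Real.log N)⁻¹))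
      calc _ ≤ ArithmeticFunction.vonMangoldt n / (n * Real.log n) *
            (Real.log n * (Real.log N)⁻¹) := by
            refine mul_le_mul_of_nonneg_left (by linarith) (hb0 n)
        _ = _ := by field_simp
  have hδ : ∑ n ∈ Finset.Icc 1 N, |b n - r n| ≤ 1 + C₁ / Real.log 2 := by
    refine (Finset.sum_le_sum hbr).trans ?_
    rw [← Finset.mul_sum]
    have h9 := (abs_le.1 (h₁ N (by omega))).2
    calc (Real.log N)⁻¹ * ∑ n ∈ Finset.Icc 1 N, ArithmeticFunction.vonMangoldt n / n
        ≤ (Real.log N)⁻¹ * (Real.log N + C₁) := by gcongr; linarith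
      _ = 1 + C₁ / Real.log N := by field_simp
      _ ≤ _ := by gcongr
  have hprime : ∑ p ∈ primesUpTo N, c p / p + ∑ p ∈ primesUpTo N, (1 : ℝ) / p ≤
      ∑ n ∈ Finset.Icc 1 N, (c n + 1) * b n := by
    rw [← Finset.sum_add_distrib]
    have h10 : ∑ p ∈ primesUpTo N, (c p / p + 1 / p) = ∑ p ∈ primesUpTo N, (c p + 1) * b p := by
      refine Finset.sum_congr rfl fun p hp => ?_
      rw [Finset.mem_filter] at hp
      have hlp : 0 < Real.log p := Real.log_pos (by exact_mod_cast hp.2.one_lt)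
      rw [hb]
      simp only
      rw [ArithmeticFunction.vonMangoldt_apply_prime hp.2]
      field_simp
    rw [h10]
    refine Finset.sum_le_sum_of_subset_of_nonneg (Finset.filter_subset _ _) fun n _ _ => ?_
    have := (abs_le.1 (hc1 n)).1
    exact mul_nonneg (by linarith) (hb0 n)
  have hswap : ∑ n ∈ Finset.Icc 1 N, (c n + 1) * b n ≤
      ∑ n ∈ Finset.Icc 1 N, c n * r n + ∑ n ∈ Finset.Icc 1 N, r n +
        2 * ∑ n ∈ Finset.Icc 1 N, |b n - r n| := by
    rw [Finset.mul_sum, ← Finset.sum_add_distrib, ← Finset.sum_add_distrib]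
    refine Finset.sum_le_sum fun n _ => ?_
    have h11 := abs_le.1 (hc1 n)
    have h12 : (c n + 1) * (b n - r n) ≤ 2 * |b n - r n| := by
      calc _ ≤ (c n + 1) * |b n - r n| :=
            mul_le_mul_of_nonneg_left (le_abs_self _) (by linarith [h11.1])
        _ ≤ _ := mul_le_mul_of_nonneg_right (by linarith [h11.2]) (abs_nonneg _)
    linarith
  have h13 := (abs_le.1 (h₃ N hN2)).1
  linarith

/-- The restriction of a completely multiplicative function to the `Y`-smooth numbers. -/
noncomputable def smoothHom (Y : ℕ) (g : ℕ →* ℂ) : ℕ →*₀ ℂ where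
  toFun n := if n ≠ 0 ∧ ∀ p : ℕ, p.Prime → p ∣ n → p ≤ Y then g n else 0
  map_zero' := by simp
  map_one' := by
    rw [if_pos, map_one]
    exact ⟨one_ne_zero, fun p hp h => absurd (Nat.dvd_one.mp h) hp.ne_one⟩
  map_mul' m n := by
    have key : (m * n ≠ 0 ∧ ∀ p : ℕ, p.Prime → p ∣ m * n → p ≤ Y) ↔
        (m ≠ 0 ∧ ∀ p : ℕ, p.Prime → p ∣ m → p ≤ Y) ∧
          (n ≠ 0 ∧ ∀ p : ℕ, p.Prime → p ∣ n → p ≤ Y) := by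
      constructor
      · rintro ⟨h0, h⟩
        exact ⟨⟨left_ne_zero_of_mul h0, fun p hp hd => h p hp (hd.mul_right n)⟩,
          ⟨right_ne_zero_of_mul h0, fun p hp hd => h p hp (hd.mul_left m)⟩⟩
      · rintro ⟨⟨h1, h2⟩, ⟨h3, h4⟩⟩
        exact ⟨mul_ne_zero h1 h3, fun p hp hd =>
          (hp.dvd_mul.mp hd).elim (h2 p hp) (h4 p hp)⟩
    by_cases h1 : (m ≠ 0 ∧ ∀ p : ℕ, p.Prime → p ∣ m → p ≤ Y) <;>
      by_cases h2 : (n ≠ 0 ∧ ∀ p : ℕ, p.Prime → p ∣ n → p ≤ Y)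
    · rw [if_pos (key.mpr ⟨h1, h2⟩), if_pos h1, if_pos h2, map_mul]
    · rw [if_neg (fun h => h2 (key.mp h).2), if_neg h2, mul_zero]
    · rw [if_neg (fun h => h1 (key.mp h).1), if_neg h1, zero_mul]
    · rw [if_neg (fun h => h1 (key.mp h).1), if_neg h1, zero_mul]

theorem smoothHom_apply (Y : ℕ) (g : ℕ →* ℂ) (n : ℕ) :
    smoothHom Y g n = if n ≠ 0 ∧ ∀ p : ℕ, p.Prime → p ∣ n → p ≤ Y then g n else 0 := rfl

theorem smoothHom_apply_of_le {Y : ℕ} (g : ℕ →* ℂ) {n : ℕ} (h0 : n ≠ 0) (h : n ≤ Y) :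
    smoothHom Y g n = g n :=
  if_pos ⟨h0, fun _ _ hd => (Nat.le_of_dvd (Nat.pos_of_ne_zero h0) hd).trans h⟩

theorem smoothHom_apply_prime_of_lt {Y : ℕ} (g : ℕ →* ℂ) {p : ℕ} (hp : p.Prime) (h : Y < p) :
    smoothHom Y g p = 0 :=
  if_neg fun h1 => absurd (h1.2 p hp dvd_rfl) (by omega)

theorem smoothHom_mul (Y : ℕ) (g h : ℕ →* ℂ) (n : ℕ) :
    smoothHom Y (g * h) n = smoothHom Y g n * h n := by
  simp only [smoothHom_apply, MonoidHom.mul_apply]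
  split_ifs <;> simp

theorem norm_smoothHom_le_one {Y : ℕ} {g : ℕ →* ℂ} (hg : ∀ n, ‖g n‖ ≤ 1) (n : ℕ) :
    ‖smoothHom Y g n‖ ≤ 1 := by
  rw [smoothHom_apply]
  split_ifs
  · exact hg n
  · simp

/-- A Dirichlet character as a completely multiplicative function on `ℕ`. -/
noncomputable def charHom {q : ℕ} (χ : DirichletCharacter ℂ q) : ℕ →* ℂ where
  toFun n := χ (n : ZMod q)
  map_one' := by simp
  map_mul' m n := by simp

theorem charHom_apply {q : ℕ} (χ : DirichletCharacter ℂ q) (n : ℕ) :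
    charHom χ n = χ (n : ZMod q) := rfl

theorem norm_charHom_le_one {q : ℕ} (χ : DirichletCharacter ℂ q) (n : ℕ) : ‖charHom χ n‖ ≤ 1 :=
  DirichletCharacter.norm_le_one χ _

theorem norm_charHom_mul_le_one {q d : ℕ} (χ : DirichletCharacter ℂ q) (ψ : DirichletCharacter ℂ d)
    (n : ℕ) : ‖(charHom χ * charHom ψ) n‖ ≤ 1 := by
  rw [MonoidHom.mul_apply, norm_mul]
  exact mul_le_one₀ (norm_charHom_le_one χ n) (norm_nonneg _) (norm_charHom_le_one ψ n)

theorem dirichletCharacter_inv_apply_eq_conj {d : ℕ} (hd : 1 ≤ d) (ψ : DirichletCharacter ℂ d)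
    (x : ZMod d) : ψ⁻¹ x = (starRingEnd ℂ) (ψ x) := by
  have : NeZero d := ⟨by omega⟩
  rw [← MulChar.star_eq_inv, MulChar.star_apply]
  rfl

theorem Ddist_sq {q D : ℕ} (χ : DirichletCharacter ℂ q) (ξ : DirichletCharacter ℂ D) (y : ℝ) :
    Ddist χ ξ y ^ 2 = ∑ p ∈ primesUpTo ⌊y⌋₊,
      (1 - (χ (p : ZMod q) * (starRingEnd ℂ) (ξ (p : ZMod D))).re) / p := by
  rw [Ddist, Real.sq_sqrt]
  refine Finset.sum_nonneg fun p _ => div_nonneg ?_ (Nat.cast_nonneg p)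
  have h : ‖χ (p : ZMod q) * (starRingEnd ℂ) (ξ (p : ZMod D))‖ ≤ 1 := by
    rw [norm_mul, RCLike.norm_conj]
    exact mul_le_one₀ (DirichletCharacter.norm_le_one χ _) (norm_nonneg _)
      (DirichletCharacter.norm_le_one ξ _)
  linarith [Complex.re_le_norm (χ (p : ZMod q) * (starRingEnd ℂ) (ξ (p : ZMod D)))]

/-- The logarithmic sum of `χ ψ̄` over smooth numbers in terms of the pretentious distance. -/
theorem exists_norm_sum_smooth_le :
    ∃ K : ℝ, 0 < K ∧ ∀ y : ℝ, 2 ≤ y → ∀ (q : ℕ) (χ : DirichletCharacter ℂ q) (d : ℕ)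
      (ψ : DirichletCharacter ℂ d), 1 ≤ d → ∀ N : ℕ,
        ‖∑ n ∈ Finset.Icc 1 N, smoothHom ⌊y⌋₊ (charHom χ * charHom ψ⁻¹) n / n‖ ≤
          1 + K * (Real.log y * Real.exp (-(Ddist χ ψ y) ^ 2 / 2)) := by
  obtain ⟨K, hK, h⟩ := exists_norm_sum_div_le
  obtain ⟨C, hC, hM⟩ := exists_abs_sum_one_div_primes_sub_log_log_le
  refine ⟨K * Real.exp C, by positivity, fun y hy q χ d ψ hd N => ?_⟩
  have hY : 2 ≤ ⌊y⌋₊ := Nat.le_floor (by exact_mod_cast hy)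
  have hg := norm_charHom_mul_le_one χ ψ⁻¹
  have h1 := h (smoothHom ⌊y⌋₊ (charHom χ * charHom ψ⁻¹)) (norm_smoothHom_le_one hg) ⌊y⌋₊
    (fun p => (1 + ((charHom χ * charHom ψ⁻¹) p).re) / 2)
    (fun p hp hlt => smoothHom_apply_prime_of_lt _ hp hlt) (fun p hp => ?_) N
  · refine h1.trans ?_
    have e1 : ∑ p ∈ primesUpTo ⌊y⌋₊, (1 + ((charHom χ * charHom ψ⁻¹) p).re) / 2 / p =
        ∑ p ∈ primesUpTo ⌊y⌋₊, (1 : ℝ) / p - Ddist χ ψ y ^ 2 / 2 := by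
      rw [Ddist_sq, Finset.sum_div, ← Finset.sum_sub_distrib]
      refine Finset.sum_congr rfl fun p _ => ?_
      rw [MonoidHom.mul_apply, charHom_apply, charHom_apply,
        dirichletCharacter_inv_apply_eq_conj hd]
      ring
    have e2 : ∑ p ∈ primesUpTo ⌊y⌋₊, (1 : ℝ) / p ≤ Real.log (Real.log y) + C := by
      have h2 := (abs_le.mp (hM ⌊y⌋₊ hY)).2
      have hY' : (2 : ℝ) ≤ (⌊y⌋₊ : ℝ) := by exact_mod_cast hY
      have h3 : Real.log (⌊y⌋₊ : ℝ) ≤ Real.log y :=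
        Real.log_le_log (by linarith) (Nat.floor_le (by linarith))
      have h4 : Real.log (Real.log (⌊y⌋₊ : ℝ)) ≤ Real.log (Real.log y) :=
        Real.log_le_log (Real.log_pos (by linarith)) h3
      linarith
    have hlog : 0 < Real.log y := Real.log_pos (by linarith)
    rw [e1]
    calc 1 + K * Real.exp (∑ p ∈ primesUpTo ⌊y⌋₊, (1 : ℝ) / p - Ddist χ ψ y ^ 2 / 2)
        ≤ 1 + K * Real.exp (Real.log (Real.log y) + C + -(Ddist χ ψ y) ^ 2 / 2) := by
          gcongr
          linarith
      _ = 1 + K * Real.exp C * (Real.log y * Real.exp (-(Ddist χ ψ y) ^ 2 / 2)) := by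
          rw [Real.exp_add, Real.exp_add, Real.exp_log hlog]
          ring
  · have h3 := abs_le.mp ((Complex.abs_re_le_norm ((charHom χ * charHom ψ⁻¹) p)).trans (hg p))
    refine ⟨by linarith, ?_⟩
    rw [smoothHom_apply]
    split_ifs
    · exact norm_one_add_le (hg p)
    · simp only [add_zero, norm_one]
      linarith

/-- Repulsion: a character `ψ` further from `χ` than `ξ` is, with `ψ ξ̄` oscillating, is far
from `χ`. -/
theorem le_two_mul_Ddist_sq {q D d : ℕ} (χ : DirichletCharacter ℂ q) (ξ : DirichletCharacter ℂ D)
    (ψ : DirichletCharacter ℂ d) {y ε : ℝ} (hle : Ddist χ ξ y ≤ Ddist χ ψ y)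
    (hε : ∑ p ∈ primesUpTo ⌊y⌋₊,
      (ψ (p : ZMod d) * (starRingEnd ℂ) (ξ (p : ZMod D))).re / p ≤ ε) :
    (2 - √2) * ∑ p ∈ primesUpTo ⌊y⌋₊, (1 : ℝ) / p - ε / √2 ≤ 2 * Ddist χ ψ y ^ 2 := by
  have h0 : 0 ≤ Ddist χ ξ y := Real.sqrt_nonneg _
  have h1 : Ddist χ ξ y ^ 2 ≤ Ddist χ ψ y ^ 2 := by gcongr
  have h2 : Ddist χ ψ y ^ 2 + Ddist χ ξ y ^ 2 ≤ 2 * Ddist χ ψ y ^ 2 := by linarith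
  refine le_trans ?_ h2
  have hs : (0 : ℝ) < √2 := by positivity
  have hs2 : √2 * √2 = 2 := Real.mul_self_sqrt (by norm_num)
  have h3 : (2 - √2) * ∑ p ∈ primesUpTo ⌊y⌋₊, (1 : ℝ) / p - ε / √2 ≤
      (2 - √2) * ∑ p ∈ primesUpTo ⌊y⌋₊, (1 : ℝ) / p - (∑ p ∈ primesUpTo ⌊y⌋₊,
      (ψ (p : ZMod d) * (starRingEnd ℂ) (ξ (p : ZMod D))).re / p) / √2 := by gcongr
  refine h3.trans ?_
  rw [Ddist_sq, Ddist_sq, ← Finset.sum_add_distrib, Finset.mul_sum, Finset.sum_div,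
    ← Finset.sum_sub_distrib]
  refine Finset.sum_le_sum fun p _ => ?_
  set A := χ (p : ZMod q)
  set B := ψ (p : ZMod d)
  set E := ξ (p : ZMod D)
  have hA : ‖A‖ ≤ 1 := DirichletCharacter.norm_le_one χ _
  have hB : ‖B‖ ≤ 1 := DirichletCharacter.norm_le_one ψ _
  have hE : ‖E‖ ≤ 1 := DirichletCharacter.norm_le_one ξ _
  have k1 : (A * (starRingEnd ℂ) B).re + (A * (starRingEnd ℂ) E).re ≤ ‖B + E‖ := by
    calc (A * (starRingEnd ℂ) B).re + (A * (starRingEnd ℂ) E).re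
        = (A * (starRingEnd ℂ) (B + E)).re := by rw [map_add, mul_add, Complex.add_re]
      _ ≤ ‖A * (starRingEnd ℂ) (B + E)‖ := Complex.re_le_norm _
      _ = ‖A‖ * ‖B + E‖ := by rw [norm_mul, RCLike.norm_conj]
      _ ≤ ‖B + E‖ := mul_le_of_le_one_left (norm_nonneg _) hA
  have k2 : ‖B + E‖ ^ 2 ≤ 2 + 2 * (B * (starRingEnd ℂ) E).re := by
    have h4 : ‖B + E‖ ^ 2 = ‖B‖ ^ 2 + ‖E‖ ^ 2 + 2 * (B * (starRingEnd ℂ) E).re := by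
      simp only [← Complex.normSq_eq_norm_sq]
      rw [Complex.normSq_add]
    have h5 : ‖B‖ ^ 2 ≤ 1 := pow_le_one₀ (norm_nonneg _) hB
    have h6 : ‖E‖ ^ 2 ≤ 1 := pow_le_one₀ (norm_nonneg _) hE
    linarith
  have k3 : ‖B + E‖ ≤ √2 + (B * (starRingEnd ℂ) E).re / √2 := by
    have h7 : (B * (starRingEnd ℂ) E).re / √2 = (B * (starRingEnd ℂ) E).re * √2 / 2 := by
      rw [div_eq_div_iff hs.ne' (by norm_num), mul_assoc, hs2]
    rw [h7]
    nlinarith [sq_nonneg (‖B + E‖ - √2)]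
  have hp : (0 : ℝ) ≤ 1 / p := by positivity
  have k4 : 2 - √2 - (B * (starRingEnd ℂ) E).re / √2 ≤
      1 - (A * (starRingEnd ℂ) B).re + (1 - (A * (starRingEnd ℂ) E).re) := by linarith
  calc (2 - √2) * (1 / (p : ℝ)) - (B * (starRingEnd ℂ) E).re / p / √2
      = (2 - √2 - (B * (starRingEnd ℂ) E).re / √2) * (1 / p) := by ring
    _ ≤ (1 - (A * (starRingEnd ℂ) B).re + (1 - (A * (starRingEnd ℂ) E).re)) * (1 / p) := by
        gcongr
    _ = _ := by ring

theorem dirichletCharacter_natCast_eq_zero {n : ℕ} (χ : DirichletCharacter ℂ n) {k : ℕ}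
    (hk : ¬ k.Coprime n) : χ (k : ZMod n) = 0 :=
  χ.map_nonunit fun h => hk ((ZMod.isUnit_iff_coprime k n).mp h)

theorem changeLevel_natCast {n m : ℕ} (h : n ∣ m) (χ : DirichletCharacter ℂ n) (k : ℕ) :
    DirichletCharacter.changeLevel h χ (k : ZMod m) =
      if k.Coprime m then χ (k : ZMod n) else 0 := by
  split_ifs with hk
  · have := DirichletCharacter.changeLevel_eq_cast_of_dvd' χ h (a := (k : ℤ))
      (Nat.isCoprime_iff_coprime.mpr hk)
    simpa using this
  · exact dirichletCharacter_natCast_eq_zero _ hk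

theorem changeLevel_mul_inv_natCast {D d : ℕ} (hD : 1 ≤ D) (hd : 1 ≤ d)
    (ξ : DirichletCharacter ℂ D) (ψ : DirichletCharacter ℂ d) (k : ℕ) :
    (DirichletCharacter.changeLevel (dvd_mul_left d D) ψ *
      (DirichletCharacter.changeLevel (dvd_mul_right D d) ξ)⁻¹) (k : ZMod (D * d)) =
      ψ (k : ZMod d) * (starRingEnd ℂ) (ξ (k : ZMod D)) := by
  rw [MulChar.mul_apply, dirichletCharacter_inv_apply_eq_conj (Nat.mul_pos hD hd),
    changeLevel_natCast, changeLevel_natCast]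
  split_ifs with hk
  · rfl
  · rw [Nat.coprime_mul_iff_right, not_and_or] at hk
    rcases hk with hk | hk
    · rw [dirichletCharacter_natCast_eq_zero ξ hk]
      simp
    · rw [dirichletCharacter_natCast_eq_zero ψ hk]
      simp

/-- The logarithmic size of the smooth sum for a character different from the closest one. -/
theorem exists_log_mul_exp_Ddist_le :
    ∃ K y₁ : ℝ, 0 < K ∧ 3 ≤ y₁ ∧ ∀ y : ℝ, y₁ ≤ y → ∀ (q : ℕ) (χ : DirichletCharacter ℂ q) (D : ℕ)
      (ξ : DirichletCharacter ℂ D) (d : ℕ) (ψ : DirichletCharacter ℂ d), 1 ≤ d →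
      (D : ℝ) ≤ Real.log y → (d : ℝ) ≤ Real.log y → Ddist χ ξ y ≤ Ddist χ ψ y →
      (1 ≤ D → DirichletCharacter.changeLevel (dvd_mul_left d D) ψ ≠
        DirichletCharacter.changeLevel (dvd_mul_right D d) ξ) →
      Real.log y * Real.exp (-(Ddist χ ψ y) ^ 2 / 2) ≤ K * Real.log y ^ (0.8545 : ℝ) := by
  obtain ⟨C, N₀, hC, hN₀, hch⟩ := exists_sum_re_dirichletCharacter_div_le
  obtain ⟨C', hC', hM⟩ := exists_abs_sum_one_div_primes_sub_log_log_le
  refine ⟨Real.exp (C' + Real.log 2) * (Real.exp C * (1 + 2 / 0.0005)), N₀ + 4, by positivity,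
    by linarith [(Nat.cast_nonneg N₀ : (0 : ℝ) ≤ N₀)], ?_⟩
  intro y hy q χ D ξ d ψ hd hDy hdy hle hne
  have hN₀' : (0 : ℝ) ≤ N₀ := Nat.cast_nonneg N₀
  have hy4 : 4 ≤ y := by linarith
  have hY : N₀ ≤ ⌊y⌋₊ := Nat.le_floor (by linarith)
  have hlog1 : 1 ≤ Real.log y := by
    rw [Real.le_log_iff_exp_le (by linarith)]
    linarith [Real.exp_one_lt_d9]
  have hlog0 : 0 < Real.log y := by linarith
  set u := Real.log y with hu
  have hlu0 : 0 ≤ Real.log u := Real.log_nonneg hlog1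
  set ε := Real.log (2 * Real.log u + 1) + C with hε
  have hε0 : 0 ≤ ε := by
    have := Real.log_nonneg (show 1 ≤ 2 * Real.log u + 1 by linarith)
    linarith
  have hsum : ∑ p ∈ primesUpTo ⌊y⌋₊,
      (ψ (p : ZMod d) * (starRingEnd ℂ) (ξ (p : ZMod D))).re / p ≤ ε := by
    rcases Nat.eq_zero_or_pos D with rfl | hD
    · refine le_trans (le_of_eq (Finset.sum_eq_zero fun p hp => ?_)) hε0
      have hp' : p.Prime := (Finset.mem_filter.mp hp).2
      rw [dirichletCharacter_natCast_eq_zero ξ (k := p)]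
      · simp
      · rw [Nat.coprime_zero_right]
        exact hp'.ne_one
    · have h1 := hch ⌊y⌋₊ hY (D * d) (DirichletCharacter.changeLevel (dvd_mul_left d D) ψ *
        (DirichletCharacter.changeLevel (dvd_mul_right D d) ξ)⁻¹) (Nat.mul_pos hD hd)
        (fun h => hne hD (mul_inv_eq_one.mp h))
      simp only [changeLevel_mul_inv_natCast hD hd] at h1
      refine h1.trans ?_
      have hD' : (1 : ℝ) ≤ D := by exact_mod_cast hD
      have hd' : (1 : ℝ) ≤ d := by exact_mod_cast hd
      have h2 : Real.log ((D * d : ℕ) : ℝ) ≤ 2 * Real.log u := by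
        push_cast
        rw [Real.log_mul (by positivity) (by positivity)]
        have := Real.log_le_log (by linarith) hDy
        have := Real.log_le_log (by linarith) hdy
        linarith
      have h3 : 0 ≤ Real.log ((D * d : ℕ) : ℝ) := Real.log_natCast_nonneg _
      rw [hε]
      gcongr
  have hrep := le_two_mul_Ddist_sq χ ξ ψ hle hsum
  have hL : Real.log u - Real.log 2 - C' ≤ ∑ p ∈ primesUpTo ⌊y⌋₊, (1 : ℝ) / p := by
    have h2 := (abs_le.mp (hM ⌊y⌋₊ (by omega))).1
    have hfl : y / 2 ≤ (⌊y⌋₊ : ℝ) := by linarith [Nat.lt_floor_add_one y]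
    have h3 : u / 2 ≤ Real.log (⌊y⌋₊ : ℝ) := by
      have h4 : Real.log (y / 2) ≤ Real.log (⌊y⌋₊ : ℝ) := Real.log_le_log (by linarith) hfl
      rw [Real.log_div (by linarith) (by norm_num)] at h4
      have h5 : 2 * Real.log 2 ≤ u := by
        rw [hu, ← Real.log_rpow (by norm_num)]
        exact Real.log_le_log (by norm_num) (by norm_num; linarith)
      linarith
    have h6 : Real.log (u / 2) ≤ Real.log (Real.log (⌊y⌋₊ : ℝ)) :=
      Real.log_le_log (by linarith) h3
    rw [Real.log_div (by linarith) (by norm_num)] at h6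
    linarith
  have hs1 : √2 ≤ 1.4143 := Real.sqrt_le_iff.mpr (by norm_num)
  have hs2 : 1 ≤ √2 := Real.one_le_sqrt.mpr (by norm_num)
  have h7 : ε / √2 ≤ ε := div_le_self hε0 hs2
  have hlog2 : 0 < Real.log 2 := Real.log_pos (by norm_num)
  have h8 : -(Ddist χ ψ y) ^ 2 / 2 ≤ -0.146 * Real.log u + (C' + Real.log 2) + ε := by
    have h9 : (2 - √2) * (Real.log u - Real.log 2 - C') ≤
        (2 - √2) * ∑ p ∈ primesUpTo ⌊y⌋₊, (1 : ℝ) / p := by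
      gcongr
      linarith
    have h10 : 0.5857 * Real.log u - (Real.log 2 + C') ≤
        (2 - √2) * (Real.log u - Real.log 2 - C') := by
      nlinarith
    linarith
  have h11 : Real.exp ε ≤ Real.exp C * (1 + 2 / 0.0005) * u ^ (0.0005 : ℝ) := by
    rw [hε, Real.exp_add, Real.exp_log (by linarith), mul_comm, mul_assoc]
    gcongr
    have h12 := Real.log_le_rpow_div hlog0.le (show (0 : ℝ) < 0.0005 by norm_num)
    have h13 : 1 ≤ u ^ (0.0005 : ℝ) := Real.one_le_rpow hlog1 (by norm_num)
    have h14 : (1 + 2 / 0.0005) * u ^ (0.0005 : ℝ) =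
      u ^ (0.0005 : ℝ) + 2 * (u ^ (0.0005 : ℝ) / 0.0005) := by ring
    rw [h14]
    linarith
  calc u * Real.exp (-(Ddist χ ψ y) ^ 2 / 2)
      ≤ u * Real.exp (-0.146 * Real.log u + (C' + Real.log 2) + ε) := by gcongr
    _ = u ^ (1 : ℝ) * u ^ (-0.146 : ℝ) * Real.exp (C' + Real.log 2) * Real.exp ε := by
        rw [Real.exp_add, Real.exp_add, Real.rpow_def_of_pos hlog0 (-0.146), Real.rpow_one,
          mul_comm (-0.146) (Real.log u)]
        ring
    _ ≤ u ^ (1 : ℝ) * u ^ (-0.146 : ℝ) * Real.exp (C' + Real.log 2) *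
        (Real.exp C * (1 + 2 / 0.0005) * u ^ (0.0005 : ℝ)) := by gcongr
    _ = Real.exp (C' + Real.log 2) * (Real.exp C * (1 + 2 / 0.0005)) * u ^ (0.8545 : ℝ) := by
        rw [show (0.8545 : ℝ) = 1 + -0.146 + 0.0005 by norm_num, Real.rpow_add hlog0,
          Real.rpow_add hlog0]
        ring

theorem e2pi_add (x y : ℝ) : e2pi (x + y) = e2pi x * e2pi y := by
  rw [e2pi, e2pi, e2pi, ← Complex.exp_add]
  push_cast
  ring_nf

theorem e2pi_natCast (n : ℕ) : e2pi n = 1 := by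
  rw [e2pi, Complex.exp_eq_one_iff]
  exact ⟨n, by push_cast; ring⟩

theorem e2pi_natCast_mul (n : ℕ) (x : ℝ) : e2pi (n * x) = e2pi x ^ n := by
  rw [e2pi, e2pi, ← Complex.exp_nat_mul]
  push_cast
  ring_nf

theorem stdAddChar_intCast_eq_e2pi {b : ℕ} [NeZero b] (k : ℤ) :
    ZMod.stdAddChar (k : ZMod b) = e2pi ((k : ℝ) / b) := by
  rw [ZMod.stdAddChar_coe, e2pi]
  push_cast
  ring_nf

theorem sum_e2pi_mul_div (n : ℕ) {i : ℕ} (hi : 1 ≤ i) :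
    ∑ t ∈ Finset.range i, e2pi ((n : ℝ) * t / i) = if i ∣ n then (i : ℂ) else 0 := by
  have hi0 : (i : ℝ) ≠ 0 := by positivity
  have h1 : ∀ t : ℕ, e2pi ((n : ℝ) * t / i) = e2pi ((n : ℝ) / i) ^ t := fun t => by
    rw [← e2pi_natCast_mul]
    ring_nf
  simp only [h1]
  split_ifs with h
  · obtain ⟨k, rfl⟩ := h
    have : ((i * k : ℕ) : ℝ) / i = (k : ℝ) := by push_cast; field_simp
    rw [this, e2pi_natCast]
    simp
  · have hne : e2pi ((n : ℝ) / i) ≠ 1 := by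
      intro h2
      rw [e2pi, Complex.exp_eq_one_iff] at h2
      obtain ⟨k, hk⟩ := h2
      have h3 : ((n : ℝ) / i : ℂ) = (k : ℂ) := by
        have h4 := Complex.two_pi_I_ne_zero
        apply mul_left_cancel₀ h4
        rw [mul_comm _ (k : ℂ), ← hk]
        push_cast
        ring
      have h5 : (n : ℂ) = (k : ℂ) * i := by
        have : (i : ℂ) ≠ 0 := by exact_mod_cast hi0
        rw [← h3]
        push_cast
        field_simp
      have h6 : (n : ℤ) = k * i := by exact_mod_cast h5
      exact h (Int.natCast_dvd_natCast.mp ⟨k, by rw [h6, mul_comm]⟩)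
    rw [geom_sum_eq hne, ← e2pi_natCast_mul]
    have : (i : ℝ) * ((n : ℝ) / i) = n := by field_simp
    rw [this, e2pi_natCast]
    simp

theorem sum_zmod_eq_sum_range {b : ℕ} [NeZero b] (f : ZMod b → ℂ) :
    ∑ x : ZMod b, f x = ∑ k ∈ Finset.range b, f (k : ZMod b) := by
  refine Finset.sum_nbij' (fun x => x.val) (fun k => (k : ZMod b)) ?_ ?_ ?_ ?_ ?_
  · intro x _
    exact Finset.mem_range.mpr (ZMod.val_lt x)
  · intro k _
    exact Finset.mem_univ _
  · intro x _
    exact ZMod.natCast_zmod_val x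
  · intro k hk
    exact ZMod.val_cast_of_lt (Finset.mem_range.mp hk)
  · intro x _
    rw [ZMod.natCast_zmod_val x]

theorem gaussSum_mulShift_natCast_eq_sum_range {b : ℕ} [NeZero b] (ψ : DirichletCharacter ℂ b)
    (n : ℕ) :
    gaussSum ψ (ZMod.stdAddChar.mulShift (n : ZMod b)) =
      ∑ u ∈ Finset.range b, ψ (u : ZMod b) * e2pi ((n : ℝ) * u / b) := by
  rw [gaussSum, sum_zmod_eq_sum_range]
  refine Finset.sum_congr rfl fun u _ => ?_
  rw [AddChar.mulShift_apply]
  have := stdAddChar_intCast_eq_e2pi (b := b) ((n : ℤ) * u)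
  push_cast at this
  rw [this]

/-- The Gauss sum of a primitive character has absolute value the square root of the modulus. -/
theorem norm_gaussSum_stdAddChar {D : ℕ} [NeZero D] {ξ : DirichletCharacter ℂ D}
    (hξ : ξ.IsPrimitive) : ‖gaussSum ξ ZMod.stdAddChar‖ = √D := by
  set G := gaussSum ξ ZMod.stdAddChar with hG
  have h1 := congr_fun (ZMod.dft_dft (ξ : ZMod D → ℂ)) (-1)
  rw [ZMod.dft_apply] at h1
  simp only [hξ.fourierTransform_eq_inv_mul_gaussSum, neg_neg, mul_neg, mul_one, map_one,
    smul_eq_mul] at h1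
  have h2 : ∑ k : ZMod D, ZMod.stdAddChar k * (ξ⁻¹ (-k) * G) =
      ξ⁻¹ (-1) * gaussSum ξ⁻¹ ZMod.stdAddChar * G := by
    rw [gaussSum, Finset.mul_sum, Finset.sum_mul]
    refine Finset.sum_congr rfl fun k _ => ?_
    rw [neg_eq_neg_one_mul k, map_mul]
    ring
  rw [h2] at h1
  have h3 : gaussSum ξ⁻¹ ZMod.stdAddChar = ξ⁻¹ (-1) * star G := by
    have h7 := gaussSum_mulShift ξ⁻¹ (ZMod.stdAddChar (N := D)) (-1)
    rw [hG, star_gaussSum_eq, AddChar.inv_mulShift]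
    simpa using h7.symm
  have h4 : ξ⁻¹ (-1) * ξ⁻¹ (-1) = 1 := by
    rw [← map_mul]
    simp
  rw [h3, ← mul_assoc, h4, one_mul] at h1
  have h5 : ((‖G‖ ^ 2 : ℝ) : ℂ) = (D : ℝ) := by
    rw [← Complex.normSq_eq_norm_sq, Complex.normSq_eq_conj_mul_self]
    simpa using h1
  have h6 : ‖G‖ ^ 2 = (D : ℝ) := by exact_mod_cast h5
  rw [← h6, Real.sqrt_sq (norm_nonneg _)]

theorem sum_range_mul_eq_sum_range_sum_range (f : ℕ → ℂ) (D i : ℕ) :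
    ∑ v ∈ Finset.range (D * i), f v =
      ∑ t ∈ Finset.range i, ∑ w ∈ Finset.range D, f (D * t + w) := by
  induction i with
  | zero => simp
  | succ i ih => rw [Finset.sum_range_succ, ← ih, mul_add, mul_one, Finset.sum_range_add]

theorem sum_range_mul_dvd (f : ℕ → ℂ) {j : ℕ} (hj : 1 ≤ j) (K : ℕ) :
    ∑ u ∈ Finset.range (j * K), (if j ∣ u then f u else 0) =
      ∑ v ∈ Finset.range K, f (j * v) := by
  rw [sum_range_mul_eq_sum_range_sum_range]
  refine Finset.sum_congr rfl fun t _ => ?_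
  rw [Finset.sum_eq_single_of_mem 0 (Finset.mem_range.mpr hj)]
  · simp
  · intro w hw hw0
    rw [if_neg]
    intro h
    rw [Nat.dvd_add_right (dvd_mul_right j t)] at h
    exact absurd (Nat.le_of_dvd (Nat.pos_of_ne_zero hw0) h) (by simpa using hw)

theorem sum_range_primitive_mul_e2pi {D : ℕ} [NeZero D] {ξ : DirichletCharacter ℂ D}
    (hξ : ξ.IsPrimitive) (n : ℕ) {i : ℕ} (hi : 1 ≤ i) :
    ∑ v ∈ Finset.range (D * i), ξ (v : ZMod D) * e2pi ((n : ℝ) * v / (D * i : ℕ)) =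
      if i ∣ n then i * ξ⁻¹ ((n / i : ℕ) : ZMod D) * gaussSum ξ ZMod.stdAddChar else 0 := by
  have hi0 : (i : ℝ) ≠ 0 := by positivity
  have hD0 : (D : ℝ) ≠ 0 := by exact_mod_cast NeZero.ne D
  have h1 : ∀ t w : ℕ, ξ ((D * t + w : ℕ) : ZMod D) *
      e2pi ((n : ℝ) * (D * t + w : ℕ) / (D * i : ℕ)) =
      e2pi ((n : ℝ) * t / i) * (ξ (w : ZMod D) * e2pi ((n : ℝ) * w / (D * i : ℕ))) := fun t w => by
    have h2 : (n : ℝ) * (D * t + w : ℕ) / (D * i : ℕ) =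
        (n : ℝ) * t / i + (n : ℝ) * w / (D * i : ℕ) := by
      push_cast
      field_simp
    rw [h2, e2pi_add]
    push_cast
    rw [CharP.cast_eq_zero, zero_mul, zero_add]
    ring
  rw [sum_range_mul_eq_sum_range_sum_range]
  simp only [h1]
  simp only [← Finset.mul_sum]
  rw [← Finset.sum_mul, sum_e2pi_mul_div n hi]
  split_ifs with h
  · obtain ⟨l, rfl⟩ := h
    rw [Nat.mul_div_cancel_left l hi, mul_assoc, ← gaussSum_mulShift_of_isPrimitive _ hξ,
      gaussSum_mulShift_natCast_eq_sum_range]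
    congr 1
    refine Finset.sum_congr rfl fun w _ => ?_
    congr 2
    push_cast
    field_simp
  · rw [zero_mul]

theorem coprime_eq_sum_moebius {m : ℕ} (hm : 1 ≤ m) (u : ℕ) :
    (if u.Coprime m then (1 : ℂ) else 0) =
      ∑ j ∈ m.divisors, if j ∣ u then (ArithmeticFunction.moebius j : ℂ) else 0 := by
  have h1 : (∑ j ∈ m.divisors, if j ∣ u then (ArithmeticFunction.moebius j : ℤ) else 0) =
      if u.Coprime m then 1 else 0 := by
    rw [← Finset.sum_filter]
    have h2 : m.divisors.filter (· ∣ u) = (u.gcd m).divisors := by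
      ext j
      simp only [Finset.mem_filter, Nat.mem_divisors, Nat.dvd_gcd_iff]
      have : u.gcd m ≠ 0 := Nat.gcd_ne_zero_right (by omega)
      have : m ≠ 0 := by omega
      tauto
    rw [h2]
    have h3 := congr_arg (fun f : ArithmeticFunction ℤ => f (u.gcd m))
      ArithmeticFunction.moebius_mul_coe_zeta
    simp only [ArithmeticFunction.coe_mul_zeta_apply, ArithmeticFunction.one_apply] at h3
    rw [h3]
  have h4 := congr_arg (fun x : ℤ => (x : ℂ)) h1
  push_cast at h4
  rw [← h4]

/-- The Gauss sums of an imprimitive character. -/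
theorem gaussSum_changeLevel_mulShift {D m : ℕ} [NeZero D] [NeZero (D * m)] (hm : 1 ≤ m)
    {ξ : DirichletCharacter ℂ D} (hξ : ξ.IsPrimitive) (n : ℕ) :
    gaussSum (DirichletCharacter.changeLevel (dvd_mul_right D m) ξ)
        (ZMod.stdAddChar.mulShift (n : ZMod (D * m))) =
      ∑ j ∈ m.divisors, (ArithmeticFunction.moebius j : ℂ) * ξ (j : ZMod D) *
        if m / j ∣ n then (m / j : ℕ) * ξ⁻¹ ((n / (m / j) : ℕ) : ZMod D) *
          gaussSum ξ ZMod.stdAddChar else 0 := by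
  rw [gaussSum_mulShift_natCast_eq_sum_range]
  have h1 : ∀ u : ℕ, DirichletCharacter.changeLevel (dvd_mul_right D m) ξ (u : ZMod (D * m)) =
      ∑ j ∈ m.divisors, if j ∣ u then (ArithmeticFunction.moebius j : ℂ) * ξ (u : ZMod D)
        else 0 := fun u => by
    have h2 : ∀ j ∈ m.divisors,
        (if j ∣ u then (ArithmeticFunction.moebius j : ℂ) * ξ (u : ZMod D) else 0) =
        (if j ∣ u then (ArithmeticFunction.moebius j : ℂ) else 0) * ξ (u : ZMod D) := fun j _ => by
      split_ifs <;> simp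
    rw [Finset.sum_congr rfl h2, ← Finset.sum_mul, ← coprime_eq_sum_moebius hm,
      changeLevel_natCast]
    by_cases hu : u.Coprime D
    · by_cases hum : u.Coprime m
      · rw [if_pos (Nat.coprime_mul_iff_right.mpr ⟨hu, hum⟩), if_pos hum, one_mul]
      · rw [if_neg fun h => hum (Nat.coprime_mul_iff_right.mp h).2, if_neg hum, zero_mul]
    · simp [dirichletCharacter_natCast_eq_zero ξ hu]
  simp only [h1, Finset.sum_mul]
  rw [Finset.sum_comm]
  refine Finset.sum_congr rfl fun j hj => ?_
  have hj' := Nat.dvd_of_mem_divisors hj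
  have hj1 : 1 ≤ j := Nat.pos_of_mem_divisors hj
  have hmj : m = j * (m / j) := (Nat.mul_div_cancel' hj').symm
  have hi : 1 ≤ m / j := Nat.div_pos (Nat.le_of_dvd hm hj') hj1
  rw [← sum_range_primitive_mul_e2pi hξ n hi, Finset.mul_sum]
  have hr : D * m = j * (D * (m / j)) := by
    conv_lhs => rw [hmj]
    ring
  have h3 : ∑ u ∈ Finset.range (D * m),
      (if j ∣ u then (ArithmeticFunction.moebius j : ℂ) * ξ (u : ZMod D) else 0) *
        e2pi ((n : ℝ) * u / (D * m : ℕ)) =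
      ∑ u ∈ Finset.range (j * (D * (m / j))),
        if j ∣ u then (ArithmeticFunction.moebius j : ℂ) * ξ (u : ZMod D) *
          e2pi ((n : ℝ) * u / (j * (D * (m / j)) : ℕ)) else 0 := by
    rw [← hr]
    refine Finset.sum_congr rfl fun u _ => ?_
    split_ifs <;> simp
  rw [h3, sum_range_mul_dvd _ hj1]
  refine Finset.sum_congr rfl fun v _ => ?_
  have hj0 : (j : ℝ) ≠ 0 := by positivity
  have h4 : (n : ℝ) * (j * v : ℕ) / (j * (D * (m / j)) : ℕ) = (n : ℝ) * v / (D * (m / j) : ℕ) := by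
    rw [Nat.cast_mul j v, Nat.cast_mul j (D * (m / j)), mul_left_comm,
      mul_div_mul_left _ _ hj0]
  rw [h4]
  push_cast
  rw [map_mul]
  ring

theorem card_divisors_le_two_mul_sqrt (m : ℕ) : (m.divisors.card : ℝ) ≤ 2 * √m := by
  have h1 : (m.divisors.filter (· ≤ m.sqrt)).card ≤ m.sqrt := by
    calc (m.divisors.filter (· ≤ m.sqrt)).card ≤ (Finset.Icc 1 m.sqrt).card := by
          refine Finset.card_le_card fun d hd => ?_
          rw [Finset.mem_filter] at hd
          exact Finset.mem_Icc.mpr ⟨Nat.pos_of_mem_divisors hd.1, hd.2⟩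
      _ = m.sqrt := by simp
  have h2 : (m.divisors.filter (fun d => ¬ d ≤ m.sqrt)).card ≤ m.sqrt := by
    calc (m.divisors.filter (fun d => ¬ d ≤ m.sqrt)).card ≤ (Finset.Icc 1 m.sqrt).card := by
          refine Finset.card_le_card_of_injOn (fun d => m / d) (fun d hd => ?_) ?_
          · rw [Finset.mem_coe, Finset.mem_filter, Nat.mem_divisors] at hd
            obtain ⟨⟨⟨k, rfl⟩, h0⟩, hlt⟩ := hd
            have hd0 : 0 < d := Nat.pos_of_ne_zero (left_ne_zero_of_mul h0)
            have hk0 : 0 < k := Nat.pos_of_ne_zero (right_ne_zero_of_mul h0)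
            simp only [Finset.coe_Icc, Set.mem_Icc, Nat.mul_div_cancel_left k hd0]
            refine ⟨hk0, ?_⟩
            rw [Nat.le_sqrt]
            by_contra hcon
            have hlt' := Nat.sqrt_lt.mp (not_le.mp hlt)
            have : k < d := Nat.lt_of_mul_lt_mul_left hlt'
            nlinarith
          · intro d hd d' hd' h
            rw [Finset.mem_coe, Finset.mem_filter, Nat.mem_divisors] at hd hd'
            have h0 : 0 < m / d :=
              Nat.div_pos (Nat.le_of_dvd (Nat.pos_of_ne_zero hd.1.2) hd.1.1)
                (Nat.pos_of_dvd_of_pos hd.1.1 (Nat.pos_of_ne_zero hd.1.2))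
            have h1 := Nat.div_mul_cancel hd.1.1
            have h2 := Nat.div_mul_cancel hd'.1.1
            have h' : m / d = m / d' := h
            rw [← h'] at h2
            exact Nat.eq_of_mul_eq_mul_left h0 (h1.trans h2.symm)
      _ = m.sqrt := by simp
  have h3 := Finset.card_filter_add_card_filter_not (s := m.divisors) (fun d => d ≤ m.sqrt)
  have h4 : m.divisors.card ≤ 2 * m.sqrt := by omega
  have h5 : (m.sqrt : ℝ) ≤ √m := Real.nat_sqrt_le_real_sqrt
  have h6 : (m.divisors.card : ℝ) ≤ 2 * m.sqrt := by exact_mod_cast h4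
  linarith

theorem sum_Icc_dvd (h : ℕ → ℂ) {i : ℕ} (hi : 1 ≤ i) (N : ℕ) :
    ∑ n ∈ Finset.Icc 1 N, (if i ∣ n then h n else 0) =
      ∑ l ∈ Finset.Icc 1 (N / i), h (i * l) := by
  rw [← Finset.sum_filter]
  refine Finset.sum_nbij' (fun n => n / i) (fun l => i * l) ?_ ?_ ?_ ?_ ?_
  · intro n hn
    simp only [Finset.mem_filter, Finset.mem_Icc] at hn
    exact Finset.mem_Icc.mpr ⟨Nat.div_pos (Nat.le_of_dvd (by omega) hn.2) hi,
      Nat.div_le_div_right hn.1.2⟩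
  · intro l hl
    rw [Finset.mem_Icc] at hl
    refine Finset.mem_filter.mpr ⟨Finset.mem_Icc.mpr ⟨Nat.mul_pos hi hl.1, ?_⟩,
      dvd_mul_right i l⟩
    rw [mul_comm]
    exact (Nat.le_div_iff_mul_le hi).mp hl.2
  · intro n hn
    exact Nat.mul_div_cancel' (Finset.mem_filter.mp hn).2
  · intro l _
    exact Nat.mul_div_cancel_left l hi
  · intro n hn
    rw [Nat.mul_div_cancel' (Finset.mem_filter.mp hn).2]

/-- The logarithmic sum of `χ ξ̄` over the `Y`-smooth integers up to `X`. -/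
noncomputable def smoothLogSum {q D : ℕ} (Y : ℕ) (χ : DirichletCharacter ℂ q)
    (ξ : DirichletCharacter ℂ D) (X : ℕ) : ℂ :=
  ∑ l ∈ Finset.Icc 1 X, smoothHom Y (charHom χ * charHom ξ⁻¹) l / l

theorem sum_smoothHom_mul_gaussSum_div {q D m : ℕ} [NeZero D] [NeZero (D * m)] (hm : 1 ≤ m)
    (Y : ℕ) (χ : DirichletCharacter ℂ q) {ξ : DirichletCharacter ℂ D} (hξ : ξ.IsPrimitive)
    (N : ℕ) :
    ∑ n ∈ Finset.Icc 1 N, smoothHom Y (charHom χ) n *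
        gaussSum (DirichletCharacter.changeLevel (dvd_mul_right D m) ξ)
          (ZMod.stdAddChar.mulShift (n : ZMod (D * m))) / n =
      gaussSum ξ ZMod.stdAddChar * ∑ j ∈ m.divisors,
        (ArithmeticFunction.moebius j : ℂ) * ξ (j : ZMod D) * smoothHom Y (charHom χ) (m / j) *
          smoothLogSum Y χ ξ (N / (m / j)) := by
  simp only [gaussSum_changeLevel_mulShift hm hξ, Finset.mul_sum, Finset.sum_div]
  rw [Finset.sum_comm]
  refine Finset.sum_congr rfl fun j hj => ?_
  have hj' := Nat.dvd_of_mem_divisors hj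
  have hj1 : 1 ≤ j := Nat.pos_of_mem_divisors hj
  have hi : 1 ≤ m / j := Nat.div_pos (Nat.le_of_dvd hm hj') hj1
  generalize m / j = i at hi
  have hi0 : (i : ℂ) ≠ 0 := by
    have : i ≠ 0 := by omega
    exact_mod_cast this
  have h1 : ∀ n ∈ Finset.Icc 1 N, smoothHom Y (charHom χ) n *
      ((ArithmeticFunction.moebius j : ℂ) * ξ (j : ZMod D) *
        if i ∣ n then (i : ℂ) * ξ⁻¹ ((n / i : ℕ) : ZMod D) *
          gaussSum ξ ZMod.stdAddChar else 0) / n =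
      if i ∣ n then smoothHom Y (charHom χ) n *
        ((ArithmeticFunction.moebius j : ℂ) * ξ (j : ZMod D) *
          ((i : ℂ) * ξ⁻¹ ((n / i : ℕ) : ZMod D) *
          gaussSum ξ ZMod.stdAddChar)) / n else 0 := fun n _ => by
    split_ifs <;> simp
  rw [Finset.sum_congr rfl h1, sum_Icc_dvd _ hi, smoothLogSum, Finset.mul_sum, Finset.mul_sum]
  refine Finset.sum_congr rfl fun l hl => ?_
  have hl0 : (l : ℂ) ≠ 0 := by
    have : l ≠ 0 := by
      have := (Finset.mem_Icc.mp hl).1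
      omega
    exact_mod_cast this
  rw [Nat.mul_div_cancel_left l hi, map_mul, smoothHom_mul, charHom_apply ξ⁻¹]
  push_cast
  field_simp

theorem norm_moebius_le_one (j : ℕ) : ‖(ArithmeticFunction.moebius j : ℂ)‖ ≤ 1 := by
  have h := ArithmeticFunction.abs_moebius_le_one (n := j)
  rw [Complex.norm_intCast]
  exact_mod_cast h

theorem norm_sum_smoothHom_mul_gaussSum_div_le {q D m : ℕ} [NeZero D] [NeZero (D * m)]
    (hm : 1 ≤ m) (Y : ℕ) (χ : DirichletCharacter ℂ q) {ξ : DirichletCharacter ℂ D}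
    (hξ : ξ.IsPrimitive) (N : ℕ) {B : ℝ} (hB : ∀ X, ‖smoothLogSum Y χ ξ X‖ ≤ B) :
    ‖∑ n ∈ Finset.Icc 1 N, smoothHom Y (charHom χ) n *
        gaussSum (DirichletCharacter.changeLevel (dvd_mul_right D m) ξ)
          (ZMod.stdAddChar.mulShift (n : ZMod (D * m))) / n‖ ≤ 2 * √(D * m : ℕ) * B := by
  have hB0 : 0 ≤ B := (norm_nonneg _).trans (hB 0)
  rw [sum_smoothHom_mul_gaussSum_div hm Y χ hξ, norm_mul, norm_gaussSum_stdAddChar hξ]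
  have h1 : ‖∑ j ∈ m.divisors,
        (ArithmeticFunction.moebius j : ℂ) * ξ (j : ZMod D) * smoothHom Y (charHom χ) (m / j) *
          smoothLogSum Y χ ξ (N / (m / j))‖ ≤ m.divisors.card * B := by
    rw [← nsmul_eq_mul]
    refine (norm_sum_le _ _).trans (Finset.sum_le_card_nsmul _ _ _ fun j _ => ?_)
    rw [norm_mul, norm_mul, norm_mul]
    have k1 := norm_moebius_le_one j
    have k2 := DirichletCharacter.norm_le_one ξ (j : ZMod D)
    have k3 := norm_smoothHom_le_one (Y := Y) (norm_charHom_le_one χ) (m / j)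
    calc _ ≤ 1 * 1 * 1 * B := by
          gcongr
          exact hB _
      _ = B := by ring
  calc √D * _ ≤ √D * (2 * √m * B) := by
        gcongr
        refine h1.trans ?_
        gcongr
        exact card_divisors_le_two_mul_sqrt m
    _ = 2 * √(D * m : ℕ) * B := by
        rw [Nat.cast_mul, Real.sqrt_mul (by positivity)]
        ring

theorem norm_smoothLogSum_div_sub_le {q D : ℕ} (Y : ℕ) (χ : DirichletCharacter ℂ q)
    (ξ : DirichletCharacter ℂ D) (N : ℕ) {i : ℕ} (hi : 1 ≤ i) :
    ‖smoothLogSum Y χ ξ (N / i) - smoothLogSum Y χ ξ N‖ ≤ i := by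
  have hle : N / i ≤ N := Nat.div_le_self N i
  have hi0 : (0 : ℝ) < i := by exact_mod_cast hi
  have h1 : smoothLogSum Y χ ξ N - smoothLogSum Y χ ξ (N / i) =
      ∑ l ∈ Finset.Ioc (N / i) N, smoothHom Y (charHom χ * charHom ξ⁻¹) l / l := by
    rw [smoothLogSum, smoothLogSum, Icc_one_eq_Ioc_zero, Icc_one_eq_Ioc_zero, sub_eq_iff_eq_add',
      Finset.sum_Ioc_consecutive _ (Nat.zero_le _) hle]
  rw [norm_sub_rev, h1]
  rcases Nat.eq_zero_or_pos N with rfl | hN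
  · simp
  have hN0 : (0 : ℝ) < N := by exact_mod_cast hN
  have h2 : ∀ l ∈ Finset.Ioc (N / i) N,
      ‖smoothHom Y (charHom χ * charHom ξ⁻¹) l / l‖ ≤ (i : ℝ) / N := fun l hl => by
    rw [Finset.mem_Ioc] at hl
    have hl0 : (0 : ℝ) < l := by
      have : 0 < l := (Nat.zero_le _).trans_lt hl.1
      exact_mod_cast this
    have h3 : (N : ℝ) ≤ i * l := by
      have := (Nat.div_lt_iff_lt_mul hi).mp hl.1
      have h4 : N ≤ i * l := by rw [mul_comm]; exact this.le
      exact_mod_cast h4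
    rw [norm_div, Complex.norm_natCast, div_le_div_iff₀ hl0 hN0]
    have := norm_smoothHom_le_one (Y := Y) (norm_charHom_mul_le_one χ ξ⁻¹) l
    nlinarith
  refine (norm_sum_le _ _).trans ((Finset.sum_le_card_nsmul _ _ _ h2).trans ?_)
  rw [Nat.card_Ioc, nsmul_eq_mul]
  have h5 : ((N - N / i : ℕ) : ℝ) ≤ N := by exact_mod_cast Nat.sub_le N (N / i)
  calc ((N - N / i : ℕ) : ℝ) * (i / N) ≤ N * (i / N) := by gcongr
    _ = i := by field_simp

theorem sum_divisors_moebius_mul {m : ℕ} (hm : m ≠ 0) (h : ℕ →* ℂ) :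
    ∑ j ∈ m.divisors, (ArithmeticFunction.moebius j : ℂ) * h j =
      ∏ p ∈ m.primeFactors, (1 - h p) := by
  have h1 : ∑ j ∈ m.divisors, (ArithmeticFunction.moebius j : ℂ) * h j =
      ∑ j ∈ m.divisors with Squarefree j, (ArithmeticFunction.moebius j : ℂ) * h j := by
    rw [Finset.sum_filter]
    refine Finset.sum_congr rfl fun j _ => ?_
    split_ifs with hj
    · rfl
    · rw [ArithmeticFunction.moebius_eq_zero_of_not_squarefree hj]
      simp
  rw [h1, Nat.sum_divisors_filter_squarefree hm]
  have h2 : ∏ p ∈ m.primeFactors, (1 - h p) = ∏ p ∈ m.primeFactors, (-h p + 1) :=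
    Finset.prod_congr rfl fun p _ => by ring
  have h3 : (UniqueFactorizationMonoid.normalizedFactors m).toFinset = m.primeFactors := by
    rw [Nat.factors_eq]
    rfl
  rw [h3, h2, Finset.prod_add_one]
  refine Finset.sum_congr rfl fun s hs => ?_
  have hs' : ∀ p ∈ s, p.Prime := fun p hp =>
    Nat.prime_of_mem_primeFactors (Finset.mem_powerset.mp hs hp)
  have h4 : s.val.prod = ∏ p ∈ s, p := by simp
  rw [h4]
  clear hs h4
  induction s using Finset.induction_on with
  | empty => simp
  | insert p s hp ih =>
    have hp' := hs' p (Finset.mem_insert_self p s)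
    have ih' := ih fun r hr => hs' r (Finset.mem_insert_of_mem hr)
    rw [Finset.prod_insert hp, Finset.prod_insert hp]
    have hcop : p.Coprime (∏ r ∈ s, r) := by
      refine Nat.Coprime.prod_right fun r hr => ?_
      refine (Nat.coprime_primes hp' (hs' r (Finset.mem_insert_of_mem hr))).mpr ?_
      rintro rfl
      exact hp hr
    rw [ArithmeticFunction.isMultiplicative_moebius.map_mul_of_coprime hcop,
      ArithmeticFunction.moebius_apply_prime hp', map_mul, ← ih']
    push_cast
    ring

theorem norm_dirichletCharacter_natCast_eq_one {q : ℕ} (χ : DirichletCharacter ℂ q) {k : ℕ}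
    (hk : k.Coprime q) : ‖χ (k : ZMod q)‖ = 1 := by
  have h := DirichletCharacter.unit_norm_eq_one χ (ZMod.unitOfCoprime k hk)
  simpa using h

/-- The norm of the Möbius sum occurring in the main term. -/
theorem norm_sum_moebius_mul_eq {q D m : ℕ} (hD : 1 ≤ D) (hm : 1 ≤ m) (hmq : m.Coprime q)
    (χ : DirichletCharacter ℂ q) (ξ : DirichletCharacter ℂ D) :
    ‖∑ j ∈ m.divisors, (ArithmeticFunction.moebius j : ℂ) * ξ (j : ZMod D) *
        χ ((m / j : ℕ) : ZMod q)‖ =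
      ∏ p ∈ m.primeFactors, ‖1 - (charHom χ * charHom ξ⁻¹) p‖ := by
  have hcop : ∀ {j : ℕ}, j ∣ m → ‖χ (j : ZMod q)‖ = 1 := fun hj =>
    norm_dirichletCharacter_natCast_eq_one χ (hmq.coprime_dvd_left hj)
  have h1 : ∀ j ∈ m.divisors, (ArithmeticFunction.moebius j : ℂ) * ξ (j : ZMod D) *
      χ ((m / j : ℕ) : ZMod q) = χ (m : ZMod q) *
        ((ArithmeticFunction.moebius j : ℂ) * (charHom ξ * charHom χ⁻¹) j) := fun j hj => by
    have hj' := Nat.dvd_of_mem_divisors hj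
    have hne : χ (j : ZMod q) ≠ 0 := by
      rw [← norm_ne_zero_iff, hcop hj']
      exact one_ne_zero
    have h2 : χ (m : ZMod q) = χ (j : ZMod q) * χ ((m / j : ℕ) : ZMod q) := by
      rw [← map_mul, ← Nat.cast_mul, Nat.mul_div_cancel' hj']
    rw [MonoidHom.mul_apply, charHom_apply, charHom_apply, MulChar.inv_apply_eq_inv', h2]
    field_simp
  rw [Finset.sum_congr rfl h1, ← Finset.mul_sum, norm_mul, hcop dvd_rfl, one_mul,
    sum_divisors_moebius_mul (by omega), norm_prod]
  refine Finset.prod_congr rfl fun p hp => ?_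
  have hp1 := hcop (Nat.dvd_of_mem_primeFactors hp)
  have h3 : (1 - (charHom ξ * charHom χ⁻¹) p) =
      (starRingEnd ℂ) (1 - (charHom χ * charHom ξ⁻¹) p) := by
    rw [MonoidHom.mul_apply, MonoidHom.mul_apply, charHom_apply, charHom_apply, charHom_apply,
      charHom_apply, MulChar.inv_apply_eq_inv', dirichletCharacter_inv_apply_eq_conj hD, map_sub,
      map_one, map_mul, Complex.conj_conj, Complex.inv_def, Complex.normSq_eq_norm_sq, hp1]
    simp [mul_comm]
  rw [h3, RCLike.norm_conj]

theorem norm_main_sum_le {q D m : ℕ} [NeZero D] [NeZero (D * m)] (hm : 1 ≤ m)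
    {Y : ℕ} (hmY : m ≤ Y) (hmq : m.Coprime q) (χ : DirichletCharacter ℂ q)
    {ξ : DirichletCharacter ℂ D} (hξ : ξ.IsPrimitive) (N : ℕ) :
    ‖∑ n ∈ Finset.Icc 1 N, smoothHom Y (charHom χ) n *
        gaussSum (DirichletCharacter.changeLevel (dvd_mul_right D m) ξ)
          (ZMod.stdAddChar.mulShift (n : ZMod (D * m))) / n‖ ≤
      √D * ((∏ p ∈ m.primeFactors, ‖1 - (charHom χ * charHom ξ⁻¹) p‖) *
        ‖smoothLogSum Y χ ξ N‖ + (m : ℝ) ^ 2) := by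
  have hD : 1 ≤ D := Nat.pos_of_ne_zero (NeZero.ne D)
  rw [sum_smoothHom_mul_gaussSum_div hm Y χ hξ, norm_mul, norm_gaussSum_stdAddChar hξ]
  gcongr
  rw [← norm_sum_moebius_mul_eq hD hm hmq χ ξ, ← norm_mul]
  have h1 : ∑ j ∈ m.divisors,
        (ArithmeticFunction.moebius j : ℂ) * ξ (j : ZMod D) * smoothHom Y (charHom χ) (m / j) *
          smoothLogSum Y χ ξ (N / (m / j)) =
      (∑ j ∈ m.divisors, (ArithmeticFunction.moebius j : ℂ) * ξ (j : ZMod D) *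
        χ ((m / j : ℕ) : ZMod q)) * smoothLogSum Y χ ξ N +
      ∑ j ∈ m.divisors, (ArithmeticFunction.moebius j : ℂ) * ξ (j : ZMod D) *
        χ ((m / j : ℕ) : ZMod q) *
          (smoothLogSum Y χ ξ (N / (m / j)) - smoothLogSum Y χ ξ N) := by
    rw [Finset.sum_mul, ← Finset.sum_add_distrib]
    refine Finset.sum_congr rfl fun j hj => ?_
    have hj' := Nat.dvd_of_mem_divisors hj
    have hi : 1 ≤ m / j := Nat.div_pos (Nat.le_of_dvd hm hj') (Nat.pos_of_mem_divisors hj)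
    rw [smoothHom_apply_of_le _ (by omega) ((Nat.div_le_self m j).trans hmY), charHom_apply]
    ring
  rw [h1]
  refine (norm_add_le _ _).trans ?_
  gcongr
  calc _ ≤ m.divisors.card • (m : ℝ) := by
        refine (norm_sum_le _ _).trans (Finset.sum_le_card_nsmul _ _ _ fun j hj => ?_)
        have hj' := Nat.dvd_of_mem_divisors hj
        have hi : 1 ≤ m / j := Nat.div_pos (Nat.le_of_dvd hm hj') (Nat.pos_of_mem_divisors hj)
        rw [norm_mul, norm_mul, norm_mul]
        have k1 := norm_moebius_le_one j
        have k2 := DirichletCharacter.norm_le_one ξ (j : ZMod D)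
        have k3 := DirichletCharacter.norm_le_one χ ((m / j : ℕ) : ZMod q)
        have k4 := norm_smoothLogSum_div_sub_le Y χ ξ N hi
        have k5 : ((m / j : ℕ) : ℝ) ≤ m := by exact_mod_cast Nat.div_le_self m j
        calc _ ≤ 1 * 1 * 1 * (m : ℝ) := by
              gcongr
              exact k4.trans k5
          _ = m := by ring
    _ ≤ (m : ℝ) ^ 2 := by
        rw [nsmul_eq_mul, sq]
        gcongr
        exact Nat.card_divisors_le_self m

/-- `n ↦ 1/n` restricted to the integers coprime to `b`. -/
noncomputable def coprimeInvHom (b : ℕ) : ℕ →* ℝ where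
  toFun n := if n.Coprime b then ((n : ℝ))⁻¹ else 0
  map_one' := by simp
  map_mul' m n := by
    by_cases hm : m.Coprime b
    · by_cases hn : n.Coprime b
      · rw [if_pos (Nat.coprime_mul_iff_left.mpr ⟨hm, hn⟩), if_pos hm, if_pos hn]
        push_cast
        rw [mul_inv]
      · rw [if_neg fun h => hn (Nat.coprime_mul_iff_left.mp h).2, if_neg hn, mul_zero]
    · rw [if_neg fun h => hm (Nat.coprime_mul_iff_left.mp h).1, if_neg hm, zero_mul]

theorem coprimeInvHom_apply (b n : ℕ) :
    coprimeInvHom b n = if n.Coprime b then ((n : ℝ))⁻¹ else 0 := rfl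

theorem coprimeInvHom_nonneg (b n : ℕ) : 0 ≤ coprimeInvHom b n := by
  rw [coprimeInvHom_apply]
  split_ifs <;> positivity

theorem prod_primeFactors_one_sub_inv {b : ℕ} (hb : 1 ≤ b) :
    ∏ p ∈ b.primeFactors, (1 - 1 / (p : ℝ)) = b.totient / b := by
  have h := congr_arg (fun x : ℚ => (x : ℝ)) (Nat.totient_eq_mul_prod_factors b)
  push_cast at h
  have hb0 : (b : ℝ) ≠ 0 := by positivity
  rw [h]
  simp only [one_div]
  field_simp

theorem prod_one_sub_coprimeInvHom_inv {b Y : ℕ} (hb : 1 ≤ b) (hbY : b ≤ Y) :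
    ∏ p ∈ primesUpTo Y, (1 - coprimeInvHom b p)⁻¹ = mertensProduct Y * (b.totient / b) := by
  have h1 : ∀ p ∈ primesUpTo Y, (1 - coprimeInvHom b p)⁻¹ =
      (1 - 1 / (p : ℝ))⁻¹ * if p ∣ b then 1 - 1 / (p : ℝ) else 1 := fun p hp => by
    have hp' : p.Prime := (Finset.mem_filter.mp hp).2
    have hp1 : (1 : ℝ) < p := by exact_mod_cast hp'.one_lt
    have hne : 1 - 1 / (p : ℝ) ≠ 0 := by
      have : 1 / (p : ℝ) < 1 := (div_lt_one (by linarith)).mpr hp1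
      linarith
    rw [coprimeInvHom_apply]
    by_cases hpb : p ∣ b
    · rw [if_pos hpb, if_neg, inv_mul_cancel₀ hne]
      · simp
      · intro h
        exact ((hp'.coprime_iff_not_dvd).mp h) hpb
    · rw [if_neg hpb, if_pos ((hp'.coprime_iff_not_dvd).mpr hpb), mul_one, one_div]
  rw [Finset.prod_congr rfl h1, Finset.prod_mul_distrib, ← Finset.prod_filter,
    ← prod_primeFactors_one_sub_inv hb]
  congr 1
  refine Finset.prod_congr ?_ fun _ _ => rfl
  ext p
  simp only [Finset.mem_filter, Finset.mem_Icc, Nat.mem_primeFactors]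
  constructor
  · rintro ⟨⟨_, hp⟩, hd⟩
    exact ⟨hp, hd, by omega⟩
  · rintro ⟨hp, hd, _⟩
    exact ⟨⟨⟨hp.one_lt.le, (Nat.le_of_dvd hb hd).trans hbY⟩, hp⟩, hd⟩

theorem sum_smooth_coprimeInvHom_le {b Y : ℕ} (hb : 1 ≤ b) (hbY : b ≤ Y) (N : ℕ) :
    ∑ n ∈ Finset.Icc 1 N,
        (if ∀ p : ℕ, p.Prime → p ∣ n → p ≤ Y then coprimeInvHom b n else 0) ≤
      mertensProduct Y * (b.totient / b) := by
  have hlt : ∀ {p : ℕ}, p.Prime → ‖coprimeInvHom b p‖ < 1 := fun {p} hp => by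
    rw [Real.norm_of_nonneg (coprimeInvHom_nonneg b p), coprimeInvHom_apply]
    split_ifs
    · exact inv_lt_one_of_one_lt₀ (by exact_mod_cast hp.one_lt)
    · exact one_pos
  have h := (EulerProduct.summable_and_hasSum_smoothNumbers_prod_primesBelow_geometric
    (f := coprimeInvHom b) hlt (Y + 1)).2
  rw [primesBelow_succ_eq_primesUpTo, prod_one_sub_coprimeInvHom_inv hb hbY] at h
  have h2 := (hasSum_subtype_iff_indicator (f := fun n => coprimeInvHom b n)
    (s := (Y + 1).smoothNumbers)).1 h
  refine le_trans (Finset.sum_le_sum fun n hn => ?_) (sum_le_hasSum (Finset.Icc 1 N)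
    (fun n _ => Set.indicator_nonneg (fun n _ => coprimeInvHom_nonneg b n) n) h2)
  split_ifs with hs
  · rw [Set.indicator_of_mem]
    rw [Nat.mem_smoothNumbers]
    refine ⟨by have := (Finset.mem_Icc.mp hn).1; omega, fun p hp => ?_⟩
    have := hs p (Nat.prime_of_mem_primeFactorsList hp) (Nat.dvd_of_mem_primeFactorsList hp)
    omega
  · exact Set.indicator_nonneg (fun n _ => coprimeInvHom_nonneg b n) n

/-- `p ↦ g p / p` as a completely multiplicative function. -/
noncomputable def divHom (g : ℕ →* ℂ) : ℕ →* ℂ where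
  toFun n := g n / n
  map_one' := by simp
  map_mul' m n := by
    push_cast
    rw [map_mul, mul_div_mul_comm]

theorem divHom_apply (g : ℕ →* ℂ) (n : ℕ) : divHom g n = g n / n := rfl

theorem norm_smoothLogSum_mul_prod_le {q D m Y : ℕ} (hD : 1 ≤ D) (hm : 1 ≤ m) (hbY : D * m ≤ Y)
    (χ : DirichletCharacter ℂ q) (ξ : DirichletCharacter ℂ D) (N : ℕ) :
    ‖smoothLogSum Y χ ξ N‖ * ∏ p ∈ m.primeFactors, ‖1 - (charHom χ * charHom ξ⁻¹) p / p‖ ≤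
      mertensProduct Y * ((D * m).totient / (D * m : ℕ)) + m := by
  set g := charHom χ * charHom ξ⁻¹ with hg
  have hmY : m ≤ Y := (Nat.le_mul_of_pos_left m hD).trans hbY
  have hT : ∑ n ∈ Finset.Icc 1 N, (if n.Coprime m then (1 : ℂ) else 0) * (smoothHom Y g n / n) =
      smoothLogSum Y χ ξ N * ∏ p ∈ m.primeFactors, (1 - g p / p) +
        ∑ j ∈ m.divisors, (ArithmeticFunction.moebius j : ℂ) * (g j / j) *
          (smoothLogSum Y χ ξ (N / j) - smoothLogSum Y χ ξ N) := by
    have h1 := sum_divisors_moebius_mul (m := m) (by omega) (divHom g)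
    simp only [divHom_apply] at h1
    rw [← h1, Finset.mul_sum, ← Finset.sum_add_distrib]
    simp only [coprime_eq_sum_moebius hm, Finset.sum_mul]
    rw [Finset.sum_comm]
    refine Finset.sum_congr rfl fun j hj => ?_
    have hj' := Nat.dvd_of_mem_divisors hj
    have hj1 : 1 ≤ j := Nat.pos_of_mem_divisors hj
    have h2 : ∀ n ∈ Finset.Icc 1 N, (if j ∣ n then (ArithmeticFunction.moebius j : ℂ) else 0) *
        (smoothHom Y g n / n) = if j ∣ n then (ArithmeticFunction.moebius j : ℂ) *
          (smoothHom Y g n / n) else 0 := fun n _ => by split_ifs <;> simp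
    rw [Finset.sum_congr rfl h2, sum_Icc_dvd _ hj1]
    have h3 : ∑ l ∈ Finset.Icc 1 (N / j), (ArithmeticFunction.moebius j : ℂ) *
        (smoothHom Y g (j * l) / (j * l : ℕ)) =
        (ArithmeticFunction.moebius j : ℂ) * (g j / j) * smoothLogSum Y χ ξ (N / j) := by
      rw [smoothLogSum, Finset.mul_sum]
      refine Finset.sum_congr rfl fun l _ => ?_
      rw [map_mul, smoothHom_apply_of_le g (by omega) ((Nat.le_of_dvd hm hj').trans hmY),
        Nat.cast_mul, mul_div_mul_comm]
      ring
    rw [h3]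
    ring
  have hE : ‖∑ j ∈ m.divisors, (ArithmeticFunction.moebius j : ℂ) * (g j / j) *
      (smoothLogSum Y χ ξ (N / j) - smoothLogSum Y χ ξ N)‖ ≤ m := by
    have h4 : ∀ j ∈ m.divisors, ‖(ArithmeticFunction.moebius j : ℂ) * (g j / j) *
      (smoothLogSum Y χ ξ (N / j) - smoothLogSum Y χ ξ N)‖ ≤ 1 := fun j hj => by
      have hj1 : 1 ≤ j := Nat.pos_of_mem_divisors hj
      have hj0 : (0 : ℝ) < j := by exact_mod_cast hj1
      rw [norm_mul, norm_mul, norm_div, Complex.norm_natCast]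
      have k1 := norm_moebius_le_one j
      have k2 := norm_charHom_mul_le_one χ ξ⁻¹ j
      have k3 := norm_smoothLogSum_div_sub_le Y χ ξ N hj1
      calc _ ≤ 1 * (1 / (j : ℝ)) * j := by gcongr
        _ = 1 := by field_simp
    refine (norm_sum_le _ _).trans ((Finset.sum_le_card_nsmul _ _ _ h4).trans ?_)
    rw [nsmul_eq_mul, mul_one]
    exact_mod_cast Nat.card_divisors_le_self m
  have hTle : ‖∑ n ∈ Finset.Icc 1 N, (if n.Coprime m then (1 : ℂ) else 0) *
      (smoothHom Y g n / n)‖ ≤ mertensProduct Y * ((D * m).totient / (D * m : ℕ)) := by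
    refine (norm_sum_le _ _).trans (le_trans (Finset.sum_le_sum fun n hn => ?_)
      (sum_smooth_coprimeInvHom_le (Nat.mul_pos hD hm) hbY N))
    have hn1 := (Finset.mem_Icc.mp hn).1
    by_cases hs : ∀ p : ℕ, p.Prime → p ∣ n → p ≤ Y
    · rw [if_pos hs, coprimeInvHom_apply]
      by_cases hnm : n.Coprime m
      · rw [if_pos hnm, one_mul, norm_div, Complex.norm_natCast]
        by_cases hnD : n.Coprime D
        · rw [if_pos (Nat.coprime_mul_iff_right.mpr ⟨hnD, hnm⟩), ← one_div]
          gcongr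
          exact norm_smoothHom_le_one (norm_charHom_mul_le_one χ ξ⁻¹) n
        · rw [if_neg fun h => hnD (Nat.coprime_mul_iff_right.mp h).1, hg, smoothHom_mul,
            charHom_apply ξ⁻¹, dirichletCharacter_natCast_eq_zero _ hnD]
          simp
      · rw [if_neg hnm, zero_mul, norm_zero]
        split_ifs <;> positivity
    · have h0 : smoothHom Y g n = 0 := by rw [smoothHom_apply, if_neg fun h => hs h.2]
      rw [if_neg hs, h0]
      simp
  rw [← norm_prod, ← norm_mul]
  have h5 := eq_sub_of_add_eq hT.symm
  rw [h5]
  exact (norm_sub_le _ _).trans (add_le_add hTle hE)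

theorem norm_one_sub_le_mul {p : ℝ} (hp : 2 ≤ p) {w : ℂ} (hw : ‖w‖ = 1 ∨ w = 0) :
    ‖1 - w‖ ≤ 2 * p / (p + 1) * ‖1 - w / p‖ := by
  have hp0 : 0 < p := by linarith
  rcases hw with hw | rfl
  · have h1 : ‖1 - w / p‖ = ‖(p : ℂ) - w‖ / p := by
      have : (1 - w / p) = ((p : ℂ) - w) / p := by
        have : (p : ℂ) ≠ 0 := by exact_mod_cast hp0.ne'
        field_simp
      rw [this, norm_div, Complex.norm_real, Real.norm_of_nonneg hp0.le]
    have h2 : 2 * p / (p + 1) * (‖(p : ℂ) - w‖ / p) = 2 * ‖(p : ℂ) - w‖ / (p + 1) := by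
      field_simp
    rw [h1, h2, le_div_iff₀ (by linarith)]
    refine le_of_sq_le_sq ?_ (by positivity)
    have hw2 : w.re * w.re + w.im * w.im = 1 := by
      rw [← Complex.normSq_apply, Complex.normSq_eq_norm_sq, hw, one_pow]
    have h3 : ‖1 - w‖ ^ 2 = 2 - 2 * w.re := by
      rw [← Complex.normSq_eq_norm_sq, Complex.normSq_apply]
      simp only [Complex.sub_re, Complex.one_re, Complex.sub_im, Complex.one_im]
      nlinarith
    have h4 : ‖(p : ℂ) - w‖ ^ 2 = p ^ 2 + 1 - 2 * p * w.re := by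
      rw [← Complex.normSq_eq_norm_sq, Complex.normSq_apply]
      simp only [Complex.sub_re, Complex.ofReal_re, Complex.sub_im, Complex.ofReal_im]
      nlinarith
    rw [mul_pow, mul_pow, h3, h4]
    have h5 : -1 ≤ w.re := by
      have := (abs_le.mp (Complex.abs_re_le_norm w)).1
      rwa [hw] at this
    nlinarith [mul_nonneg (sq_nonneg (p - 1)) (by linarith : (0 : ℝ) ≤ 1 + w.re)]
  · simp only [sub_zero, norm_one, zero_div, mul_one]
    rw [le_div_iff₀ (by linarith)]
    linarith

theorem prod_norm_one_sub_mul_norm_smoothLogSum_le {q D m Y : ℕ} (hD : 1 ≤ D) (hm : 1 ≤ m)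
    (hbY : D * m ≤ Y) (hmq : m.Coprime q) (χ : DirichletCharacter ℂ q)
    (ξ : DirichletCharacter ℂ D) (N : ℕ) :
    (∏ p ∈ m.primeFactors, ‖1 - (charHom χ * charHom ξ⁻¹) p‖) * ‖smoothLogSum Y χ ξ N‖ ≤
      (∏ p ∈ m.primeFactors, 2 * (p : ℝ) / (p + 1)) *
        (mertensProduct Y * ((D * m).totient / (D * m : ℕ)) + m) := by
  have h1 : ∏ p ∈ m.primeFactors, ‖1 - (charHom χ * charHom ξ⁻¹) p‖ ≤
      (∏ p ∈ m.primeFactors, 2 * (p : ℝ) / (p + 1)) *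
        ∏ p ∈ m.primeFactors, ‖1 - (charHom χ * charHom ξ⁻¹) p / p‖ := by
    rw [← Finset.prod_mul_distrib]
    refine Finset.prod_le_prod (fun _ _ => norm_nonneg _) fun p hp => ?_
    have hpp := Nat.prime_of_mem_primeFactors hp
    have hpm := Nat.dvd_of_mem_primeFactors hp
    have hw : ‖(charHom χ * charHom ξ⁻¹) p‖ = 1 ∨ (charHom χ * charHom ξ⁻¹) p = 0 := by
      rw [MonoidHom.mul_apply, charHom_apply, charHom_apply]
      by_cases hpD : p.Coprime D
      · left
        rw [norm_mul, norm_dirichletCharacter_natCast_eq_one _ (hmq.coprime_dvd_left hpm),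
          norm_dirichletCharacter_natCast_eq_one _ hpD, one_mul]
      · right
        rw [dirichletCharacter_natCast_eq_zero _ hpD, mul_zero]
    have := norm_one_sub_le_mul (p := (p : ℝ)) (by exact_mod_cast hpp.two_le) hw
    simpa using this
  calc _ ≤ ((∏ p ∈ m.primeFactors, 2 * (p : ℝ) / (p + 1)) *
        ∏ p ∈ m.primeFactors, ‖1 - (charHom χ * charHom ξ⁻¹) p / p‖) *
          ‖smoothLogSum Y χ ξ N‖ := by gcongr
    _ = (∏ p ∈ m.primeFactors, 2 * (p : ℝ) / (p + 1)) * (‖smoothLogSum Y χ ξ N‖ *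
        ∏ p ∈ m.primeFactors, ‖1 - (charHom χ * charHom ξ⁻¹) p / p‖) := by ring
    _ ≤ _ := by
      gcongr
      exact norm_smoothLogSum_mul_prod_le hD hm hbY χ ξ N

theorem prod_primeFactors_two_mul_div_le {m : ℕ} (hm : 1 ≤ m) :
    ∏ p ∈ m.primeFactors, 2 * (p : ℝ) / (p + 1) ≤ m * ((2 : ℝ) / 3) ^ m.primeFactors.card := by
  have h1 : (∏ p ∈ m.primeFactors, (p : ℝ)) ≤ m := by
    rw [← Nat.cast_prod]
    exact_mod_cast Nat.le_of_dvd hm (Nat.prod_primeFactors_dvd m)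
  calc _ ≤ ∏ p ∈ m.primeFactors, (p : ℝ) * (2 / 3) := by
        refine Finset.prod_le_prod (fun _ _ => by positivity) fun p hp => ?_
        have : (2 : ℝ) ≤ p := by exact_mod_cast (Nat.prime_of_mem_primeFactors hp).two_le
        rw [div_le_iff₀ (by linarith)]
        nlinarith
    _ = (∏ p ∈ m.primeFactors, (p : ℝ)) * (2 / 3) ^ m.primeFactors.card := by
        rw [Finset.prod_mul_distrib, Finset.prod_const]
    _ ≤ _ := by gcongr

theorem mertensProduct_nonneg (N : ℕ) : 0 ≤ mertensProduct N := by
  refine Finset.prod_nonneg fun p _ => inv_nonneg.mpr (sub_nonneg.mpr ?_)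
  rw [one_div]
  exact Nat.cast_inv_le_one p

theorem main_term_le_mertensProduct {q D m Y : ℕ} (hD : 1 ≤ D) (hm : 1 ≤ m)
    (hbY : D * m ≤ Y) (hmq : m.Coprime q) (χ : DirichletCharacter ℂ q)
    (ξ : DirichletCharacter ℂ D) (N : ℕ) :
    2 / ((D * m).totient : ℝ) * (√D * ((∏ p ∈ m.primeFactors,
      ‖1 - (charHom χ * charHom ξ⁻¹) p‖) * ‖smoothLogSum Y χ ξ N‖ + (m : ℝ) ^ 2)) ≤
      2 / √D * ((2 : ℝ) / 3) ^ m.primeFactors.card * mertensProduct Y +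
        4 * ((D * m : ℕ) : ℝ) ^ 2 := by
  have hb : 0 < D * m := Nat.mul_pos hD hm
  have hφ : (1 : ℝ) ≤ (D * m).totient := by exact_mod_cast Nat.totient_pos.mpr hb
  set φ : ℝ := ((D * m).totient : ℝ)
  set P := ∏ p ∈ m.primeFactors, 2 * (p : ℝ) / (p + 1)
  set w := ((2 : ℝ) / 3) ^ m.primeFactors.card
  have hM := mertensProduct_nonneg Y
  set M := mertensProduct Y
  have hw0 : 0 ≤ w := by positivity
  have hw1 : w ≤ 1 := pow_le_one₀ (by norm_num) (by norm_num)
  have hP : P ≤ m * w := prod_primeFactors_two_mul_div_le hm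
  have hm' : (1 : ℝ) ≤ m := by exact_mod_cast hm
  have hD' : (1 : ℝ) ≤ D := by exact_mod_cast hD
  have hPm : P ≤ m := hP.trans (by nlinarith)
  have hs0 : 0 < √(D : ℝ) := Real.sqrt_pos.mpr (by linarith)
  have hss : √(D : ℝ) * √D = D := Real.mul_self_sqrt (by linarith)
  have hsD : √(D : ℝ) ≤ D := by
    rw [Real.sqrt_le_left (by linarith)]
    nlinarith
  have h1 := prod_norm_one_sub_mul_norm_smoothLogSum_le hD hm hbY hmq χ ξ N
  have hP0 : 0 ≤ P := Finset.prod_nonneg fun _ _ => by positivity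
  calc _ ≤ 2 / φ * (√D * (P * (M * (φ / (D * m : ℕ)) + m) + (m : ℝ) ^ 2)) := by gcongr
    _ = 2 * √D / (D * m) * P * M + 2 / φ * (√D * (P * m + (m : ℝ) ^ 2)) := by
      push_cast
      field_simp
      ring
    _ ≤ 2 * √D / (D * m) * (m * w) * M + 2 / 1 * (D * (m * m + (m : ℝ) ^ 2)) := by gcongr
    _ = 2 / √D * w * M + 4 * (D * (m : ℝ) ^ 2) := by
      congr 1
      · rw [show 2 / √(D : ℝ) = 2 * √D / D by
          rw [div_eq_div_iff hs0.ne' (by linarith), mul_assoc, hss]]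
        field_simp
      · ring
    _ ≤ _ := by
      push_cast
      rw [mul_pow]
      gcongr
      nlinarith

theorem le_two_mul_totient_sq_and (n : ℕ) (hn : 0 < n) :
    (n ≤ 2 * n.totient ^ 2 ∧ (Odd n → n ≤ n.totient ^ 2)) ∧
      (2 ^ n.primeFactors.card ≤ 2 * n.totient ∧
        (Odd n → 2 ^ n.primeFactors.card ≤ n.totient)) := by
  induction n using Nat.recOnPosPrimePosCoprime with
  | zero => omega
  | one => simp
  | prime_pow p k hp hk =>
    rw [Nat.primeFactors_prime_pow hk.ne' hp, Finset.card_singleton,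
      Nat.totient_prime_pow hp hk]
    obtain ⟨j, rfl⟩ : ∃ j, k = j + 1 := ⟨k - 1, by omega⟩
    obtain ⟨r, rfl⟩ : ∃ r, p = r + 1 := ⟨p - 1, by have := hp.two_le; omega⟩
    simp only [Nat.add_sub_cancel]
    have hX : 1 ≤ (r + 1) ^ j := Nat.one_le_pow _ _ (by omega)
    have hr : 1 ≤ r := by have := hp.two_le; omega
    have hodd : Odd ((r + 1) ^ (j + 1)) → 2 ≤ r := by
      intro h
      by_contra hc
      have : r = 1 := by omega
      subst this
      rw [Nat.odd_pow_iff (by omega)] at h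
      exact absurd h (by decide)
    rw [pow_succ]
    rw [pow_succ] at hodd
    generalize (r + 1) ^ j = X at *
    refine ⟨⟨?_, fun h => ?_⟩, ?_, fun h => ?_⟩
    · have : r + 1 ≤ 2 * r ^ 2 := by nlinarith
      calc X * (r + 1) ≤ (X * X) * (2 * r ^ 2) := by gcongr; nlinarith
        _ = _ := by ring
    · have h2 := hodd h
      have : r + 1 ≤ r ^ 2 := by nlinarith
      calc X * (r + 1) ≤ (X * X) * (r ^ 2) := by gcongr; nlinarith
        _ = _ := by ring
    · nlinarith
    · have h2 := hodd h
      nlinarith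
  | coprime a b ha hb hab iha ihb =>
    have ha' := iha (by omega)
    have hb' := ihb (by omega)
    rw [Nat.totient_mul hab, hab.primeFactors_mul,
      Finset.card_union_of_disjoint hab.disjoint_primeFactors, pow_add, mul_pow]
    have hor : Odd a ∨ Odd b := by
      by_contra hc
      rw [not_or, Nat.not_odd_iff_even, Nat.not_odd_iff_even] at hc
      have := Nat.dvd_gcd hc.1.two_dvd hc.2.two_dvd
      rw [hab.gcd_eq_one] at this
      omega
    refine ⟨⟨?_, fun h => ?_⟩, ?_, fun h => ?_⟩
    · rcases hor with h | h
      · calc a * b ≤ a.totient ^ 2 * (2 * b.totient ^ 2) := Nat.mul_le_mul (ha'.1.2 h) hb'.1.1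
          _ = _ := by ring
      · calc a * b ≤ (2 * a.totient ^ 2) * b.totient ^ 2 := Nat.mul_le_mul ha'.1.1 (hb'.1.2 h)
          _ = _ := by ring
    · rw [Nat.odd_mul] at h
      exact Nat.mul_le_mul (ha'.1.2 h.1) (hb'.1.2 h.2)
    · rcases hor with h | h
      · calc _ ≤ a.totient * (2 * b.totient) := Nat.mul_le_mul (ha'.2.2 h) hb'.2.1
          _ = _ := by ring
      · calc _ ≤ (2 * a.totient) * b.totient := Nat.mul_le_mul ha'.2.1 (hb'.2.2 h)
          _ = _ := by ring
    · rw [Nat.odd_mul] at h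
      exact Nat.mul_le_mul (ha'.2.2 h.1) (hb'.2.2 h.2)

theorem sqrt_mul_two_pow_card_primeFactors_le {D m : ℕ} (hD : 1 ≤ D) (hm : 1 ≤ m) :
    √(D : ℝ) * 2 ^ m.primeFactors.card ≤ 4 * (D * m).totient := by
  have h1 : √(D : ℝ) ≤ 2 * D.totient := by
    rw [Real.sqrt_le_left (by positivity)]
    have : (D : ℝ) ≤ 2 * (D.totient : ℝ) ^ 2 := by
      exact_mod_cast (le_two_mul_totient_sq_and D hD).1.1
    nlinarith [sq_nonneg (D.totient : ℝ)]
  have h2 : (2 : ℝ) ^ m.primeFactors.card ≤ 2 * m.totient := by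
    exact_mod_cast (le_two_mul_totient_sq_and m hm).2.1
  have h3 : (D.totient : ℝ) * m.totient ≤ (D * m).totient := by
    exact_mod_cast Nat.totient_super_multiplicative D m
  calc _ ≤ (2 * (D.totient : ℝ)) * (2 * m.totient) := by gcongr
    _ = 4 * ((D.totient : ℝ) * m.totient) := by ring
    _ ≤ _ := by gcongr

theorem main_term_le_of_norm_smoothLogSum_le {q D m Y : ℕ} (hD : 1 ≤ D) (hm : 1 ≤ m)
    (χ : DirichletCharacter ℂ q) (ξ : DirichletCharacter ℂ D) (N : ℕ) {B : ℝ}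
    (hB : ‖smoothLogSum Y χ ξ N‖ ≤ B) :
    2 / ((D * m).totient : ℝ) * (√D * ((∏ p ∈ m.primeFactors,
      ‖1 - (charHom χ * charHom ξ⁻¹) p‖) * ‖smoothLogSum Y χ ξ N‖ + (m : ℝ) ^ 2)) ≤
      8 * B + 2 * ((D * m : ℕ) : ℝ) ^ 2 := by
  have hb : 0 < D * m := Nat.mul_pos hD hm
  have hφ : (1 : ℝ) ≤ (D * m).totient := by exact_mod_cast Nat.totient_pos.mpr hb
  have h4 := sqrt_mul_two_pow_card_primeFactors_le hD hm
  set φ : ℝ := ((D * m).totient : ℝ)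
  have hD' : (1 : ℝ) ≤ D := by exact_mod_cast hD
  have hB0 : 0 ≤ B := (norm_nonneg _).trans hB
  have hsD : √(D : ℝ) ≤ D := by
    rw [Real.sqrt_le_left (by linarith)]
    nlinarith
  have hP : ∏ p ∈ m.primeFactors, ‖1 - (charHom χ * charHom ξ⁻¹) p‖ ≤
      2 ^ m.primeFactors.card := by
    rw [← Finset.prod_const]
    refine Finset.prod_le_prod (fun _ _ => norm_nonneg _) fun p _ => ?_
    have := norm_charHom_mul_le_one χ ξ⁻¹ p
    refine (norm_sub_le _ _).trans ?_
    rw [norm_one]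
    linarith
  calc _ ≤ 2 / φ * (√D * (2 ^ m.primeFactors.card * B + (m : ℝ) ^ 2)) := by gcongr
    _ = 2 / φ * (√D * 2 ^ m.primeFactors.card * B) + 2 / φ * (√D * (m : ℝ) ^ 2) := by ring
    _ ≤ 2 / φ * (4 * φ * B) + 2 / 1 * (D * (m : ℝ) ^ 2) := by gcongr
    _ = 8 * B + 2 * (D * (m : ℝ) ^ 2) := by field_simp; ring
    _ ≤ _ := by
      push_cast
      rw [mul_pow]
      gcongr
      nlinarith

theorem sum_Icc_neg_eq_sum_Icc_one (f : ℤ → ℂ) (h0 : f 0 = 0) (N : ℕ) :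
    ∑ n ∈ Finset.Icc (-(N : ℤ)) N, f n = ∑ n ∈ Finset.Icc 1 N, (f n + f (-(n : ℤ))) := by
  induction N with
  | zero => simp [h0]
  | succ N ih =>
    rw [Finset.sum_Icc_succ_top (by omega), ← ih]
    have h : Finset.Icc (-((N + 1 : ℕ) : ℤ)) ((N + 1 : ℕ) : ℤ) =
        insert ((N + 1 : ℕ) : ℤ) (insert (-((N + 1 : ℕ) : ℤ)) (Finset.Icc (-(N : ℤ)) N)) := by
      ext k
      simp only [Finset.mem_insert, Finset.mem_Icc]
      omega
    rw [h, Finset.sum_insert, Finset.sum_insert]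
    · ring
    · simp only [Finset.mem_Icc]
      omega
    · simp only [Finset.mem_insert, Finset.mem_Icc]
      omega

theorem sum_dirichletCharacter_mul_gaussSum {b : ℕ} [NeZero b] (u : (ZMod b)ˣ) (x : ZMod b) :
    ∑ ψ : DirichletCharacter ℂ b, ψ (u⁻¹ : (ZMod b)ˣ) *
      gaussSum ψ (ZMod.stdAddChar.mulShift x) = b.totient * ZMod.stdAddChar (x * (u : ZMod b)) := by
  simp only [gaussSum, Finset.mul_sum, ← mul_assoc]
  rw [Finset.sum_comm]
  simp only [← Finset.sum_mul]
  have h := fun v : ZMod b => DirichletCharacter.sum_char_inv_mul_char_eq ℂ u.isUnit v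
  simp only [ZMod.inv_coe_unit] at h
  simp only [h, ite_mul, zero_mul, AddChar.mulShift_apply]
  rw [Finset.sum_ite_eq]
  simp

/-- The two-sided sum over smooth integers, folded to positive integers. -/
theorem sum_filter_smooth_eq {q b : ℕ} [NeZero b] (χ : DirichletCharacter ℂ q) {a : ℤ}
    {u : (ZMod b)ˣ} (hu : (u : ZMod b) = a) {y : ℝ} (hy : 0 ≤ y) (N : ℕ) :
    ∑ n ∈ (Finset.Icc (-(N : ℤ)) (N : ℤ)).filter
        (fun n => n ≠ 0 ∧ ∀ p : ℕ, p.Prime → (p : ℤ) ∣ n → (p : ℝ) ≤ y),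
        χ (n : ZMod q) * e2pi ((a : ℝ) * n / b) / n =
      ∑ n ∈ Finset.Icc 1 N, smoothHom ⌊y⌋₊ (charHom χ) n / n *
        (ZMod.stdAddChar ((n : ZMod b) * (u : ZMod b)) -
          χ (-1) * ZMod.stdAddChar ((n : ZMod b) * ((-u : (ZMod b)ˣ) : ZMod b))) := by
  rw [Finset.sum_filter, sum_Icc_neg_eq_sum_Icc_one _ (by simp)]
  refine Finset.sum_congr rfl fun n hn => ?_
  have hn1 := (Finset.mem_Icc.mp hn).1
  have hn0 : n ≠ 0 := by omega
  have he : ∀ k : ℤ, e2pi ((a : ℝ) * k / b) =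
      ZMod.stdAddChar ((k : ZMod b) * (u : ZMod b)) := fun k => by
    rw [hu, ← Int.cast_mul, mul_comm a k, ← stdAddChar_intCast_eq_e2pi]
    push_cast
    rfl
  have hiff : (∀ p : ℕ, p.Prime → (p : ℤ) ∣ (n : ℤ) → (p : ℝ) ≤ y) ↔
      ∀ p : ℕ, p.Prime → p ∣ n → p ≤ ⌊y⌋₊ := by
    simp only [Int.natCast_dvd_natCast, Nat.le_floor_iff hy]
  simp only [he, Int.dvd_neg, hiff, smoothHom_apply]
  by_cases hs : ∀ p : ℕ, p.Prime → p ∣ n → p ≤ ⌊y⌋₊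
  · have hχ : χ ((-(n : ℤ) : ℤ) : ZMod q) = χ (-1) * χ (n : ZMod q) := by
      rw [← map_mul]
      push_cast
      ring_nf
    rw [if_pos ⟨by simpa using hn0, hs⟩, if_pos ⟨by simpa using hn0, hs⟩, if_pos ⟨hn0, hs⟩, hχ,
      charHom_apply]
    push_cast
    rw [neg_mul, mul_neg, div_neg]
    ring
  · rw [if_neg fun h => hs h.2, if_neg fun h => hs h.2, if_neg fun h => hs h.2]
    simp

theorem norm_sum_filter_smooth_le {q b : ℕ} [NeZero b] (χ : DirichletCharacter ℂ q) {a : ℤ}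
    (hab : Int.gcd a b = 1) {y : ℝ} (hy : 0 ≤ y) (N : ℕ) :
    ‖∑ n ∈ (Finset.Icc (-(N : ℤ)) (N : ℤ)).filter
        (fun n => n ≠ 0 ∧ ∀ p : ℕ, p.Prime → (p : ℤ) ∣ n → (p : ℝ) ≤ y),
        χ (n : ZMod q) * e2pi ((a : ℝ) * n / b) / n‖ ≤
      1 / (b.totient : ℝ) * ∑ ψ : DirichletCharacter ℂ b, ‖1 - χ (-1) * ψ (-1)‖ *
        ‖∑ n ∈ Finset.Icc 1 N, smoothHom ⌊y⌋₊ (charHom χ) n *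
          gaussSum ψ (ZMod.stdAddChar.mulShift (n : ZMod b)) / n‖ := by
  obtain ⟨u, hu⟩ : IsUnit (a : ZMod b) :=
    (ZMod.coe_int_isUnit_iff_isCoprime a b).mpr (Int.isCoprime_iff_gcd_eq_one.mpr hab).symm
  have hφ : (0 : ℝ) < b.totient := by
    exact_mod_cast Nat.totient_pos.mpr (Nat.pos_of_ne_zero (NeZero.ne b))
  have hφ' : (b.totient : ℂ) ≠ 0 := by exact_mod_cast hφ.ne'
  have hψ : ∀ ψ : DirichletCharacter ℂ b, ψ (((-u)⁻¹ : (ZMod b)ˣ) : ZMod b) =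
      ψ (-1) * ψ ((u⁻¹ : (ZMod b)ˣ) : ZMod b) := fun ψ => by
    rw [← map_mul, inv_neg]
    simp
  rw [sum_filter_smooth_eq χ hu hy N]
  have key : ∑ n ∈ Finset.Icc 1 N, smoothHom ⌊y⌋₊ (charHom χ) n / n *
        (ZMod.stdAddChar ((n : ZMod b) * (u : ZMod b)) -
          χ (-1) * ZMod.stdAddChar ((n : ZMod b) * ((-u : (ZMod b)ˣ) : ZMod b))) =
      1 / (b.totient : ℂ) * ∑ ψ : DirichletCharacter ℂ b,
        ψ ((u⁻¹ : (ZMod b)ˣ) : ZMod b) * ((1 - χ (-1) * ψ (-1)) *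
        ∑ n ∈ Finset.Icc 1 N, smoothHom ⌊y⌋₊ (charHom χ) n *
          gaussSum ψ (ZMod.stdAddChar.mulShift (n : ZMod b)) / n) := by
    simp only [Finset.mul_sum]
    rw [Finset.sum_comm]
    refine Finset.sum_congr rfl fun n _ => ?_
    have h1 := sum_dirichletCharacter_mul_gaussSum u (n : ZMod b)
    have h2 := sum_dirichletCharacter_mul_gaussSum (-u) (n : ZMod b)
    rw [mul_comm, ← div_eq_iff hφ'] at h1 h2
    rw [← h1, ← h2, Finset.sum_div, Finset.sum_div, Finset.mul_sum, ← Finset.sum_sub_distrib,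
      Finset.mul_sum]
    refine Finset.sum_congr rfl fun ψ _ => ?_
    rw [hψ]
    ring
  rw [key, norm_mul, norm_div, norm_one, Complex.norm_natCast]
  gcongr
  refine (norm_sum_le _ _).trans (Finset.sum_le_sum fun ψ _ => ?_)
  rw [norm_mul, norm_mul]
  exact mul_le_of_le_one_left (by positivity) (DirichletCharacter.norm_le_one ψ _)

theorem exists_norm_nonmain_le : ∃ K y₁ : ℝ, 0 < K ∧ 3 ≤ y₁ ∧ ∀ y : ℝ, y₁ ≤ y →
    ∀ (q : ℕ) (χ : DirichletCharacter ℂ q) (D : ℕ) (ξ : DirichletCharacter ℂ D),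
      ξ.IsPrimitive → (D : ℝ) ≤ Real.log y →
      (∀ (d : ℕ) (ψ : DirichletCharacter ℂ d), ψ.IsPrimitive →
        (d : ℝ) ≤ Real.log y → Ddist χ ξ y ≤ Ddist χ ψ y) →
      ∀ (b : ℕ) [NeZero b], (b : ℝ) ≤ Real.log y → ∀ ψ : DirichletCharacter ℂ b,
        (∀ h : D ∣ b, ψ ≠ DirichletCharacter.changeLevel h ξ) → ∀ N : ℕ,
          ‖∑ n ∈ Finset.Icc 1 N, smoothHom ⌊y⌋₊ (charHom χ) n *
            gaussSum ψ (ZMod.stdAddChar.mulShift (n : ZMod b)) / n‖ ≤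
            2 * √b * (K * Real.log y ^ (0.8545 : ℝ)) := by
  obtain ⟨K₁, hK₁, h₁⟩ := exists_norm_sum_smooth_le
  obtain ⟨K₂, y₁, hK₂, hy₁, h₂⟩ := exists_log_mul_exp_Ddist_le
  refine ⟨1 + K₁ * K₂, y₁, by positivity, hy₁, ?_⟩
  intro y hy q χ D ξ hξ hDy hmin b _ hb ψ hψ N
  have hL : 1 ≤ Real.log y := by
    rw [Real.le_log_iff_exp_le (by linarith)]
    linarith [Real.exp_one_lt_three]
  have hb0 := NeZero.ne b
  obtain ⟨d, ψ', hprim, hdb, rfl⟩ : ∃ (d : ℕ) (ψ' : DirichletCharacter ℂ d),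
      ψ'.IsPrimitive ∧ ∃ h : d ∣ b, DirichletCharacter.changeLevel h ψ' = ψ :=
    ⟨ψ.conductor, ψ.primitiveCharacter, ψ.primitiveCharacter_isPrimitive, ψ.conductor_dvd_level,
      ψ.changeLevel_primitiveCharacter⟩
  obtain ⟨m, rfl⟩ := hdb
  have hd : 1 ≤ d := Nat.pos_of_ne_zero (left_ne_zero_of_mul hb0)
  have hm : 1 ≤ m := Nat.pos_of_ne_zero (right_ne_zero_of_mul hb0)
  have : NeZero d := ⟨by omega⟩
  have hdy : (d : ℝ) ≤ Real.log y :=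
    le_trans (by exact_mod_cast Nat.le_mul_of_pos_right d hm) hb
  refine norm_sum_smoothHom_mul_gaussSum_div_le hm ⌊y⌋₊ χ hprim N fun X => ?_
  have h3 := h₂ y hy q χ D ξ d ψ' hd hDy hdy (hmin d ψ' hprim hdy) fun hD heq => by
    have : NeZero D := ⟨by omega⟩
    have hcond := congrArg DirichletCharacter.conductor heq
    rw [DirichletCharacter.conductor_changeLevel, DirichletCharacter.conductor_changeLevel,
      hξ, hprim] at hcond
    subst hcond
    exact hψ (dvd_mul_right _ _)
      (congrArg _ (DirichletCharacter.changeLevel_injective (dvd_mul_left _ _) heq))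
  have h4 : 1 ≤ Real.log y ^ (0.8545 : ℝ) := Real.one_le_rpow hL (by norm_num)
  calc _ ≤ _ := h₁ y (by linarith) q χ d ψ' hd X
    _ ≤ 1 * Real.log y ^ (0.8545 : ℝ) + K₁ * (K₂ * Real.log y ^ (0.8545 : ℝ)) := by
      gcongr
      linarith
    _ = _ := by ring

theorem apply_neg_one_changeLevel {D b : ℕ} [NeZero b] (h : D ∣ b) (ξ : DirichletCharacter ℂ D) :
    DirichletCharacter.changeLevel h ξ (-1) = ξ (-1) := by
  have := DirichletCharacter.changeLevel_eq_cast_of_dvd ξ h (-1 : (ZMod b)ˣ)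
  rw [Units.val_neg, Units.val_one, ZMod.cast_neg h, ZMod.cast_one h] at this
  exact this

/-- Lemma 12: the simplified Fourier expansion formula. -/
theorem formula2_lemma :
    ∃ C y₀ : ℝ, 0 < C ∧ 2 ≤ y₀ ∧
      ∀ y : ℝ, y₀ ≤ y →
        ∀ (q : ℕ) (χ : DirichletCharacter ℂ q) (D : ℕ) (ξ : DirichletCharacter ℂ D),
          ξ.IsPrimitive → (D : ℝ) ≤ Real.log y →
          (∀ (d₁ : ℕ) (ψ₁ : DirichletCharacter ℂ d₁), ψ₁.IsPrimitive →
            (d₁ : ℝ) ≤ Real.log y → Ddist χ ξ y ≤ Ddist χ ψ₁ y) →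
          ∀ (z : ℝ) (a : ℤ) (b : ℕ), 1 ≤ z → 1 ≤ b →
            (b : ℝ) ≤ Real.log y ^ ((1 : ℝ) / 100) → Int.gcd a b = 1 → b.Coprime q →
            ((¬ D ∣ b ∨ χ (-1) * ξ (-1) = 1) →
              ‖∑ n ∈ (Finset.Icc (-(⌊z⌋₊ : ℤ)) (⌊z⌋₊ : ℤ)).filter
                  (fun n => n ≠ 0 ∧ ∀ p : ℕ, p.Prime → (p : ℤ) ∣ n → (p : ℝ) ≤ y),
                  χ (n : ZMod q) * e2pi ((a : ℝ) * n / b) / n‖ ≤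
                C * Real.log y ^ (0.86 : ℝ)) ∧
            ((D ∣ b ∧ χ (-1) * ξ (-1) = -1) →
              ‖∑ n ∈ (Finset.Icc (-(⌊z⌋₊ : ℤ)) (⌊z⌋₊ : ℤ)).filter
                  (fun n => n ≠ 0 ∧ ∀ p : ℕ, p.Prime → (p : ℤ) ∣ n → (p : ℝ) ≤ y),
                  χ (n : ZMod q) * e2pi ((a : ℝ) * n / b) / n‖ ≤
                Real.log y *
                    min ((2 * Real.exp Real.eulerMascheroniConstant / Real.sqrt D) *
                        ((2 : ℝ) / 3) ^ (b / D).primeFactors.card)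
                      (Real.exp (-(Ddist χ ξ y) ^ 2 / 2 + C)) +
                  C * Real.log y ^ (0.86 : ℝ)) := by
  obtain ⟨K₁, hK₁, h₁⟩ := exists_norm_sum_smooth_le
  obtain ⟨K₂, y₁, hK₂, hy₁, h₂⟩ := exists_norm_nonmain_le
  obtain ⟨C₁, hC₁, h₃⟩ := exists_mertensProduct_le
  refine ⟨4 * K₂ + 2 * C₁ + 14 + 8 * K₁, y₁, by positivity, by linarith, ?_⟩
  intro y hy q χ D ξ hξ hDy hmin z a b _ hb1 hb hab hbq
  have : NeZero b := ⟨by omega⟩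
  set C := 4 * K₂ + 2 * C₁ + 14 + 8 * K₁ with hC
  have hL : 1 ≤ Real.log y := by
    rw [Real.le_log_iff_exp_le (by linarith)]
    linarith [Real.exp_one_lt_three]
  set L := Real.log y with hLdef
  have hL0 : 0 < L := by linarith
  have hbL : (b : ℝ) ≤ L := by
    refine hb.trans ?_
    conv_rhs => rw [← Real.rpow_one L]
    exact Real.rpow_le_rpow_of_exponent_le hL (by norm_num)
  have hL86 : 1 ≤ L ^ (0.86 : ℝ) := Real.one_le_rpow hL (by norm_num)
  have hb2 : (b : ℝ) ^ 2 ≤ L ^ (0.86 : ℝ) := by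
    calc (b : ℝ) ^ 2 ≤ (L ^ ((1 : ℝ) / 100)) ^ 2 := by gcongr
      _ = L ^ ((1 : ℝ) / 100 * 2) := by
        rw [Real.rpow_mul hL0.le]
        norm_num
      _ ≤ _ := Real.rpow_le_rpow_of_exponent_le hL (by norm_num)
  have hsb : √(b : ℝ) ≤ L ^ ((1 : ℝ) / 200) := by
    calc √(b : ℝ) ≤ √(L ^ ((1 : ℝ) / 100)) := Real.sqrt_le_sqrt hb
      _ = L ^ ((1 : ℝ) / 100 * (1 / 2)) := by rw [Real.sqrt_eq_rpow, ← Real.rpow_mul hL0.le]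
      _ = _ := by norm_num
  set T := 2 * √(b : ℝ) * (K₂ * L ^ (0.8545 : ℝ)) with hTdef
  have hT0 : 0 ≤ T := by positivity
  have hT : 2 * T ≤ 4 * K₂ * L ^ (0.86 : ℝ) := by
    calc 2 * T = 4 * K₂ * (√(b : ℝ) * L ^ (0.8545 : ℝ)) := by rw [hTdef]; ring
      _ ≤ 4 * K₂ * (L ^ ((1 : ℝ) / 200) * L ^ (0.8545 : ℝ)) := by gcongr
      _ = 4 * K₂ * L ^ ((1 : ℝ) / 200 + 0.8545) := by rw [Real.rpow_add hL0]
      _ ≤ _ := by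
        gcongr 4 * K₂ * ?_
        exact Real.rpow_le_rpow_of_exponent_le hL (by norm_num)
  have hφ : (0 : ℝ) < b.totient := by exact_mod_cast Nat.totient_pos.mpr hb1
  have hcard : (Finset.univ : Finset (DirichletCharacter ℂ b)).card = b.totient := by
    rw [Finset.card_univ, ← Nat.card_eq_fintype_card,
      DirichletCharacter.card_eq_totient_of_hasEnoughRootsOfUnity]
  have hS := norm_sum_filter_smooth_le χ hab (y := y) (by linarith) ⌊z⌋₊
  set H : DirichletCharacter ℂ b → ℂ := fun ψ => ∑ n ∈ Finset.Icc 1 ⌊z⌋₊,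
    smoothHom ⌊y⌋₊ (charHom χ) n *
      gaussSum ψ (ZMod.stdAddChar.mulShift (n : ZMod b)) / n with hH
  have hfac : ∀ ψ : DirichletCharacter ℂ b, ‖1 - χ (-1) * ψ (-1)‖ ≤ 2 := fun ψ => by
    refine (norm_sub_le _ _).trans ?_
    rw [norm_one, norm_mul]
    have := mul_le_one₀ (DirichletCharacter.norm_le_one χ (-1)) (norm_nonneg _)
      (DirichletCharacter.norm_le_one ψ (-1))
    linarith
  have hnon : ∀ ψ : DirichletCharacter ℂ b,
      (∀ h : D ∣ b, ψ ≠ DirichletCharacter.changeLevel h ξ) →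
        ‖1 - χ (-1) * ψ (-1)‖ * ‖H ψ‖ ≤ 2 * T := fun ψ hψ =>
    mul_le_mul (hfac ψ) (h₂ y hy q χ D ξ hξ hDy hmin b hbL ψ hψ ⌊z⌋₊) (norm_nonneg _) (by norm_num)
  refine ⟨fun hcase => hS.trans ?_, fun ⟨hDb, hsign⟩ => hS.trans ?_⟩
  · have hterm : ∀ ψ ∈ (Finset.univ : Finset (DirichletCharacter ℂ b)),
        ‖1 - χ (-1) * ψ (-1)‖ * ‖H ψ‖ ≤ 2 * T := by
      intro ψ _
      by_cases hψ : ∀ h : D ∣ b, ψ ≠ DirichletCharacter.changeLevel h ξ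
      · exact hnon ψ hψ
      · push Not at hψ
        obtain ⟨h, rfl⟩ := hψ
        rw [apply_neg_one_changeLevel, hcase.resolve_left (not_not.mpr h)]
        simpa using hT0
    have h5 := Finset.sum_le_card_nsmul _ _ _ hterm
    rw [hcard, nsmul_eq_mul] at h5
    calc _ ≤ 1 / (b.totient : ℝ) * (b.totient * (2 * T)) := by gcongr
      _ = 2 * T := by field_simp
      _ ≤ 4 * K₂ * L ^ (0.86 : ℝ) := hT
      _ ≤ _ := by
        gcongr
        linarith
  · set ψ₀ := DirichletCharacter.changeLevel hDb ξ with hψ₀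
    have hterm : ∀ ψ : DirichletCharacter ℂ b, ‖1 - χ (-1) * ψ (-1)‖ * ‖H ψ‖ ≤
        2 * T + if ψ = ψ₀ then 2 * ‖H ψ₀‖ else 0 := by
      intro ψ
      split_ifs with h
      · subst h
        have := mul_le_mul_of_nonneg_right (hfac ψ₀) (norm_nonneg (H ψ₀))
        linarith
      · rw [add_zero]
        exact hnon ψ fun _ => h
    have h5 := Finset.sum_le_sum fun ψ (_ : ψ ∈ Finset.univ) => hterm ψ
    rw [Finset.sum_add_distrib, Finset.sum_const, hcard, nsmul_eq_mul, Finset.sum_ite_eq',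
      if_pos (Finset.mem_univ _)] at h5
    have h6 : 1 / (b.totient : ℝ) * ∑ ψ : DirichletCharacter ℂ b,
        ‖1 - χ (-1) * ψ (-1)‖ * ‖H ψ‖ ≤ 2 * T + 2 / b.totient * ‖H ψ₀‖ := by
      calc _ ≤ 1 / (b.totient : ℝ) * (b.totient * (2 * T) + 2 * ‖H ψ₀‖) := by gcongr
        _ = _ := by field_simp
    refine h6.trans ?_
    clear h6 h5 hterm hnon hfac hcard hS
    obtain ⟨m, rfl⟩ := hDb
    have hD : 1 ≤ D := Nat.pos_of_ne_zero fun h => by simp [h] at hb1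
    have hm : 1 ≤ m := Nat.pos_of_ne_zero fun h => by simp [h] at hb1
    have : NeZero D := ⟨by omega⟩
    have hyY : D * m ≤ ⌊y⌋₊ := Nat.le_floor (hbL.trans (Real.log_le_self (by linarith)))
    have hmq : m.Coprime q := hbq.coprime_dvd_left (dvd_mul_left m D)
    have hmain := norm_main_sum_le hm ((Nat.le_mul_of_pos_left m hD).trans hyY) hmq χ hξ ⌊z⌋₊
    have h7 : 2 / ((D * m).totient : ℝ) * ‖H ψ₀‖ ≤ _ :=
      mul_le_mul_of_nonneg_left hmain (by positivity)
    have hY2 : 2 ≤ ⌊y⌋₊ := Nat.le_floor (by push_cast; linarith)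
    have hA := h7.trans (main_term_le_mertensProduct hD hm hyY hmq χ ξ ⌊z⌋₊)
    have hB := h7.trans (main_term_le_of_norm_smoothLogSum_le hD hm χ ξ ⌊z⌋₊
      (h₁ y (by linarith) q χ D ξ hD ⌊z⌋₊))
    rw [Nat.mul_div_cancel_left m hD, mul_min_of_nonneg _ _ hL0.le, ← min_add_add_right]
    refine le_min ?_ ?_
    · have hM : mertensProduct ⌊y⌋₊ ≤ Real.exp Real.eulerMascheroniConstant * L + C₁ := by
        refine (h₃ _ hY2).trans ?_
        gcongr
        exact Real.log_le_log (by exact_mod_cast (show 0 < ⌊y⌋₊ by omega))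
          (Nat.floor_le (by linarith))
      set w := ((2 : ℝ) / 3) ^ m.primeFactors.card
      have hw1 : w ≤ 1 := pow_le_one₀ (by norm_num) (by norm_num)
      have hw0 : 0 ≤ w := by positivity
      have hs1 : 1 ≤ √(D : ℝ) := Real.one_le_sqrt.mpr (by exact_mod_cast hD)
      have h8 : 2 / √(D : ℝ) * w * C₁ ≤ 2 / 1 * 1 * C₁ := by gcongr
      calc 2 * T + 2 / ((D * m).totient : ℝ) * ‖H ψ₀‖
          ≤ 4 * K₂ * L ^ (0.86 : ℝ) + (2 / √D * w * (Real.exp Real.eulerMascheroniConstant * L + C₁)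
            + 4 * ((D * m : ℕ) : ℝ) ^ 2) := by
            refine add_le_add hT (hA.trans ?_)
            gcongr
        _ = L * (2 * Real.exp Real.eulerMascheroniConstant / √D * w) + (4 * K₂ * L ^ (0.86 : ℝ) +
            2 / √D * w * C₁ + 4 * ((D * m : ℕ) : ℝ) ^ 2) := by ring
        _ ≤ _ := by
            gcongr
            rw [hC]
            nlinarith
    · have hexp : 8 * K₁ ≤ Real.exp C := by
        have := Real.add_one_le_exp C
        linarith
      set E := Real.exp (-(Ddist χ ξ y) ^ 2 / 2)
      have hE : L * (8 * K₁ * E) ≤ L * Real.exp (-(Ddist χ ξ y) ^ 2 / 2 + C) := by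
        rw [Real.exp_add, mul_comm _ (Real.exp C)]
        gcongr
      calc 2 * T + 2 / ((D * m).totient : ℝ) * ‖H ψ₀‖
          ≤ 4 * K₂ * L ^ (0.86 : ℝ) + (8 * (1 + K₁ * (L * E)) + 2 * ((D * m : ℕ) : ℝ) ^ 2) :=
            add_le_add hT hB
        _ = L * (8 * K₁ * E) + (4 * K₂ * L ^ (0.86 : ℝ) + 8 + 2 * ((D * m : ℕ) : ℝ) ^ 2) := by ring
        _ ≤ _ := by
            refine add_le_add hE ?_
            rw [hC]
            nlinarith
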